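/- arXiv:2108.04887 — 3 statements merged into one kernel-verified Lean document; each statement's English description precedes it below -/
import Mathlib

section
/- Let Φ be of the form (IA) and fix an integer m̄ with 2 ≤ m̄ ≤ N − 10. For all constants K₁, …, K_{m̄−1} > 0 (with K₁ large enough depending on Φ, and each K_j large enough depending on Φ, K₁, …, K_{j−1}), there exist K_{m̄} > 0 and δ > 0 such that the following holds. Let f : [0, x_MAX] → ℝ be C^∞ with 0 < x_MAX ≤ δ, |f(x)| ≤ x^N and |f^(m)(x)| ≤ K_m x^(N−m) on [0, x_MAX] for m = 1, …, m̄. Suppose the image Φ({(x, f(x)) : x ∈ [0, x_MAX]}) is the graph {(X, F(X)) : X ∈ [0, X_MAX]} of a C^∞ function F satisfying |F(X)| ≤ X^N and |F^(m)(X)| ≤ K_m X^(N−m) on [0, X_MAX] for m = 1, …, m̄−1. Then |F^(m̄)(X)| ≤ K_{m̄} X^(N−m̄) on [0, X_MAX]. -/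
open Set Filter Asymptotics Topology

/-- First component of a map `Φ` of the form (IA):
`X = x + x² + x³ θ_A(x,y) + y θ_B(x,y)`. -/
noncomputable def XIA (θA θB : ℝ × ℝ → ℝ) (x y : ℝ) : ℝ :=
  x + x ^ 2 + x ^ 3 * θA (x, y) + y * θB (x, y)

/-- Second component of a map `Φ` of the form (IA):
`Y = -y(1 - λx + y θ_C(x,y) + x² θ_D(x,y)) + x^(N+100) θ_E(x,y)`. -/
noncomputable def YIA (θC θD θE : ℝ × ℝ → ℝ) (lam : ℝ) (N : ℕ) (x y : ℝ) : ℝ :=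
  -y * (1 - lam * x + y * θC (x, y) + x ^ 2 * θD (x, y)) + x ^ (N + 100) * θE (x, y)

/-- A family of functions `u i`, smooth on `[0, a i]`, whose derivatives of order `j ≤ k` are
bounded by `C x ^ (p - j)` with a constant `C` that does not depend on `i`. -/
def FlatBound {ι : Type*} (a : ι → ℝ) (k p : ℕ) (u : ι → ℝ → ℝ) : Prop :=
  (∀ i, ContDiffOn ℝ (⊤ : ℕ∞) (u i) (Icc 0 (a i))) ∧
    ∃ C : ℝ, ∀ i, ∀ j ≤ k, ∀ x ∈ Icc 0 (a i),
      |iteratedDerivWithin j (u i) (Icc 0 (a i)) x| ≤ C * x ^ (p - j)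

namespace FlatBound

variable {ι : Type*} {a : ι → ℝ} {k l p q : ℕ} {u v : ι → ℝ → ℝ}

theorem differentiableWithinAt (hu : FlatBound a k p u) {i : ι} {x : ℝ} (hx : x ∈ Icc 0 (a i)) :
    DifferentiableWithinAt ℝ (u i) (Icc 0 (a i)) x :=
  (hu.1 i).differentiableOn (by simp) x hx

theorem exists_pos (hu : FlatBound a k p u) :
    ∃ C > 0, ∀ i, ∀ j ≤ k, ∀ x ∈ Icc 0 (a i),
      |iteratedDerivWithin j (u i) (Icc 0 (a i)) x| ≤ C * x ^ (p - j) := by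
  obtain ⟨C, hC⟩ := hu.2
  refine ⟨|C| + 1, by positivity, fun i j hj x hx => (hC i j hj x hx).trans ?_⟩
  have := hx.1
  gcongr
  linarith [le_abs_self C]

theorem mono (hu : FlatBound a k p u) (ha1 : ∀ i, a i ≤ 1) (hl : l ≤ k) (hq : q ≤ p) :
    FlatBound a l q u := by
  obtain ⟨C, hC0, hC⟩ := hu.exists_pos
  refine ⟨hu.1, C, fun i j hj x hx => (hC i j (hj.trans hl) x hx).trans ?_⟩
  exact mul_le_mul_of_nonneg_left
    (pow_le_pow_of_le_one hx.1 (hx.2.trans (ha1 i)) (by omega)) hC0.le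

theorem congr (hu : FlatBound a k p u) (h : ∀ i, EqOn (v i) (u i) (Icc 0 (a i))) :
    FlatBound a k p v := by
  refine ⟨fun i => (hu.1 i).congr (h i), ?_⟩
  obtain ⟨C, hC⟩ := hu.2
  refine ⟨C, fun i j hj x hx => ?_⟩
  rw [iteratedDerivWithin_congr (h i) hx]
  exact hC i j hj x hx

theorem comap {κ : Type*} (hu : FlatBound a k p u) (g : κ → ι) :
    FlatBound (fun i => a (g i)) k p (fun i => u (g i)) :=
  ⟨fun i => hu.1 (g i), hu.2.imp fun _ hC i => hC (g i)⟩

theorem derivWithin_family (hu : FlatBound a (k + 1) p u) (ha0 : ∀ i, 0 < a i) :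
    FlatBound a k (p - 1) (fun i => derivWithin (u i) (Icc 0 (a i))) := by
  refine ⟨fun i => (hu.1 i).derivWithin (uniqueDiffOn_Icc (ha0 i)) (by simp), ?_⟩
  obtain ⟨C, hC⟩ := hu.2
  refine ⟨C, fun i j hj x hx => ?_⟩
  have := hC i (j + 1) (by omega) x hx
  rwa [iteratedDerivWithin_succ', show p - (j + 1) = p - 1 - j by omega] at this

theorem iteratedDerivWithin_family (ha0 : ∀ i, 0 < a i) (j : ℕ) (hu : FlatBound a (k + j) p u) :
    FlatBound a k (p - j) (fun i => iteratedDerivWithin j (u i) (Icc 0 (a i))) := by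
  induction j generalizing p u with
  | zero => simpa using hu
  | succ j ih =>
    have := ih (FlatBound.derivWithin_family (k := k + j) hu ha0)
    simp only [iteratedDerivWithin_succ']
    rwa [show p - (j + 1) = p - 1 - j by omega]

theorem of_bound (hu : ∀ i, ContDiffOn ℝ (⊤ : ℕ∞) (u i) (Icc 0 (a i))) {C : ℝ}
    (hC : ∀ i, ∀ x ∈ Icc 0 (a i), |u i x| ≤ C * x ^ p) : FlatBound a 0 p u := by
  refine ⟨hu, C, fun i j hj x hx => ?_⟩
  obtain rfl : j = 0 := by omega
  simpa using hC i x hx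

theorem abs_le (hu : FlatBound a k p u) :
    ∃ C > 0, ∀ i, ∀ x ∈ Icc 0 (a i), |u i x| ≤ C * x ^ p := by
  obtain ⟨C, hC0, hC⟩ := hu.exists_pos
  exact ⟨C, hC0, fun i x hx => by simpa using hC i 0 (by omega) x hx⟩

theorem succ (hu : FlatBound a 0 p u)
    (hu' : FlatBound a k (p - 1) (fun i => derivWithin (u i) (Icc 0 (a i)))) :
    FlatBound a (k + 1) p u := by
  refine ⟨hu.1, ?_⟩
  obtain ⟨C, hC0, hC⟩ := hu.exists_pos
  obtain ⟨D, hD0, hD⟩ := hu'.exists_pos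
  refine ⟨C + D, fun i j hj x hx => ?_⟩
  have hx0 := hx.1
  have h1 : 0 ≤ C * x ^ (p - j) := by positivity
  have h2 : 0 ≤ D * x ^ (p - j) := by positivity
  rw [add_mul]
  cases j with
  | zero => linarith [hC i 0 le_rfl x hx]
  | succ j =>
    have := hD i j (by omega) x hx
    rw [show p - 1 - j = p - (j + 1) by omega] at this
    rw [iteratedDerivWithin_succ']
    linarith

theorem add (ha0 : ∀ i, 0 < a i) (hu : FlatBound a k p u) (hv : FlatBound a k p v) :
    FlatBound a k p (fun i x => u i x + v i x) := by
  refine ⟨fun i => (hu.1 i).add (hv.1 i), ?_⟩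
  obtain ⟨C, hC⟩ := hu.2
  obtain ⟨D, hD⟩ := hv.2
  refine ⟨C + D, fun i j hj x hx => ?_⟩
  have hsm {w : ι → ℝ → ℝ} (hw : FlatBound a k p w) :
      ContDiffWithinAt ℝ j (w i) (Icc 0 (a i)) x :=
    ((hw.1 i) x hx).of_le (by exact_mod_cast le_top)
  rw [iteratedDerivWithin_fun_add hx (uniqueDiffOn_Icc (ha0 i)) (hsm hu) (hsm hv), add_mul]
  exact (abs_add_le _ _).trans (add_le_add (hC i j hj x hx) (hD i j hj x hx))

theorem mul (ha0 : ∀ i, 0 < a i) (ha1 : ∀ i, a i ≤ 1)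
    (hu : FlatBound a k p u) (hv : FlatBound a k q v) :
    FlatBound a k (p + q) (fun i x => u i x * v i x) := by
  have hzero {p q : ℕ} {u v : ι → ℝ → ℝ} (hu : FlatBound a 0 p u) (hv : FlatBound a 0 q v) :
      FlatBound a 0 (p + q) (fun i x => u i x * v i x) := by
    obtain ⟨C, hC0, hC⟩ := hu.abs_le
    obtain ⟨D, hD0, hD⟩ := hv.abs_le
    refine of_bound (C := C * D) (fun i => (hu.1 i).mul (hv.1 i)) fun i x hx => ?_
    have hx0 := hx.1
    rw [abs_mul, show C * D * x ^ (p + q) = (C * x ^ p) * (D * x ^ q) by ring]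
    exact mul_le_mul (hC i x hx) (hD i x hx) (abs_nonneg _) (by positivity)
  induction k generalizing p q u v with
  | zero => exact hzero hu hv
  | succ k ih =>
    refine succ (hzero (hu.mono ha1 (by omega) le_rfl) (hv.mono ha1 (by omega) le_rfl)) ?_
    have h1 := (ih (hu.derivWithin_family ha0) (hv.mono ha1 (l := k) (by omega) le_rfl)).mono ha1
      le_rfl (q := p + q - 1) (by omega)
    have h2 := (ih (hu.mono ha1 (l := k) (by omega) le_rfl) (hv.derivWithin_family ha0)).mono ha1
      le_rfl (q := p + q - 1) (by omega)
    exact (h1.add ha0 h2).congr fun i x hx =>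
      derivWithin_fun_mul (hu.differentiableWithinAt hx) (hv.differentiableWithinAt hx)

theorem const (c : ℝ) : FlatBound a k 0 (fun _ _ => c) := by
  refine ⟨fun i => contDiffOn_const, |c|, fun i j hj x hx => ?_⟩
  rw [iteratedDerivWithin_const]
  split_ifs <;> simp

theorem id (ha0 : ∀ i, 0 < a i) : FlatBound a k 1 (fun _ x => x) := by
  have h0 : FlatBound a 0 1 (fun _ x => x) :=
    of_bound (C := 1) (fun i => contDiffOn_id) fun i x hx => by simp [abs_of_nonneg hx.1]
  cases k with
  | zero => exact h0
  | succ k =>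
    exact succ h0 ((const 1).congr fun i x hx =>
      derivWithin_id' x _ (uniqueDiffOn_Icc (ha0 i) x hx))

theorem pow (ha0 : ∀ i, 0 < a i) (ha1 : ∀ i, a i ≤ 1) (hu : FlatBound a k p u) (n : ℕ) :
    FlatBound a k (n * p) (fun i x => u i x ^ n) := by
  induction n with
  | zero => simpa using const (a := a) (k := k) 1
  | succ n ih => simpa only [pow_succ, add_mul, one_mul] using ih.mul ha0 ha1 hu

theorem inv (ha0 : ∀ i, 0 < a i) (ha1 : ∀ i, a i ≤ 1) (hu : FlatBound a k 0 u)
    (h1 : ∀ i, ∀ x ∈ Icc 0 (a i), 1 ≤ u i x) :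
    FlatBound a k 0 (fun i x => (u i x)⁻¹) := by
  have h0 : FlatBound a 0 0 (fun i x => (u i x)⁻¹) := by
    refine of_bound (C := 1) (fun i => (hu.1 i).inv fun x hx => by linarith [h1 i x hx]) ?_
    intro i x hx
    have := h1 i x hx
    rw [abs_of_nonneg (by positivity)]
    simpa using inv_le_one_of_one_le₀ this
  induction k with
  | zero => exact h0
  | succ k ih =>
    have hi := ih (hu.mono ha1 (by omega) le_rfl)
    have := ((const (-1)).mul ha0 ha1 (hu.derivWithin_family ha0)).mul ha0 ha1 (hi.pow ha0 ha1 2)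
    refine succ h0 (this.congr fun i x hx => ?_)
    have hne : u i x ≠ 0 := by linarith [h1 i x hx]
    have := (hu.differentiableWithinAt hx).hasDerivWithinAt.fun_inv hne
    rw [this.derivWithin (uniqueDiffOn_Icc (ha0 i) x hx)]
    field_simp

theorem comp_graph (ha0 : ∀ i, 0 < a i) (ha1 : ∀ i, a i ≤ 1) {θ : ℝ × ℝ → ℝ}
    {U B : Set (ℝ × ℝ)} (hU : IsOpen U) (hB : IsCompact B) (hBU : B ⊆ U)
    (hθ : ContDiffOn ℝ (⊤ : ℕ∞) θ U) (hu : FlatBound a k 0 u)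
    (hmem : ∀ i, ∀ x ∈ Icc 0 (a i), (x, u i x) ∈ B) :
    FlatBound a k 0 (fun i x => θ (x, u i x)) := by
  have hzero {θ : ℝ × ℝ → ℝ} (hθ : ContDiffOn ℝ (⊤ : ℕ∞) θ U) :
      FlatBound a 0 0 (fun i x => θ (x, u i x)) := by
    obtain ⟨C, hC⟩ := hB.exists_bound_of_continuousOn (hθ.continuousOn.mono hBU)
    refine of_bound (C := C) (fun i => ?_) fun i x hx => by simpa using hC _ (hmem i x hx)
    exact hθ.comp (contDiffOn_id.prodMk (hu.1 i)) fun x hx => hBU (hmem i x hx)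
  induction k generalizing θ with
  | zero => exact hzero hθ
  | succ k ih =>
    have hd (w : ℝ × ℝ) : ContDiffOn ℝ (⊤ : ℕ∞) (fun z => fderiv ℝ θ z w) U :=
      (hθ.fderiv_of_isOpen hU (by simp)).clm_apply contDiffOn_const
    have hu' := hu.mono ha1 (l := k) (by omega) le_rfl
    have := (ih (hd (1, 0)) hu').add ha0 ((hu.derivWithin_family ha0).mul ha0 ha1 (ih (hd (0, 1)) hu'))
    refine succ (hzero hθ) (this.congr fun i x hx => ?_)
    have hxU := hU.mem_nhds (hBU (hmem i x hx))
    have h1 : HasFDerivAt θ (fderiv ℝ θ (x, u i x)) (x, u i x) :=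
      ((hθ.contDiffAt hxU).differentiableAt (by simp)).hasFDerivAt
    have h2 := (hasDerivWithinAt_id x (Icc 0 (a i))).prodMk
      (hu.differentiableWithinAt hx).hasDerivWithinAt
    have h3 := h1.comp_hasDerivWithinAt x h2
    refine (h3.derivWithin (uniqueDiffOn_Icc (ha0 i) x hx)).trans ?_
    set d := derivWithin (u i) (Icc 0 (a i)) x
    rw [show ((1 : ℝ), d) = (1, 0) + d • ((0 : ℝ), (1 : ℝ)) by simp, map_add, map_smul,
      smul_eq_mul]

/-- Leibniz rule in which only the term carrying the top derivative of `u` is kept. -/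
theorem iteratedDerivWithin_mul_eq (ha0 : ∀ i, 0 < a i) (ha1 : ∀ i, a i ≤ 1) {n : ℕ}
    (hu : FlatBound a (n - 1) q u) (hv : FlatBound a n 0 v) :
    ∀ j ≤ n, ∃ r : ι → ℝ → ℝ, FlatBound a (n - j) (q + 1 - j) r ∧
      ∀ i, ∀ x ∈ Icc 0 (a i),
        iteratedDerivWithin j (fun x => u i x * v i x) (Icc 0 (a i)) x =
          iteratedDerivWithin j (u i) (Icc 0 (a i)) x * v i x + r i x := by
  intro j
  induction j with
  | zero =>
    intro _
    refine ⟨fun _ _ => 0, ⟨fun i => contDiffOn_const, 0, fun i j hj x hx => ?_⟩, ?_⟩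
    · rw [iteratedDerivWithin_const]; simp
    · simp
  | succ j ih =>
    intro hj
    obtain ⟨r, hr, hrr⟩ := ih (by omega)
    have hr' : FlatBound a (n - (j + 1) + 1) (q + 1 - j) r := by
      rwa [show n - (j + 1) + 1 = n - j by omega]
    have huj : FlatBound a (n - (j + 1)) (q - j)
        (fun i => iteratedDerivWithin j (u i) (Icc 0 (a i))) :=
      FlatBound.iteratedDerivWithin_family ha0 j (hu.mono ha1 (by omega) le_rfl)
    have hv' : FlatBound a (n - (j + 1)) 0 (fun i => derivWithin (v i) (Icc 0 (a i))) :=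
      FlatBound.derivWithin_family (hv.mono ha1 (by omega) le_rfl) ha0
    refine ⟨_, ((huj.mul ha0 ha1 hv').mono ha1 le_rfl (by omega)).add ha0
      ((hr'.derivWithin_family ha0).mono ha1 le_rfl (by omega)), fun i x hx => ?_⟩
    rw [iteratedDerivWithin_succ, derivWithin_congr (hrr i) (hrr i x hx)]
    have hd := huj.differentiableWithinAt hx
    have hvd := hv.differentiableWithinAt hx
    rw [derivWithin_fun_add (hd.fun_mul hvd) (hr.differentiableWithinAt hx),
      derivWithin_fun_mul hd hvd, iteratedDerivWithin_succ]
    ring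

/-- Iterating `w · d/dx` on `u` gives `w ^ j · u⁽ʲ⁾` up to a term of higher order. -/
theorem iterate_mul_derivWithin_eq (ha0 : ∀ i, 0 < a i) (ha1 : ∀ i, a i ≤ 1) {n : ℕ}
    {w : ι → ℝ → ℝ} {z : ℕ → ι → ℝ → ℝ}
    (hw : FlatBound a (n - 1) 0 w) (hu : FlatBound a (n - 1) q u)
    (hz0 : ∀ i, ∀ x ∈ Icc 0 (a i), z 0 i x = u i x)
    (hz : ∀ j i, ∀ x ∈ Icc 0 (a i),
      z (j + 1) i x = w i x * derivWithin (z j i) (Icc 0 (a i)) x) :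
    ∀ j ≤ n, ∃ r : ι → ℝ → ℝ, FlatBound a (n - j) (q + 1 - j) r ∧
      ∀ i, ∀ x ∈ Icc 0 (a i),
        z j i x = w i x ^ j * iteratedDerivWithin j (u i) (Icc 0 (a i)) x + r i x := by
  intro j
  induction j with
  | zero =>
    intro _
    refine ⟨fun _ _ => 0, ⟨fun i => contDiffOn_const, 0, fun i j hj x hx => ?_⟩, ?_⟩
    · rw [iteratedDerivWithin_const]; simp
    · simpa using hz0
  | succ j ih =>
    intro hj
    obtain ⟨r, hr, hrr⟩ := ih (by omega)
    have hr' : FlatBound a (n - (j + 1) + 1) (q + 1 - j) r := by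
      rwa [show n - (j + 1) + 1 = n - j by omega]
    have huj : FlatBound a (n - (j + 1)) (q - j)
        (fun i => iteratedDerivWithin j (u i) (Icc 0 (a i))) :=
      FlatBound.iteratedDerivWithin_family ha0 j (hu.mono ha1 (by omega) le_rfl)
    have hwj : FlatBound a (n - (j + 1) + 1) 0 (fun i x => w i x ^ j) := by
      cases j with
      | zero => simpa using const (a := a) 1
      | succ j => exact (hw.pow ha0 ha1 (j + 1)).mono ha1 (by omega) (by omega)
    have hw' : FlatBound a (n - (j + 1)) 0 w := hw.mono ha1 (by omega) le_rfl
    refine ⟨_, (((hw'.mul ha0 ha1 (hwj.derivWithin_family ha0)).mul ha0 ha1 huj).mono ha1 le_rfl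
      (by omega)).add ha0 ((hw'.mul ha0 ha1 (hr'.derivWithin_family ha0)).mono ha1 le_rfl (by omega)),
      fun i x hx => ?_⟩
    have hd := huj.differentiableWithinAt hx
    have hwd := hwj.differentiableWithinAt hx
    rw [hz j i x hx, derivWithin_congr (hrr i) (hrr i x hx),
      derivWithin_fun_add (hwd.fun_mul hd) (hr.differentiableWithinAt hx),
      derivWithin_fun_mul hwd hd, iteratedDerivWithin_succ]
    ring

end FlatBound

theorem XIA_flatBound {θA θB : ℝ × ℝ → ℝ} {ι : Type*} {a : ι → ℝ} {f : ι → ℝ → ℝ} {n q : ℕ}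
    (ha0 : ∀ i, 0 < a i) (ha1 : ∀ i, a i ≤ 1) (hn : 1 ≤ n) (hq : 3 ≤ q)
    (hf : FlatBound a n q f)
    (hA : FlatBound a n 0 (fun i x => θA (x, f i x)))
    (hB : FlatBound a n 0 (fun i x => θB (x, f i x))) :
    FlatBound a n 0 (fun i x => XIA θA θB x (f i x)) ∧
      ∃ C > 0, ∀ i, ∀ x ∈ Icc 0 (a i),
        |XIA θA θB x (f i x) - (x + x ^ 2)| ≤ C * x ^ 3 ∧
        |derivWithin (fun x => XIA θA θB x (f i x)) (Icc 0 (a i)) x - (1 + 2 * x)|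
          ≤ C * x ^ 2 := by
  have hx : FlatBound a n 1 (fun _ x => x) := FlatBound.id ha0
  have hR := (((hx.pow ha0 ha1 3).mul ha0 ha1 hA).mono ha1 le_rfl (q := 3) (by omega)).add ha0
    ((hf.mul ha0 ha1 hB).mono ha1 le_rfl (q := 3) (by omega))
  have hX : ∀ i, EqOn (fun x => XIA θA θB x (f i x))
      (fun x => (x + x ^ 2) + (x ^ 3 * θA (x, f i x) + f i x * θB (x, f i x)))
      (Icc 0 (a i)) := fun i x _ => by simp only [XIA]; ring
  have hsum := (((hx.mono ha1 le_rfl (q := 0) (by omega)).add ha0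
    ((hx.pow ha0 ha1 2).mono ha1 le_rfl (q := 0) (by omega))).add ha0
      (hR.mono ha1 le_rfl (q := 0) (by omega)))
  refine ⟨hsum.congr hX, ?_⟩
  obtain ⟨C, hC0, hC⟩ := hR.exists_pos
  refine ⟨C, hC0, fun i x hxi => ⟨?_, ?_⟩⟩
  · have := hC i 0 (by omega) x hxi
    rw [iteratedDerivWithin_zero] at this
    rwa [show XIA θA θB x (f i x) = _ from hX i hxi, add_sub_cancel_left]
  · have := hC i 1 hn x hxi
    rw [iteratedDerivWithin_one] at this
    have hd : HasDerivWithinAt (fun x : ℝ => x + x ^ 2) (1 + 2 * x) (Icc 0 (a i)) x := by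
      simpa using ((hasDerivAt_id' x).fun_add (hasDerivAt_pow 2 x)).hasDerivWithinAt
    rw [derivWithin_congr (hX i) (hX i hxi),
      derivWithin_fun_add hd.differentiableWithinAt (hR.differentiableWithinAt hxi),
      hd.derivWithin (uniqueDiffOn_Icc (ha0 i) x hxi), add_sub_cancel_left]
    exact this

theorem YIA_flatBound {θC θD θE : ℝ × ℝ → ℝ} {lam : ℝ} {N : ℕ} {ι : Type*} {a : ι → ℝ}
    {f : ι → ℝ → ℝ} {n : ℕ}
    (ha0 : ∀ i, 0 < a i) (ha1 : ∀ i, a i ≤ 1) (hN : 3 ≤ N)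
    (hf : FlatBound a n (N - 1) f) (hf' : FlatBound a (n - 1) N f)
    (hC : FlatBound a n 0 (fun i x => θC (x, f i x)))
    (hD : FlatBound a n 0 (fun i x => θD (x, f i x)))
    (hE : FlatBound a n 0 (fun i x => θE (x, f i x))) :
    FlatBound a (n - 1) N (fun i x => YIA θC θD θE lam N x (f i x)) ∧
      ∃ C > 0, ∀ i, ∀ x ∈ Icc 0 (a i), ∃ G : ℝ, |G - (1 - lam * x)| ≤ C * x ^ 2 ∧
        |iteratedDerivWithin n (fun x => YIA θC θD θE lam N x (f i x)) (Icc 0 (a i)) x +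
          iteratedDerivWithin n (f i) (Icc 0 (a i)) x * G| ≤ C * x ^ (N + 1 - n) := by
  have hx : FlatBound a n 1 (fun _ x => x) := FlatBound.id ha0
  have hR := ((hf.mul ha0 ha1 hC).mono ha1 le_rfl (q := 2) (by omega)).add ha0
    (((hx.pow ha0 ha1 2).mul ha0 ha1 hD).mono ha1 le_rfl (q := 2) (by omega))
  have hG' := ((FlatBound.const 1).add ha0
    (((FlatBound.const (-lam)).mul ha0 ha1 hx).mono ha1 le_rfl (q := 0) (by omega))).add ha0
      (hR.mono ha1 le_rfl (q := 0) (by omega))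
  have hG := (FlatBound.const (-1)).mul ha0 ha1 hG'
  have hP := (hx.pow ha0 ha1 (N + 100)).mul ha0 ha1 hE
  have hY : ∀ i, EqOn (fun x => YIA θC θD θE lam N x (f i x))
      (fun x => f i x * (-1 * ((1 + -lam * x) + (f i x * θC (x, f i x) + x ^ 2 * θD (x, f i x)))) +
        x ^ (N + 100) * θE (x, f i x)) (Icc 0 (a i)) :=
    fun i x _ => by simp only [YIA]; ring
  refine ⟨(((hf'.mul ha0 ha1 (hG.mono ha1 (by omega) le_rfl)).mono ha1 le_rfl
    (by omega)).add ha0 (hP.mono ha1 (by omega) (by omega))).congr hY, ?_⟩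
  obtain ⟨r, hr, hrr⟩ := hf'.iteratedDerivWithin_mul_eq ha0 ha1 hG n le_rfl
  obtain ⟨C₁, hC₁, h₁⟩ := hR.abs_le
  obtain ⟨C₂, hC₂, h₂⟩ := hr.abs_le
  obtain ⟨C₃, hC₃, h₃⟩ := (hP.mono ha1 le_rfl (q := N + 1) (by omega)).exists_pos
  refine ⟨C₁ + (C₂ + C₃), by positivity, fun i x hxi => ?_⟩
  have hx0 := hxi.1
  have h₁ := h₁ i x hxi
  have h₂ := h₂ i x hxi
  have h₃ := h₃ i n le_rfl x hxi
  have hpow2 : 0 ≤ (C₂ + C₃) * x ^ 2 := by positivity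
  have hpown : 0 ≤ C₁ * x ^ (N + 1 - n) := by positivity
  refine ⟨(1 + -lam * x) + (f i x * θC (x, f i x) + x ^ 2 * θD (x, f i x)), ?_, ?_⟩
  · rw [show (1 + -lam * x) + (f i x * θC (x, f i x) + x ^ 2 * θD (x, f i x)) - (1 - lam * x)
      = f i x * θC (x, f i x) + x ^ 2 * θD (x, f i x) by ring]
    linarith
  · rw [iteratedDerivWithin_congr (hY i) hxi,
      iteratedDerivWithin_fun_add hxi (uniqueDiffOn_Icc (ha0 i))
        (((hf.1 i).mul (hG.1 i) x hxi).of_le (by exact_mod_cast le_top))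
        ((hP.1 i x hxi).of_le (by exact_mod_cast le_top)), hrr i x hxi]
    refine le_trans ?_ (show C₂ * x ^ (N + 1 - n) + C₃ * x ^ (N + 1 - n) ≤ _ by linarith)
    refine le_trans (le_of_eq (congrArg _ ?_)) ((abs_add_le _ _).trans (add_le_add h₂ h₃))
    ring

theorem iteratedDerivWithin_graph_transform {ι : Type*} {a b : ι → ℝ}
    {X Y F : ι → ℝ → ℝ} {n q : ℕ} (ha0 : ∀ i, 0 < a i) (ha1 : ∀ i, a i ≤ 1) (hb : ∀ i, 0 < b i)
    (hn : 1 ≤ n) (hX : FlatBound a n 0 X)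
    (hX1 : ∀ i, ∀ x ∈ Icc 0 (a i), 1 ≤ derivWithin (X i) (Icc 0 (a i)) x)
    (hY : FlatBound a (n - 1) q Y)
    (hF : ∀ i, ContDiffOn ℝ (⊤ : ℕ∞) (F i) (Icc 0 (b i)))
    (hmaps : ∀ i, MapsTo (X i) (Icc 0 (a i)) (Icc 0 (b i)))
    (hFX : ∀ i, ∀ x ∈ Icc 0 (a i), F i (X i x) = Y i x) :
    ∃ C > 0, ∀ i, ∀ x ∈ Icc 0 (a i), ∃ w : ℝ, 0 ≤ w ∧ w ≤ 1 ∧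
      |iteratedDerivWithin n (F i) (Icc 0 (b i)) (X i x) -
        w * iteratedDerivWithin n (Y i) (Icc 0 (a i)) x| ≤ C * x ^ (q + 1 - n) := by
  have hX' : FlatBound a (n - 1 + 1) 0 X := by rwa [Nat.sub_add_cancel hn]
  have hw := (hX'.derivWithin_family ha0).inv ha0 ha1 hX1
  obtain ⟨r, hr, hrr⟩ := FlatBound.iterate_mul_derivWithin_eq ha0 ha1
    (z := fun j i x => iteratedDerivWithin j (F i) (Icc 0 (b i)) (X i x)) hw hY
    (fun i x hx => by simpa using hFX i x hx) (fun j i x hx => by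
      have h1 := ((hF i).differentiableOn_iteratedDerivWithin (m := j)
        (by exact_mod_cast WithTop.coe_lt_top _) (uniqueDiffOn_Icc (hb i))
        (X i x) (hmaps i hx)).hasDerivWithinAt
      have h2 := (h1.comp x (hX.differentiableWithinAt hx).hasDerivWithinAt
        (hmaps i)).derivWithin (uniqueDiffOn_Icc (ha0 i) x hx)
      have hne : derivWithin (X i) (Icc 0 (a i)) x ≠ 0 := by linarith [hX1 i x hx]
      simp only [Function.comp_def] at h2
      rw [h2, iteratedDerivWithin_succ]
      field_simp) n le_rfl
  obtain ⟨C, hC0, hC⟩ := hr.abs_le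
  refine ⟨C, hC0, fun i x hx => ⟨(derivWithin (X i) (Icc 0 (a i)) x)⁻¹ ^ n, ?_, ?_, ?_⟩⟩
  · have := hX1 i x hx
    positivity
  · have := hX1 i x hx
    exact pow_le_one₀ (by positivity) (inv_le_one_of_one_le₀ this)
  · rw [hrr i x hx, add_sub_cancel_left]
    exact hC i x hx

theorem abs_le_of_contraction {S T w φ G x P lam K C₁ C₂ : ℝ} (hw0 : 0 ≤ w) (hw1 : w ≤ 1)
    (hx0 : 0 ≤ x) (hP : 0 ≤ P) (hK : 0 ≤ K) (hS : |S - w * T| ≤ C₂ * (x * P))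
    (hT : |T + φ * G| ≤ C₁ * (x * P)) (hφ : |φ| ≤ K * P)
    (hG : |G - (1 - lam * x)| ≤ C₁ * x ^ 2) (hx1 : lam * x ≤ 1) (hx2 : C₁ * x ≤ lam / 2)
    (hKC : 2 * (C₁ + C₂) ≤ lam * K) : |S| ≤ K * P := by
  have hG' : |G| ≤ 1 - lam * x / 2 := by
    have h1 : C₁ * x ^ 2 ≤ lam / 2 * x := by nlinarith
    rw [abs_le] at hG ⊢
    constructor <;> linarith
  have hT' : |T| ≤ K * P * (1 - lam * x / 2) + C₁ * (x * P) := by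
    have h1 : |T| ≤ |T + φ * G| + |φ| * |G| := by
      rw [← abs_mul]
      simpa using abs_sub (T + φ * G) (φ * G)
    have h2 : |φ| * |G| ≤ K * P * (1 - lam * x / 2) :=
      mul_le_mul hφ hG' (abs_nonneg _) (by positivity)
    linarith
  have hS' : |S| ≤ C₂ * (x * P) + |T| := by
    have h1 : |S| ≤ |S - w * T| + |w * T| := by
      simpa using abs_add_le (S - w * T) (w * T)
    have h2 : |w * T| ≤ |T| := by
      rw [abs_mul, abs_of_nonneg hw0]
      exact mul_le_of_le_one_left (abs_nonneg _) hw1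
    linarith
  nlinarith [mul_le_mul_of_nonneg_right hKC (mul_nonneg hx0 hP)]

/-- **Assertion 4.** Fix `2 ≤ m̄ ≤ N - 10`. There are threshold
functions `τ` (with `τ K j` depending only on `Φ` and `K 1, …, K (j-1)`) such that
for all constants `K 1, …, K (m̄-1) > 0` exceeding their thresholds, there exist
`K_m̄ > 0` and `δ > 0` with the following property. If `f` is `C^∞` on
`[0, x_MAX] ⊆ [0, δ]` with `|f| ≤ xᴺ` and `|f⁽ᵐ⁾| ≤ K_m x^(N-m)` for `m = 1, …, m̄`,
and the image of the graph of `f` under `Φ` is the graph of a `C^∞` function `F` on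
`[0, X_MAX]` with `|F| ≤ Xᴺ` and `|F⁽ᵐ⁾| ≤ K_m X^(N-m)` for `m = 1, …, m̄-1`, then
`|F⁽ᵐ̄⁾(X)| ≤ K_m̄ X^(N-m̄)` on `[0, X_MAX]`. -/
theorem assertion4
    (θA θB θC θD θE : ℝ × ℝ → ℝ) (V : Set (ℝ × ℝ)) (hV : V ∈ 𝓝 (0 : ℝ × ℝ))
    (hθA : ContDiffOn ℝ (⊤ : ℕ∞) θA V) (hθB : ContDiffOn ℝ (⊤ : ℕ∞) θB V)
    (hθC : ContDiffOn ℝ (⊤ : ℕ∞) θC V) (hθD : ContDiffOn ℝ (⊤ : ℕ∞) θD V)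
    (hθE : ContDiffOn ℝ (⊤ : ℕ∞) θE V)
    (lam : ℝ) (hlam : 0 < lam) (N : ℕ) (hN : 100 ≤ N)
    (mb : ℕ) (hmb2 : 2 ≤ mb) (hmbN : mb ≤ N - 10) :
    ∃ τ : (ℕ → ℝ) → ℕ → ℝ,
      (∀ K K' : ℕ → ℝ, ∀ j : ℕ, (∀ i < j, K i = K' i) → τ K j = τ K' j) ∧
      ∀ K : ℕ → ℝ,
        (∀ j : ℕ, 1 ≤ j → j ≤ mb - 1 → 0 < K j ∧ τ K j ≤ K j) →
        ∃ Kmb > (0 : ℝ), ∃ δ > (0 : ℝ),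
          ∀ (xMAX XMAX : ℝ) (f F : ℝ → ℝ),
            0 < xMAX → xMAX ≤ δ → 0 < XMAX →
            ContDiffOn ℝ (⊤ : ℕ∞) f (Icc 0 xMAX) →
            (∀ x ∈ Icc (0 : ℝ) xMAX, |f x| ≤ x ^ N) →
            (∀ m : ℕ, 1 ≤ m → m ≤ mb - 1 → ∀ x ∈ Icc (0 : ℝ) xMAX,
              |iteratedDerivWithin m f (Icc 0 xMAX) x| ≤ K m * x ^ (N - m)) →
            (∀ x ∈ Icc (0 : ℝ) xMAX,
              |iteratedDerivWithin mb f (Icc 0 xMAX) x| ≤ Kmb * x ^ (N - mb)) →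
            ContDiffOn ℝ (⊤ : ℕ∞) F (Icc 0 XMAX) →
            (fun x => (XIA θA θB x (f x), YIA θC θD θE lam N x (f x))) '' Icc 0 xMAX
              = (fun X => (X, F X)) '' Icc 0 XMAX →
            (∀ X ∈ Icc (0 : ℝ) XMAX, |F X| ≤ X ^ N) →
            (∀ m : ℕ, 1 ≤ m → m ≤ mb - 1 → ∀ X ∈ Icc (0 : ℝ) XMAX,
              |iteratedDerivWithin m F (Icc 0 XMAX) X| ≤ K m * X ^ (N - m)) →
            ∀ X ∈ Icc (0 : ℝ) XMAX,
              |iteratedDerivWithin mb F (Icc 0 XMAX) X| ≤ Kmb * X ^ (N - mb) := by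
  obtain ⟨ε, hε, hεV⟩ := Metric.mem_nhds_iff.1 hV
  refine ⟨fun _ _ => 0, fun _ _ _ _ => rfl, fun K hK => ?_⟩
  set L : ℝ := 1 + ∑ j ∈ Finset.range mb, |K j|
  have hsum0 : 0 ≤ ∑ j ∈ Finset.range mb, |K j| := Finset.sum_nonneg fun _ _ => abs_nonneg _
  have hKL (j : ℕ) (hj : j < mb) : K j ≤ L := by
    have := Finset.single_le_sum (f := fun j => |K j|) (fun _ _ => abs_nonneg _)
      (Finset.mem_range.2 hj)
    linarith [le_abs_self (K j)]
  -- The curves `f` on `[0, a]` with bounds that do not involve the top constant.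
  let A : ℝ × (ℝ → ℝ) → Prop := fun t =>
    0 < t.1 ∧ t.1 ≤ 1 ∧ t.1 ≤ ε / 2 ∧ ContDiffOn ℝ (⊤ : ℕ∞) t.2 (Icc 0 t.1) ∧
      (∀ x ∈ Icc 0 t.1, |t.2 x| ≤ x ^ N) ∧
      (∀ j ≤ mb - 1, ∀ x ∈ Icc 0 t.1, |iteratedDerivWithin j t.2 (Icc 0 t.1) x| ≤ L * x ^ (N - j)) ∧
      ∀ j ≤ mb, ∀ x ∈ Icc 0 t.1, |iteratedDerivWithin j t.2 (Icc 0 t.1) x| ≤ L * x ^ (N - 1 - j)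
  let a : Subtype A → ℝ := fun t => t.1.1
  let f : Subtype A → ℝ → ℝ := fun t => t.1.2
  have ha0 : ∀ i, 0 < a i := fun i => i.2.1
  have ha1 : ∀ i, a i ≤ 1 := fun i => i.2.2.1
  have hf' : FlatBound a (mb - 1) N f := ⟨fun i => i.2.2.2.2.1, L, fun i => i.2.2.2.2.2.2.1⟩
  have hf : FlatBound a mb (N - 1) f := ⟨fun i => i.2.2.2.2.1, L, fun i => i.2.2.2.2.2.2.2⟩
  have hmem : ∀ i, ∀ x ∈ Icc 0 (a i), (x, f i x) ∈ Metric.closedBall (0 : ℝ × ℝ) (ε / 2) := by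
    intro i x hx
    have h1 : x ≤ ε / 2 := hx.2.trans i.2.2.2.1
    have h2 : |f i x| ≤ x :=
      (i.2.2.2.2.2.1 x hx).trans (pow_le_of_le_one hx.1 (hx.2.trans (ha1 i)) (by omega))
    rw [mem_closedBall_zero_iff, Prod.norm_def, Real.norm_eq_abs, Real.norm_eq_abs,
      abs_of_nonneg hx.1]
    exact max_le h1 (h2.trans h1)
  have hθ {θ : ℝ × ℝ → ℝ} (h : ContDiffOn ℝ (⊤ : ℕ∞) θ V) :
      FlatBound a mb 0 (fun i x => θ (x, f i x)) :=
    FlatBound.comp_graph ha0 ha1 Metric.isOpen_ball (isCompact_closedBall _ _)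
      (Metric.closedBall_subset_ball (half_lt_self hε)) (h.mono hεV)
      (hf.mono ha1 le_rfl (by omega)) hmem
  obtain ⟨hX, C₀, hC₀, hXC⟩ :=
    XIA_flatBound ha0 ha1 (by omega) (by omega) hf (hθ hθA) (hθ hθB)
  obtain ⟨hY, C₁, hC₁, hYC⟩ :=
    YIA_flatBound (lam := lam) ha0 ha1 (by omega) hf hf' (hθ hθC) (hθ hθD) (hθ hθE)
  -- The curves together with a smooth image curve `F` on `[0, b]`.
  let ι := {t : Subtype A × ℝ × (ℝ → ℝ) // C₀ * a t.1 ≤ 1 ∧ 0 < t.2.1 ∧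
    ContDiffOn ℝ (⊤ : ℕ∞) t.2.2 (Icc 0 t.2.1) ∧
    MapsTo (fun x => XIA θA θB x (f t.1 x)) (Icc 0 (a t.1)) (Icc 0 t.2.1) ∧
    ∀ x ∈ Icc 0 (a t.1),
      t.2.2 (XIA θA θB x (f t.1 x)) = YIA θC θD θE lam N x (f t.1 x)}
  obtain ⟨C₂, hC₂, hFC⟩ := iteratedDerivWithin_graph_transform (ι := ι) (n := mb)
    (b := fun i => i.1.2.1) (F := fun i => i.1.2.2) (fun i => ha0 i.1.1) (fun i => ha1 i.1.1)
    (fun i => i.2.2.1) (by omega) (hX.comap fun i : ι => i.1.1)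
    (fun i x hx => by
      have h1 := (abs_le.1 (hXC i.1.1 x hx).2).1
      have h2 : C₀ * x ≤ 1 := (mul_le_mul_of_nonneg_left hx.2 hC₀.le).trans i.2.1
      nlinarith [hx.1])
    (hY.comap fun i : ι => i.1.1) (fun i => i.2.2.2.1) (fun i => i.2.2.2.2.1)
    (fun i => i.2.2.2.2.2)
  set Kmb : ℝ := 2 * (C₁ + C₂) / lam + 1 with hKmb
  have hKpos : 0 < Kmb := by positivity
  have hKC : 2 * (C₁ + C₂) ≤ lam * Kmb := by
    have : lam * Kmb = 2 * (C₁ + C₂) + lam := by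
      rw [hKmb]
      field_simp
    linarith
  obtain ⟨δ, hδ0, hδ⟩ : ∃ δ > 0, δ ≤ 1 ∧ δ ≤ ε / 2 ∧ C₀ * δ ≤ 1 ∧ C₁ * δ ≤ lam / 2 ∧
      lam * δ ≤ 1 ∧ Kmb * δ ≤ 1 := by
    have hsmall {c d : ℝ} (hd : 0 < d) : ∀ᶠ δ in 𝓝[>] (0 : ℝ), c * δ ≤ d := by
      have h : Tendsto (fun δ : ℝ => c * δ) (𝓝[>] 0) (𝓝 (c * 0)) :=
        (continuous_const_mul c).continuousAt.tendsto.mono_left nhdsWithin_le_nhds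
      rw [mul_zero] at h
      exact (h.eventually_lt_const hd).mono fun _ => le_of_lt
    have h := (hsmall (c := 1) one_pos).and ((hsmall (c := 1) (half_pos hε)).and
      ((hsmall (c := C₀) one_pos).and ((hsmall (c := C₁) (half_pos hlam)).and
        ((hsmall (c := lam) one_pos).and (hsmall (c := Kmb) one_pos)))))
    simp only [one_mul] at h
    obtain ⟨δ, hδ, h0⟩ := (h.and self_mem_nhdsWithin).exists
    exact ⟨δ, h0, hδ⟩
  obtain ⟨hδ1, hδε, hδC₀, hδC₁, hδlam, hδK⟩ := hδ
  refine ⟨Kmb, hKpos, δ, hδ0, ?_⟩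
  intro xMAX XMAX g F hx0 hxδ hX0 hg hgN hgm hgmb hF himg hFN hFm
  have hgK : ∀ j ≤ mb - 1, ∀ x ∈ Icc 0 xMAX,
      |iteratedDerivWithin j g (Icc 0 xMAX) x| ≤ L * x ^ (N - j) := by
    intro j hj x hx
    have hx' := hx.1
    rcases Nat.eq_zero_or_pos j with rfl | hj0
    · rw [iteratedDerivWithin_zero]
      exact (hgN x hx).trans (le_mul_of_one_le_left (by positivity) (by linarith))
    · refine (hgm j hj0 hj x hx).trans ?_
      gcongr
      exact hKL j (by omega)
  have hA : A (xMAX, g) := by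
    refine ⟨hx0, hxδ.trans hδ1, hxδ.trans hδε, hg, hgN, hgK, fun j hj x hx => ?_⟩
    have hx' : 0 ≤ x := hx.1
    have hxd : x ≤ δ := hx.2.trans hxδ
    rcases hj.lt_or_eq with hj | rfl
    · refine (hgK j (by omega) x hx).trans
        (mul_le_mul_of_nonneg_left ?_ (by linarith))
      exact pow_le_pow_of_le_one hx' (hxd.trans hδ1) (by omega)
    · refine (hgmb x hx).trans ?_
      rw [show N - j = N - 1 - j + 1 by omega, pow_succ']
      have h1 : Kmb * x ≤ 1 := (mul_le_mul_of_nonneg_left hxd hKpos.le).trans hδK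
      rw [← mul_assoc]
      exact mul_le_mul_of_nonneg_right (h1.trans (by linarith)) (by positivity)
  have himg1 : ∀ x ∈ Icc 0 xMAX, XIA θA θB x (g x) ∈ Icc 0 XMAX ∧
      F (XIA θA θB x (g x)) = YIA θC θD θE lam N x (g x) := by
    intro x hx
    obtain ⟨Z, hZ, hZe⟩ := himg.subset (mem_image_of_mem _ hx)
    obtain ⟨h1, h2⟩ := Prod.mk.inj hZe
    rw [← h1, ← h2]
    exact ⟨hZ, rfl⟩
  intro Z hZ
  obtain ⟨x, hx, hxe⟩ := himg.superset (mem_image_of_mem _ hZ)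
  obtain rfl : XIA θA θB x (g x) = Z := (Prod.mk.inj hxe).1
  let i : Subtype A := ⟨(xMAX, g), hA⟩
  have hxa : x ∈ Icc 0 (a i) := hx
  have hx' : 0 ≤ x := hx.1
  have hxd : x ≤ δ := hx.2.trans hxδ
  have hscale {c d : ℝ} (hc : 0 ≤ c) (h : c * δ ≤ d) : c * x ≤ d :=
    (mul_le_mul_of_nonneg_left hxd hc).trans h
  obtain ⟨w, hw0, hw1, hw⟩ := hFC
    ⟨(i, XMAX, F), (mul_le_mul_of_nonneg_left hxδ hC₀.le).trans hδC₀, hX0, hF,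
      fun x hx => (himg1 x hx).1, fun x hx => (himg1 x hx).2⟩ x hx
  obtain ⟨G, hG, hYG⟩ := hYC i x hxa
  have hpow : x ^ (N + 1 - mb) = x * x ^ (N - mb) := by
    rw [show N + 1 - mb = N - mb + 1 by omega, pow_succ']
  rw [hpow] at hw hYG
  refine (abs_le_of_contraction hw0 hw1 hx' (by positivity) hKpos.le hw hYG (hgmb x hx) hG
    (hscale hlam.le hδlam) (hscale hC₁.le hδC₁) hKC).trans ?_
  have hxX : x ≤ XIA θA θB x (g x) := by
    have h1 := (abs_le.1 (hXC i x hxa).1).1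
    change -(C₀ * x ^ 3) ≤ XIA θA θB x (g x) - (x + x ^ 2) at h1
    have h2 := mul_le_mul_of_nonneg_right (hscale hC₀.le hδC₀) (sq_nonneg x)
    nlinarith
  gcongr
end

section
/- Let Φ be of the form (IA). There exist constants K₁, …, K_{N−10} > 0, C > 0 and δ > 0 such that the following holds. Let Γ = {(x, f(x)) : x ∈ [0, x_MAX]} with f C^∞, 0 < x_MAX ≤ δ, |f(x)| ≤ x^N, and |f^(m)(x)| ≤ K_m x^(N−m) for m = 1, …, N−10, on [0, x_MAX]. Then Φ(Γ) = {(X, F(X)) : X ∈ [0, X_MAX]} for some X_MAX > 0 and some C^∞ function F satisfying |F(X)| ≤ X^N and |F^(m)(X)| ≤ K_m X^(N−m) for m = 1, …, N−10 on [0, X_MAX]; moreover |X_MAX − (x_MAX + x_MAX²)| ≤ C x_MAX³. -/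
open Set Filter Asymptotics Topology

/-- Families of smooth functions on `[0, M t]` which vanish to order `a` at the origin together
with their first `J` derivatives (the order dropping by one for each derivative), with constants
that are uniform in the family. -/
def VanishesTo {T : Type*} (M : T → ℝ) : ℕ → ℕ → (T → ℝ → ℝ) → Prop
  | 0, a, h => (∀ t, ContDiffOn ℝ (⊤ : ℕ∞) (h t) (Icc 0 (M t))) ∧
      ∃ C : ℝ, 0 ≤ C ∧ ∀ t, ∀ x ∈ Icc 0 (M t), |h t x| ≤ C * x ^ a
  | J + 1, a, h => (∀ t, ContDiffOn ℝ (⊤ : ℕ∞) (h t) (Icc 0 (M t))) ∧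
      (∃ C : ℝ, 0 ≤ C ∧ ∀ t, ∀ x ∈ Icc 0 (M t), |h t x| ≤ C * x ^ a) ∧
      VanishesTo M J (a - 1) (fun t => derivWithin (h t) (Icc 0 (M t)))

namespace VanishesTo

theorem contDiffOn {T : Type*} {M : T → ℝ} {J a : ℕ} {h : T → ℝ → ℝ}
    (H : VanishesTo M J a h) (t : T) : ContDiffOn ℝ (⊤ : ℕ∞) (h t) (Icc 0 (M t)) := by
  cases J with
  | zero => exact H.1 t
  | succ J => exact H.1 t

theorem bound {T : Type*} {M : T → ℝ} {J a : ℕ} {h : T → ℝ → ℝ}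
    (H : VanishesTo M J a h) :
    ∃ C : ℝ, 0 ≤ C ∧ ∀ t, ∀ x ∈ Icc 0 (M t), |h t x| ≤ C * x ^ a := by
  cases J with
  | zero => exact H.2
  | succ J => exact H.2.1

theorem differentiableOn {T : Type*} {M : T → ℝ} {J a : ℕ} {h : T → ℝ → ℝ}
    (H : VanishesTo M J a h) (t : T) : DifferentiableOn ℝ (h t) (Icc 0 (M t)) :=
  (H.contDiffOn t).differentiableOn (by simp)

theorem congr {T : Type*} {M : T → ℝ} {J a : ℕ} {h g : T → ℝ → ℝ}
    (H : VanishesTo M J a h) (e : ∀ t, EqOn (g t) (h t) (Icc 0 (M t))) :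
    VanishesTo M J a g := by
  induction J generalizing a h g with
  | zero =>
    obtain ⟨h1, C, hC, h2⟩ := H
    exact ⟨fun t => (h1 t).congr (e t), C, hC, fun t x hx => by rw [e t hx]; exact h2 t x hx⟩
  | succ J ih =>
    obtain ⟨h1, ⟨C, hC, h2⟩, h3⟩ := H
    exact ⟨fun t => (h1 t).congr (e t),
      ⟨C, hC, fun t x hx => by rw [e t hx]; exact h2 t x hx⟩,
      ih h3 fun t x hx => derivWithin_congr (e t) (e t hx)⟩

theorem mono {T : Type*} {M : T → ℝ} (hM : ∀ t, M t ≤ 1) {J J' a a' : ℕ} {h : T → ℝ → ℝ}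
    (H : VanishesTo M J a h) (hJ : J' ≤ J) (ha : a' ≤ a) : VanishesTo M J' a' h := by
  have key : ∀ {J a a' : ℕ} {h : T → ℝ → ℝ}, VanishesTo M J a h → a' ≤ a →
      ∃ C : ℝ, 0 ≤ C ∧ ∀ t, ∀ x ∈ Icc 0 (M t), |h t x| ≤ C * x ^ a' := by
    intro J a a' h H ha
    obtain ⟨C, hC, hb⟩ := H.bound
    refine ⟨C, hC, fun t x hx => (hb t x hx).trans ?_⟩
    exact mul_le_mul_of_nonneg_left (pow_le_pow_of_le_one hx.1 (hx.2.trans (hM t)) ha) hC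
  induction J generalizing J' a a' h with
  | zero =>
    obtain rfl : J' = 0 := by omega
    exact ⟨H.1, key H ha⟩
  | succ J ih =>
    cases J' with
    | zero => exact ⟨H.1, key H ha⟩
    | succ J' => exact ⟨H.1, key H ha, ih H.2.2 (by omega) (by omega)⟩

theorem add {T : Type*} {M : T → ℝ} {J a : ℕ} {h g : T → ℝ → ℝ}
    (H : VanishesTo M J a h) (G : VanishesTo M J a g) :
    VanishesTo M J a (fun t x => h t x + g t x) := by
  have key : ∃ C : ℝ, 0 ≤ C ∧ ∀ t, ∀ x ∈ Icc 0 (M t), |h t x + g t x| ≤ C * x ^ a := by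
    obtain ⟨C, hC, hb⟩ := H.bound
    obtain ⟨D, hD, gb⟩ := G.bound
    refine ⟨C + D, by positivity, fun t x hx => (abs_add_le _ _).trans ?_⟩
    linarith [hb t x hx, gb t x hx]
  induction J generalizing a h g with
  | zero => exact ⟨fun t => (H.1 t).add (G.1 t), key⟩
  | succ J ih =>
    refine ⟨fun t => (H.1 t).add (G.1 t), key, (ih H.2.2 G.2.2 ?_).congr fun t x hx => ?_⟩
    · obtain ⟨C, hC, hb⟩ := H.2.2.bound
      obtain ⟨D, hD, gb⟩ := G.2.2.bound
      refine ⟨C + D, by positivity, fun t x hx => (abs_add_le _ _).trans ?_⟩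
      linarith [hb t x hx, gb t x hx]
    · exact derivWithin_fun_add (H.differentiableOn t x hx) (G.differentiableOn t x hx)

theorem const_mul {T : Type*} {M : T → ℝ} {J a : ℕ} {h : T → ℝ → ℝ} (c : ℝ)
    (H : VanishesTo M J a h) : VanishesTo M J a (fun t x => c * h t x) := by
  have key : ∀ {J a : ℕ} {h : T → ℝ → ℝ}, VanishesTo M J a h →
      ∃ C : ℝ, 0 ≤ C ∧ ∀ t, ∀ x ∈ Icc 0 (M t), |c * h t x| ≤ C * x ^ a := by
    intro J a h H
    obtain ⟨C, hC, hb⟩ := H.bound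
    refine ⟨|c| * C, by positivity, fun t x hx => ?_⟩
    rw [abs_mul, mul_assoc]
    exact mul_le_mul_of_nonneg_left (hb t x hx) (abs_nonneg c)
  induction J generalizing a h with
  | zero => exact ⟨fun t => contDiffOn_const.mul (H.1 t), key H⟩
  | succ J ih =>
    exact ⟨fun t => contDiffOn_const.mul (H.1 t), key H,
      (ih H.2.2).congr fun t x hx => derivWithin_const_mul c (H.differentiableOn t x hx)⟩

theorem mul {T : Type*} {M : T → ℝ} (hM : ∀ t, M t ≤ 1) {J a b : ℕ} {h g : T → ℝ → ℝ}
    (H : VanishesTo M J a h) (G : VanishesTo M J b g) :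
    VanishesTo M J (a + b) (fun t x => h t x * g t x) := by
  have key : ∀ {J a b : ℕ} {h g : T → ℝ → ℝ}, VanishesTo M J a h → VanishesTo M J b g →
      ∃ C : ℝ, 0 ≤ C ∧ ∀ t, ∀ x ∈ Icc 0 (M t), |h t x * g t x| ≤ C * x ^ (a + b) := by
    intro J a b h g H G
    obtain ⟨C, hC, hb⟩ := H.bound
    obtain ⟨D, hD, gb⟩ := G.bound
    refine ⟨C * D, by positivity, fun t x hx => ?_⟩
    have hx0 : 0 ≤ x := hx.1
    rw [abs_mul, pow_add, mul_mul_mul_comm]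
    exact mul_le_mul (hb t x hx) (gb t x hx) (abs_nonneg _) (by positivity)
  induction J generalizing a b h g with
  | zero => exact ⟨fun t => (H.1 t).mul (G.1 t), key H G⟩
  | succ J ih =>
    refine ⟨fun t => (H.1 t).mul (G.1 t), key H G, ?_⟩
    have h1 := (ih H.2.2 (G.mono hM (Nat.le_succ J) le_rfl)).mono hM le_rfl
      (show a + b - 1 ≤ a - 1 + b by omega)
    have h2 := (ih (H.mono hM (Nat.le_succ J) le_rfl) G.2.2).mono hM le_rfl
      (show a + b - 1 ≤ a + (b - 1) by omega)
    exact (h1.add h2).congr fun t x hx =>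
      derivWithin_fun_mul (H.differentiableOn t x hx) (G.differentiableOn t x hx)

theorem pow {T : Type*} {M : T → ℝ} (hM0 : ∀ t, 0 < M t) (J n : ℕ) :
    VanishesTo M J n (fun _ x => x ^ n) := by
  have key : ∀ n : ℕ, ∃ C : ℝ, 0 ≤ C ∧ ∀ t, ∀ x ∈ Icc 0 (M t), |x ^ n| ≤ C * x ^ n := by
    intro n
    refine ⟨1, zero_le_one, fun t x hx => ?_⟩
    rw [one_mul, abs_of_nonneg (pow_nonneg hx.1 n)]
  induction J generalizing n with
  | zero => exact ⟨fun t => contDiffOn_id.pow n, key n⟩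
  | succ J ih =>
    refine ⟨fun t => contDiffOn_id.pow n, key n,
      ((ih (n - 1)).const_mul (n : ℝ)).congr fun t x hx => ?_⟩
    exact ((hasDerivAt_pow n x).hasDerivWithinAt).derivWithin
      (uniqueDiffOn_Icc (hM0 t) x hx)

theorem deriv {T : Type*} {M : T → ℝ} {J a : ℕ} {h : T → ℝ → ℝ}
    (H : VanishesTo M (J + 1) a h) :
    VanishesTo M J (a - 1) (fun t => derivWithin (h t) (Icc 0 (M t))) :=
  H.2.2

theorem inv {T : Type*} {M : T → ℝ} (hM0 : ∀ t, 0 < M t) (hM : ∀ t, M t ≤ 1) {J : ℕ}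
    {h : T → ℝ → ℝ} (H : VanishesTo M J 0 h) (h1 : ∀ t, ∀ x ∈ Icc 0 (M t), 1 ≤ h t x) :
    VanishesTo M J 0 (fun t x => (h t x)⁻¹) := by
  have hne : ∀ t, ∀ x ∈ Icc 0 (M t), h t x ≠ 0 := fun t x hx => by linarith [h1 t x hx]
  have key : ∃ C : ℝ, 0 ≤ C ∧ ∀ t, ∀ x ∈ Icc 0 (M t), |(h t x)⁻¹| ≤ C * x ^ 0 := by
    refine ⟨1, zero_le_one, fun t x hx => ?_⟩
    have := h1 t x hx
    rw [abs_of_nonneg (by positivity), pow_zero, mul_one]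
    exact inv_le_one_of_one_le₀ this
  induction J with
  | zero => exact ⟨fun t => (H.1 t).inv (hne t), key⟩
  | succ J ih =>
    refine ⟨fun t => (H.1 t).inv (hne t), key, ?_⟩
    have i := ih (H.mono hM (Nat.le_succ J) le_rfl)
    refine ((H.2.2.mul hM (i.mul hM i)).const_mul (-1)).congr fun t x hx => ?_
    have d := ((H.differentiableOn t x hx).hasDerivWithinAt.fun_inv (hne t x hx)).derivWithin
      (uniqueDiffOn_Icc (hM0 t) x hx)
    simp only
    rw [d]
    field_simp

theorem of_iteratedDerivWithin {T : Type*} {M : T → ℝ} {J a : ℕ} {h : T → ℝ → ℝ}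
    (hM0 : ∀ t, 0 < M t)
    (hs : ∀ t, ContDiffOn ℝ (⊤ : ℕ∞) (h t) (Icc 0 (M t)))
    (hb : ∀ j ≤ J, ∃ C : ℝ, 0 ≤ C ∧ ∀ t, ∀ x ∈ Icc 0 (M t),
      |iteratedDerivWithin j (h t) (Icc 0 (M t)) x| ≤ C * x ^ (a - j)) :
    VanishesTo M J a h := by
  induction J generalizing a h with
  | zero => exact ⟨hs, by simpa using hb 0 le_rfl⟩
  | succ J ih =>
    refine ⟨hs, by simpa using hb 0 (Nat.zero_le _), ih (fun t => ?_) fun j hj => ?_⟩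
    · exact (hs t).derivWithin (uniqueDiffOn_Icc (hM0 t)) (by simp)
    · obtain ⟨C, hC, H⟩ := hb (j + 1) (by omega)
      refine ⟨C, hC, fun t x hx => ?_⟩
      have := H t x hx
      rwa [iteratedDerivWithin_succ', show a - (j + 1) = a - 1 - j by omega] at this

theorem iteratedDerivWithin {T : Type*} {M : T → ℝ} {J a : ℕ} {h : T → ℝ → ℝ}
    (H : VanishesTo M J a h) {m : ℕ} (hm : m ≤ J) :
    VanishesTo M (J - m) (a - m) (fun t => _root_.iteratedDerivWithin m (h t) (Icc 0 (M t))) := by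
  induction m with
  | zero => simpa using H
  | succ m ih =>
    have := ih (by omega)
    rw [show J - m = (J - (m + 1)) + 1 by omega] at this
    refine (this.deriv).congr fun t x hx => ?_
    rw [iteratedDerivWithin_succ]

theorem comp {T : Type*} {M : T → ℝ} (hM0 : ∀ t, 0 < M t) (hM : ∀ t, M t ≤ 1)
    {U L : Set (ℝ × ℝ)} (hU : IsOpen U) (hL : IsCompact L) (hLU : L ⊆ U) {J : ℕ}
    {f : T → ℝ → ℝ} (hf : VanishesTo M J 0 f) (hfL : ∀ t, ∀ x ∈ Icc 0 (M t), (x, f t x) ∈ L)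
    {θ : ℝ × ℝ → ℝ} (hθ : ContDiffOn ℝ (⊤ : ℕ∞) θ U) :
    VanishesTo M J 0 (fun t x => θ (x, f t x)) := by
  have smooth : ∀ t, ContDiffOn ℝ (⊤ : ℕ∞) (fun x => θ (x, f t x)) (Icc 0 (M t)) := fun t =>
    hθ.comp (contDiffOn_id.prodMk (hf.contDiffOn t)) fun x hx => hLU (hfL t x hx)
  have key : ∃ C : ℝ, 0 ≤ C ∧ ∀ t, ∀ x ∈ Icc 0 (M t), |θ (x, f t x)| ≤ C * x ^ 0 := by
    obtain ⟨C, hC⟩ := hL.exists_bound_of_continuousOn (hθ.continuousOn.mono hLU)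
    refine ⟨|C|, abs_nonneg C, fun t x hx => ?_⟩
    rw [pow_zero, mul_one]
    exact (hC _ (hfL t x hx)).trans (le_abs_self C)
  induction J generalizing θ with
  | zero => exact ⟨smooth, key⟩
  | succ J ih =>
    have partialSmooth : ∀ v : ℝ × ℝ, ContDiffOn ℝ (⊤ : ℕ∞) (fun p => fderiv ℝ θ p v) U :=
      fun v => (hθ.fderiv_of_isOpen hU (by simp)).clm_apply contDiffOn_const
    have partialVanishes : ∀ v : ℝ × ℝ, VanishesTo M J 0 (fun t x => fderiv ℝ θ (x, f t x) v) := by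
      intro v
      refine ih (hf.mono hM (Nat.le_succ J) le_rfl) (partialSmooth v) (fun t => ?_) ?_
      · exact (partialSmooth v).comp (contDiffOn_id.prodMk (hf.contDiffOn t))
          fun x hx => hLU (hfL t x hx)
      · obtain ⟨C, hC⟩ := hL.exists_bound_of_continuousOn ((partialSmooth v).continuousOn.mono hLU)
        refine ⟨|C|, abs_nonneg C, fun t x hx => ?_⟩
        rw [pow_zero, mul_one]
        exact (hC _ (hfL t x hx)).trans (le_abs_self C)
    refine ⟨smooth, key, ((partialVanishes (1, 0)).add
      ((partialVanishes (0, 1)).mul hM hf.2.2)).congr fun t x hx => ?_⟩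
    have d1 : HasFDerivAt θ (fderiv ℝ θ (x, f t x)) (x, f t x) :=
      ((hθ.contDiffAt (hU.mem_nhds (hLU (hfL t x hx)))).differentiableAt (by simp)).hasFDerivAt
    have d2 := (hasDerivWithinAt_id x (Icc 0 (M t))).prodMk
      (hf.differentiableOn t x hx).hasDerivWithinAt
    have d3 := (d1.comp_hasDerivWithinAt x d2).derivWithin (uniqueDiffOn_Icc (hM0 t) x hx)
    have e : ((1 : ℝ), derivWithin (f t) (Icc 0 (M t)) x)
        = (1, 0) + derivWithin (f t) (Icc 0 (M t)) x • ((0, 1) : ℝ × ℝ) := by simp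
    rw [e, map_add, map_smul, smul_eq_mul] at d3
    simp only
    rw [mul_comm (fderiv ℝ θ (x, f t x) (0, 1))]
    exact d3

end VanishesTo

/-- A smooth function on `[0, M]` with derivative at least `1` and vanishing at `0` maps `[0, M]`
bijectively onto `[0, φ M]`, with smooth inverse. -/
theorem exists_contDiffOn_inverse {M : ℝ} (hM : 0 < M) {φ : ℝ → ℝ}
    (hφ : ContDiffOn ℝ (⊤ : ℕ∞) φ (Icc 0 M)) (h0 : φ 0 = 0)
    (h1 : ∀ x ∈ Icc 0 M, 1 ≤ derivWithin φ (Icc 0 M) x) :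
    (∀ x ∈ Icc 0 M, x ≤ φ x) ∧ φ '' Icc 0 M = Icc 0 (φ M) ∧
    ∃ g : ℝ → ℝ, ContDiffOn ℝ (⊤ : ℕ∞) g (Icc 0 (φ M)) ∧ ∀ x ∈ Icc 0 M, g (φ x) = x := by
  have hdiff : DifferentiableOn ℝ φ (Icc 0 M) := hφ.differentiableOn (by simp)
  have expand : ∀ x ∈ Icc 0 M, ∀ y ∈ Icc 0 M, x ≤ y → y - x ≤ φ y - φ x := by
    intro x hx y hy hxy
    have := (convex_Icc 0 M).mul_sub_le_image_sub_of_le_deriv hφ.continuousOn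
      (hdiff.mono interior_subset) (C := 1) (fun z hz => ?_) x hx y hy hxy
    · linarith
    · rw [← derivWithin_of_mem_nhds (mem_interior_iff_mem_nhds.1 hz)]
      exact h1 z (interior_subset hz)
  have hmem0 : (0 : ℝ) ∈ Icc 0 M := ⟨le_rfl, hM.le⟩
  have hmemM : M ∈ Icc 0 M := ⟨hM.le, le_rfl⟩
  have hle : ∀ x ∈ Icc 0 M, x ≤ φ x := fun x hx => by
    have := expand 0 hmem0 x hx hx.1
    linarith
  have himage : φ '' Icc 0 M = Icc 0 (φ M) := by
    apply Subset.antisymm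
    · rintro _ ⟨x, hx, rfl⟩
      refine ⟨hx.1.trans (hle x hx), ?_⟩
      have := expand x hx M hmemM hx.2
      linarith [hx.2]
    · have := intermediate_value_Icc hM.le hφ.continuousOn
      rwa [h0] at this
  have hinj : InjOn φ (Icc 0 M) := by
    intro x hx y hy hxy
    rcases le_total x y with h | h
    · linarith [expand x hx y hy h]
    · linarith [expand y hy x hx h]
  set g := Function.invFunOn φ (Icc 0 M) with hg
  have hgφ : ∀ x ∈ Icc 0 M, g (φ x) = x := fun x hx => hinj.leftInvOn_invFunOn hx
  have hgmem : ∀ y ∈ Icc 0 (φ M), g y ∈ Icc 0 M := by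
    rw [← himage]
    rintro _ ⟨x, hx, rfl⟩
    rwa [hgφ x hx]
  have hφg : ∀ y ∈ Icc 0 (φ M), φ (g y) = y := by
    rw [← himage]
    rintro _ ⟨x, hx, rfl⟩
    rw [hgφ x hx]
  have hlip : LipschitzOnWith 1 g (Icc 0 (φ M)) := by
    refine LipschitzOnWith.of_dist_le_mul fun y hy z hz => ?_
    rw [NNReal.coe_one, one_mul, Real.dist_eq, Real.dist_eq]
    rcases le_total (g y) (g z) with h | h
    · have := expand _ (hgmem y hy) _ (hgmem z hz) h
      rw [hφg y hy, hφg z hz] at this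
      rw [abs_sub_comm, abs_of_nonneg (by linarith), abs_sub_comm]
      exact this.trans (le_abs_self _)
    · have := expand _ (hgmem z hz) _ (hgmem y hy) h
      rw [hφg y hy, hφg z hz] at this
      rw [abs_of_nonneg (by linarith)]
      exact this.trans (le_abs_self _)
  have hXM : 0 < φ M := hM.trans_le (hle M hmemM)
  have hu := uniqueDiffOn_Icc hXM
  have hderiv : ∀ y ∈ Icc 0 (φ M),
      HasDerivWithinAt g (derivWithin φ (Icc 0 M) (g y))⁻¹ (Icc 0 (φ M)) y := by
    intro y hy
    have hne : derivWithin φ (Icc 0 M) (g y) ≠ 0 := by linarith [h1 _ (hgmem y hy)]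
    have hd := (hdiff (g y) (hgmem y hy)).hasDerivWithinAt
    have ht : Tendsto g (𝓝[Icc 0 (φ M)] y) (𝓝[Icc 0 M] (g y)) :=
      tendsto_nhdsWithin_iff.2 ⟨hlip.continuousOn y hy,
        eventually_nhdsWithin_of_forall hgmem⟩
    exact HasFDerivWithinAt.of_local_left_inverse
      (f' := ContinuousLinearEquiv.unitsEquivAut ℝ (Units.mk0 _ hne)) ht
      hd.hasFDerivWithinAt hy (eventually_nhdsWithin_of_forall hφg)
  have hφ' : ContDiffOn ℝ (⊤ : ℕ∞) (derivWithin φ (Icc 0 M)) (Icc 0 M) :=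
    hφ.derivWithin (uniqueDiffOn_Icc hM) (by simp)
  have hsmooth : ∀ n : ℕ, ContDiffOn ℝ n g (Icc 0 (φ M)) := by
    intro n
    induction n with
    | zero => exact contDiffOn_zero.2 hlip.continuousOn
    | succ n ih =>
      rw [Nat.cast_succ, contDiffOn_succ_iff_derivWithin hu]
      refine ⟨fun y hy => (hderiv y hy).differentiableWithinAt, by simp, ?_⟩
      have : ContDiffOn ℝ n (fun y => (derivWithin φ (Icc 0 M) (g y))⁻¹) (Icc 0 (φ M)) :=
        ((hφ'.of_le (by exact_mod_cast le_top)).comp ih hgmem).inv fun y hy =>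
          (zero_lt_one.trans_le (h1 _ (hgmem y hy))).ne'
      exact this.congr fun y hy => (hderiv y hy).derivWithin (hu y hy)
  exact ⟨hle, himage, g, contDiffOn_infty.2 hsmooth, hgφ⟩

/-- The iterates of `h ↦ h' / φ'`, applied to `ψ`: these are the derivatives of `ψ ∘ φ⁻¹`, written
in the variable of `φ`. -/
noncomputable def reparamDeriv (M : ℝ) (φ ψ : ℝ → ℝ) : ℕ → ℝ → ℝ
  | 0 => ψ
  | m + 1 => fun x =>
      derivWithin (reparamDeriv M φ ψ m) (Icc 0 M) x * (derivWithin φ (Icc 0 M) x)⁻¹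

theorem contDiffOn_reparamDeriv {M : ℝ} (hM : 0 < M) {φ ψ : ℝ → ℝ}
    (hφ : ContDiffOn ℝ (⊤ : ℕ∞) φ (Icc 0 M)) (hψ : ContDiffOn ℝ (⊤ : ℕ∞) ψ (Icc 0 M))
    (h1 : ∀ x ∈ Icc 0 M, 1 ≤ derivWithin φ (Icc 0 M) x) (m : ℕ) :
    ContDiffOn ℝ (⊤ : ℕ∞) (reparamDeriv M φ ψ m) (Icc 0 M) := by
  have hu := uniqueDiffOn_Icc hM
  induction m with
  | zero => exact hψ
  | succ m ih =>
    exact (ih.derivWithin hu (by simp)).mul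
      ((hφ.derivWithin hu (by simp)).inv fun x hx => by linarith [h1 x hx])

theorem iteratedDerivWithin_eq_reparamDeriv {M M' : ℝ} (hM : 0 < M) (hM' : 0 < M')
    {φ ψ F : ℝ → ℝ} (hφ : ContDiffOn ℝ (⊤ : ℕ∞) φ (Icc 0 M))
    (h1 : ∀ x ∈ Icc 0 M, 1 ≤ derivWithin φ (Icc 0 M) x) (hmaps : MapsTo φ (Icc 0 M) (Icc 0 M'))
    (hF : ContDiffOn ℝ (⊤ : ℕ∞) F (Icc 0 M')) (hFφ : ∀ x ∈ Icc 0 M, F (φ x) = ψ x) (m : ℕ) :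
    ∀ x ∈ Icc 0 M, iteratedDerivWithin m F (Icc 0 M') (φ x) = reparamDeriv M φ ψ m x := by
  have hu := uniqueDiffOn_Icc hM
  have hu' := uniqueDiffOn_Icc hM'
  induction m with
  | zero => simpa [reparamDeriv] using hFφ
  | succ m ih =>
    intro x hx
    have hd : DifferentiableWithinAt ℝ (iteratedDerivWithin m F (Icc 0 M')) (Icc 0 M') (φ x) :=
      hF.differentiableOn_iteratedDerivWithin (by exact_mod_cast ENat.natCast_lt_top m) hu' _
        (hmaps hx)
    have hd' := hd.hasDerivWithinAt.comp x
      ((hφ.differentiableOn (by simp)) x hx).hasDerivWithinAt hmaps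
    have e : derivWithin (reparamDeriv M φ ψ m) (Icc 0 M) x
        = derivWithin (iteratedDerivWithin m F (Icc 0 M')) (Icc 0 M') (φ x)
          * derivWithin φ (Icc 0 M) x := by
      rw [← hd'.derivWithin (hu x hx)]
      exact derivWithin_congr (fun y hy => (ih y hy).symm) (ih x hx).symm
    have hne : derivWithin φ (Icc 0 M) x ≠ 0 := by linarith [h1 x hx]
    simp only [iteratedDerivWithin_succ, reparamDeriv, e, mul_inv_cancel_right₀ hne]

/-- Expansion of the derivatives of the image of a curve `y = f(x)` under the map
`x ↦ x + x² + O(x³)`, `y ↦ -y(1 - λx) + O(x^(N+2))`. -/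
theorem VanishesTo.reparamDeriv_expansion {T : Type*} {M : T → ℝ} (hM0 : ∀ t, 0 < M t)
    (hM : ∀ t, M t ≤ 1) {J N : ℕ} (hJN : J ≤ N) {f φ ψ : T → ℝ → ℝ} {lam : ℝ}
    (hf : VanishesTo M J N f)
    (hφ : VanishesTo M J 3 (fun t x => φ t x - x - x ^ 2))
    (h1 : ∀ t, ∀ x ∈ Icc 0 (M t), 1 ≤ derivWithin (φ t) (Icc 0 (M t)) x)
    (hψ : VanishesTo M J (N + 2) (fun t x => ψ t x + (1 - lam * x) * f t x))
    {m : ℕ} (hm : m ≤ J) :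
    VanishesTo M (J - m) (N + 2 - m) (fun t x => reparamDeriv (M t) (φ t) (ψ t) m x
      + (1 - (lam + 2 * m) * x) * _root_.iteratedDerivWithin m (f t) (Icc 0 (M t)) x
      - m * (lam + m - 1) * _root_.iteratedDerivWithin (m - 1) (f t) (Icc 0 (M t)) x) := by
  have hsφ : ∀ t, ContDiffOn ℝ (⊤ : ℕ∞) (φ t) (Icc 0 (M t)) := fun t =>
    ((hφ.contDiffOn t).add (contDiffOn_id.add (contDiffOn_id.pow 2))).congr fun x _ => by
      simp
  have hsψ : ∀ t, ContDiffOn ℝ (⊤ : ℕ∞) (ψ t) (Icc 0 (M t)) := fun t =>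
    ((hψ.contDiffOn t).sub ((contDiffOn_const.sub (contDiffOn_const.mul contDiffOn_id)).mul
      (hf.contDiffOn t))).congr fun x _ => by
        change _ = ψ t x + (1 - lam * x) * f t x - (1 - lam * x) * f t x
        ring
  induction m with
  | zero => simpa [reparamDeriv] using hψ
  | succ m ih =>
    obtain ⟨J, rfl⟩ : ∃ L, J = L + m + 1 := ⟨J - m - 1, by omega⟩
    have R := ih (by omega)
    rw [show J + m + 1 - m = J + 1 by omega] at R
    rw [show J + m + 1 - (m + 1) = J by omega]
    have R' := R.deriv
    have hP := (hf.iteratedDerivWithin (m := m) (by omega)).mono hM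
      (show J ≤ J + m + 1 - m by omega) le_rfl
    have hQ := (hf.iteratedDerivWithin (m := m + 1) (by omega)).mono hM
      (show J ≤ J + m + 1 - (m + 1) by omega) le_rfl
    have pw := fun n : ℕ => VanishesTo.pow (M := M) hM0 J n
    -- the derivative of `φ` and its inverse
    have hdφ : ∀ t, ∀ x ∈ Icc 0 (M t), derivWithin (φ t) (Icc 0 (M t)) x
        = 1 + 2 * x + derivWithin (fun x => φ t x - x - x ^ 2) (Icc 0 (M t)) x := by
      intro t x hx
      have d := (((hsφ t).differentiableOn (by simp) x hx).hasDerivWithinAt.sub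
        (hasDerivWithinAt_id x _)).sub ((hasDerivAt_pow 2 x).hasDerivWithinAt)
      have d' := d.derivWithin (uniqueDiffOn_Icc (hM0 t) x hx)
      have d'' : derivWithin (fun x => φ t x - x - x ^ 2) (Icc 0 (M t)) x = _ := d'
      rw [d'']
      simp
    have hE := (hφ.mono hM (show J + 1 ≤ J + m + 1 by omega) le_rfl).deriv
    rw [show 3 - 1 = 2 from rfl] at hE
    have hφ' : VanishesTo M J 0 (fun t x => derivWithin (φ t) (Icc 0 (M t)) x) := by
      refine (((pw 0).add (((pw 1).const_mul 2).mono hM le_rfl (Nat.zero_le _))).add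
        (hE.mono hM le_rfl (Nat.zero_le _))).congr fun t x hx => ?_
      rw [hdφ t x hx]
      simp
    have hI := hφ'.inv hM0 hM h1
    have hv : VanishesTo M J 2 (fun t x => (derivWithin (φ t) (Icc 0 (M t)) x)⁻¹
        - (1 - 2 * x)) := by
      have a1 := ((pw 2).const_mul 4).add (hE.const_mul (-1))
      have a2 := a1.add ((((pw 1).const_mul 2).mul hM hE).mono hM le_rfl (show 2 ≤ 1 + 2 by omega))
      refine (a2.mul hM hI).congr fun t x hx => ?_
      have hne : derivWithin (φ t) (Icc 0 (M t)) x ≠ 0 := by linarith [h1 t x hx]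
      have e := hdφ t x hx
      simp only
      set E := derivWithin (fun x => φ t x - x - x ^ 2) (Icc 0 (M t)) x
      rw [eq_mul_inv_iff_mul_eq₀ hne, sub_mul, inv_mul_cancel₀ hne, e]
      ring
    -- the derivative of the remainder
    have hdG : ∀ t, ∀ x ∈ Icc 0 (M t),
        derivWithin (reparamDeriv (M t) (φ t) (ψ t) m) (Icc 0 (M t)) x
        = derivWithin (fun x => reparamDeriv (M t) (φ t) (ψ t) m x
            + (1 - (lam + 2 * m) * x) * _root_.iteratedDerivWithin m (f t) (Icc 0 (M t)) x
            - m * (lam + m - 1) * _root_.iteratedDerivWithin (m - 1) (f t) (Icc 0 (M t)) x)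
            (Icc 0 (M t)) x
          - (1 - (lam + 2 * m) * x) * _root_.iteratedDerivWithin (m + 1) (f t) (Icc 0 (M t)) x
          + (lam + 2 * m + m * (lam + m - 1))
            * _root_.iteratedDerivWithin m (f t) (Icc 0 (M t)) x := by
      intro t x hx
      have hu := uniqueDiffOn_Icc (hM0 t)
      have dit : ∀ k : ℕ, HasDerivWithinAt (_root_.iteratedDerivWithin k (f t) (Icc 0 (M t)))
          (_root_.iteratedDerivWithin (k + 1) (f t) (Icc 0 (M t)) x) (Icc 0 (M t)) x := by
        intro k
        rw [iteratedDerivWithin_succ]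
        exact ((hf.contDiffOn t).differentiableOn_iteratedDerivWithin
          (by exact_mod_cast ENat.natCast_lt_top k) hu x hx).hasDerivWithinAt
      have dG := ((contDiffOn_reparamDeriv (hM0 t) (hsφ t) (hsψ t) (h1 t) m).differentiableOn
        (by simp) x hx).hasDerivWithinAt
      have dl : HasDerivWithinAt (fun x : ℝ => 1 - (lam + 2 * m) * x) (-(lam + 2 * m))
          (Icc 0 (M t)) x := by
        simpa using (((hasDerivAt_id x).const_mul (lam + 2 * m)).const_sub 1).hasDerivWithinAt
      have d := ((dG.add (dl.mul (dit m))).sub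
        ((dit (m - 1)).const_mul ((m : ℝ) * (lam + m - 1)))).derivWithin (hu x hx)
      have e : (m : ℝ) * (lam + m - 1)
          * _root_.iteratedDerivWithin (m - 1 + 1) (f t) (Icc 0 (M t)) x
          = m * (lam + m - 1) * _root_.iteratedDerivWithin m (f t) (Icc 0 (M t)) x := by
        rcases Nat.eq_zero_or_pos m with rfl | hpos
        · simp
        · rw [Nat.sub_add_cancel hpos]
      rw [e] at d
      refine Eq.trans ?_ (congrArg (fun z => z
        - (1 - (lam + 2 * m) * x) * _root_.iteratedDerivWithin (m + 1) (f t) (Icc 0 (M t)) x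
        + (lam + 2 * m + m * (lam + m - 1))
          * _root_.iteratedDerivWithin m (f t) (Icc 0 (M t)) x) d.symm)
      ring
    -- collecting the error terms
    set k : ℝ := lam + 2 * m with hk
    set c : ℝ := m * (lam + m - 1) with hc
    have b1 := ((pw 2).mul hM hQ).const_mul (-2 * k)
    have b2 := ((pw 1).mul hM hP).const_mul (-2 * (k + c))
    have b3 := R'.mul hM hI
    have b4 := (hv.mul hM hQ).const_mul (-1)
    have b5 := (hv.mul hM ((pw 1).mul hM hQ)).const_mul k
    have b6 := (hv.mul hM hP).const_mul (k + c)
    refine ((((((b1.mono hM le_rfl ?_).add (b2.mono hM le_rfl ?_)).add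
      (b3.mono hM le_rfl ?_)).add (b4.mono hM le_rfl ?_)).add (b5.mono hM le_rfl ?_)).add
      (b6.mono hM le_rfl ?_)).congr fun t x hx => ?_
    any_goals omega
    simp only [reparamDeriv, Nat.add_sub_cancel]
    rw [hdG t x hx]
    push_cast
    rw [hc, hk]
    ring

/-- The constants bounding the derivatives: each dominates the contribution of the previous one. -/
noncomputable def derivBound (lam : ℝ) : ℕ → ℝ
  | 0 => 1
  | m + 1 => 1 + (m + 1) * (lam + m) * derivBound lam m / lam

theorem one_le_derivBound {lam : ℝ} (hlam : 0 < lam) (m : ℕ) : 1 ≤ derivBound lam m := by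
  induction m with
  | zero => exact le_rfl
  | succ m ih =>
    have : 0 ≤ ((m : ℝ) + 1) * (lam + m) * derivBound lam m / lam := by positivity
    simp only [derivBound]
    linarith

theorem VanishesTo.XIA_expansion {T : Type*} {M : T → ℝ} (hM0 : ∀ t, 0 < M t) (hM : ∀ t, M t ≤ 1)
    {U L : Set (ℝ × ℝ)} (hU : IsOpen U) (hL : IsCompact L) (hLU : L ⊆ U) {J N : ℕ} (hN : 3 ≤ N)
    {f : T → ℝ → ℝ} (hf : VanishesTo M J N f) (hfL : ∀ t, ∀ x ∈ Icc 0 (M t), (x, f t x) ∈ L)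
    {θA θB : ℝ × ℝ → ℝ} (hθA : ContDiffOn ℝ (⊤ : ℕ∞) θA U) (hθB : ContDiffOn ℝ (⊤ : ℕ∞) θB U) :
    VanishesTo M J 3 (fun t x => XIA θA θB x (f t x) - x - x ^ 2) := by
  have hf0 := hf.mono hM le_rfl (Nat.zero_le N)
  have a := (VanishesTo.pow hM0 J 3).mul hM (hf0.comp hM0 hM hU hL hLU hfL hθA)
  have b := hf.mul hM (hf0.comp hM0 hM hU hL hLU hfL hθB)
  refine (a.add (b.mono hM le_rfl ?_)).congr fun t x _ => ?_
  · omega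
  · simp only [XIA]
    ring

theorem VanishesTo.YIA_expansion {T : Type*} {M : T → ℝ} (hM0 : ∀ t, 0 < M t) (hM : ∀ t, M t ≤ 1)
    {U L : Set (ℝ × ℝ)} (hU : IsOpen U) (hL : IsCompact L) (hLU : L ⊆ U) {J N : ℕ} (hN : 2 ≤ N)
    {f : T → ℝ → ℝ} (hf : VanishesTo M J N f) (hfL : ∀ t, ∀ x ∈ Icc 0 (M t), (x, f t x) ∈ L)
    {θC θD θE : ℝ × ℝ → ℝ} (hθC : ContDiffOn ℝ (⊤ : ℕ∞) θC U)
    (hθD : ContDiffOn ℝ (⊤ : ℕ∞) θD U) (hθE : ContDiffOn ℝ (⊤ : ℕ∞) θE U) (lam : ℝ) :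
    VanishesTo M J (N + 2)
      (fun t x => YIA θC θD θE lam N x (f t x) + (1 - lam * x) * f t x) := by
  have hf0 := hf.mono hM le_rfl (Nat.zero_le N)
  have c := ((hf.mul hM hf).mul hM (hf0.comp hM0 hM hU hL hLU hfL hθC)).const_mul (-1)
  have d := ((hf.mul hM (VanishesTo.pow hM0 J 2)).mul hM
    (hf0.comp hM0 hM hU hL hLU hfL hθD)).const_mul (-1)
  have e := (VanishesTo.pow hM0 J (N + 100)).mul hM (hf0.comp hM0 hM hU hL hLU hfL hθE)
  refine (((c.mono hM le_rfl ?_).add (d.mono hM le_rfl ?_)).add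
    (e.mono hM le_rfl ?_)).congr fun t x _ => ?_
  any_goals omega
  simp only [YIA]
  ring

theorem abs_le_of_expansion {x a k c lam K K' C G P Q : ℝ} (hx : 0 ≤ x) (ha : 0 ≤ a)
    (hR : |G + (1 - k * x) * P - c * Q| ≤ C * (a * x ^ 2)) (hP : |P| ≤ K * a)
    (hQ : |c * Q| ≤ c * (K' * (a * x))) (hkx : k * x ≤ 1) (hK : lam + c * K' ≤ k * K)
    (hC : C * x ≤ lam) : |G| ≤ K * a := by
  have h1 : |(1 - k * x) * P| ≤ (1 - k * x) * (K * a) := by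
    rw [abs_mul, abs_of_nonneg (by linarith)]
    exact mul_le_mul_of_nonneg_left hP (by linarith)
  have h2 : G = (G + (1 - k * x) * P - c * Q) - (1 - k * x) * P + c * Q := by ring
  have h3 : |G| ≤ C * (a * x ^ 2) + (1 - k * x) * (K * a) + c * (K' * (a * x)) := by
    rw [h2]
    refine (abs_add_le _ _).trans (add_le_add ((abs_sub _ _).trans (add_le_add hR h1)) hQ)
  have h4 : 0 ≤ (a * x) * (k * K - (lam + c * K')) :=
    mul_nonneg (mul_nonneg ha hx) (by linarith)
  have h5 : 0 ≤ (a * x) * (lam - C * x) := mul_nonneg (mul_nonneg ha hx) (by linarith)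
  linarith

/-- Curves `y = f(x)` over `[0, M]`, `M ≤ δ`, whose derivatives up to order `N - 10` satisfy the
bounds with constants `derivBound`. -/
def AdmissibleCurve (lam : ℝ) (N : ℕ) (δ : ℝ) : Type :=
  {p : ℝ × (ℝ → ℝ) // 0 < p.1 ∧ p.1 ≤ δ ∧ ContDiffOn ℝ (⊤ : ℕ∞) p.2 (Icc 0 p.1) ∧
    ∀ m ≤ N - 10, ∀ x ∈ Icc 0 p.1,
      |iteratedDerivWithin m p.2 (Icc 0 p.1) x| ≤ derivBound lam m * x ^ (N - m)}

theorem AdmissibleCurve.vanishesTo {lam : ℝ} (hlam : 0 < lam) (N : ℕ) (δ : ℝ) :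
    VanishesTo (fun t : AdmissibleCurve lam N δ => t.1.1) (N - 10) N (fun t => t.1.2) :=
  VanishesTo.of_iteratedDerivWithin (fun t => t.2.1) (fun t => t.2.2.2.1) fun m hm =>
    ⟨derivBound lam m, zero_le_one.trans (one_le_derivBound hlam m),
      fun t x hx => t.2.2.2.2 m hm x hx⟩

theorem AdmissibleCurve.abs_le {lam : ℝ} {N : ℕ} {δ : ℝ} (t : AdmissibleCurve lam N δ) {x : ℝ}
    (hx : x ∈ Icc 0 t.1.1) : |t.1.2 x| ≤ x ^ N := by
  simpa [derivBound] using t.2.2.2.2 0 (Nat.zero_le _) x hx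

theorem AdmissibleCurve.mem_closedBall {lam : ℝ} {N : ℕ} (hN : N ≠ 0) {δ : ℝ} (hδ : δ ≤ 1)
    (t : AdmissibleCurve lam N δ) {x : ℝ} (hx : x ∈ Icc 0 t.1.1) :
    (x, t.1.2 x) ∈ Metric.closedBall (0 : ℝ × ℝ) δ := by
  have hxδ : x ≤ δ := hx.2.trans t.2.2.1
  have h := (t.abs_le hx).trans (pow_le_of_le_one hx.1 (hxδ.trans hδ) hN)
  rw [mem_closedBall_zero_iff, Prod.norm_def, max_le_iff, Real.norm_eq_abs, Real.norm_eq_abs,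
    abs_of_nonneg hx.1]
  exact ⟨hxδ, h.trans hxδ⟩

theorem derivWithin_XIA_ge_one {M C : ℝ} (hM : 0 < M) {φ : ℝ → ℝ}
    (hφ : DifferentiableOn ℝ φ (Icc 0 M))
    (hC : ∀ x ∈ Icc 0 M, |derivWithin (fun x => φ x - x - x ^ 2) (Icc 0 M) x| ≤ C * x ^ 2)
    (hCM : ∀ x ∈ Icc 0 M, C * x ≤ 1) :
    ∀ x ∈ Icc 0 M, 1 ≤ derivWithin φ (Icc 0 M) x := by
  intro x hx
  have d := (((hφ x hx).hasDerivWithinAt.sub (hasDerivWithinAt_id x _)).sub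
    ((hasDerivAt_pow 2 x).hasDerivWithinAt)).derivWithin (uniqueDiffOn_Icc hM x hx)
  have d' : derivWithin (fun x => φ x - x - x ^ 2) (Icc 0 M) x = _ := d
  have h := (abs_le.1 (hC x hx)).1
  rw [d'] at h
  norm_num at h
  nlinarith [mul_nonneg hx.1 (sub_nonneg.2 (hCM x hx)), hx.1]

/-- **Assertion 5.** For `Φ` of the form (IA) there exist constants
`K 1, …, K (N-10) > 0`, `C > 0` and `δ > 0` such that: if `f` is `C^∞` on
`[0, x_MAX]` with `0 < x_MAX ≤ δ`, `|f(x)| ≤ xᴺ` and `|f⁽ᵐ⁾(x)| ≤ K_m x^(N-m)` for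
`m = 1, …, N-10`, then `Φ` maps the graph of `f` onto the graph of a `C^∞` function
`F` on `[0, X_MAX]` satisfying the same bounds, and
`|X_MAX - (x_MAX + x_MAX²)| ≤ C x_MAX³`. -/
theorem assertion5
    (θA θB θC θD θE : ℝ × ℝ → ℝ) (V : Set (ℝ × ℝ)) (hV : V ∈ 𝓝 (0 : ℝ × ℝ))
    (hθA : ContDiffOn ℝ (⊤ : ℕ∞) θA V) (hθB : ContDiffOn ℝ (⊤ : ℕ∞) θB V)
    (hθC : ContDiffOn ℝ (⊤ : ℕ∞) θC V) (hθD : ContDiffOn ℝ (⊤ : ℕ∞) θD V)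
    (hθE : ContDiffOn ℝ (⊤ : ℕ∞) θE V)
    (lam : ℝ) (hlam : 0 < lam) (N : ℕ) (hN : 100 ≤ N)
    :
    ∃ K : ℕ → ℝ, (∀ m : ℕ, 1 ≤ m → m ≤ N - 10 → 0 < K m) ∧
    ∃ C > (0 : ℝ), ∃ δ > (0 : ℝ), ∀ (xMAX : ℝ) (f : ℝ → ℝ),
      0 < xMAX → xMAX ≤ δ →
      ContDiffOn ℝ (⊤ : ℕ∞) f (Icc 0 xMAX) →
      (∀ x ∈ Icc (0 : ℝ) xMAX, |f x| ≤ x ^ N) →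
      (∀ m : ℕ, 1 ≤ m → m ≤ N - 10 → ∀ x ∈ Icc (0 : ℝ) xMAX,
        |iteratedDerivWithin m f (Icc 0 xMAX) x| ≤ K m * x ^ (N - m)) →
      ∃ XMAX > (0 : ℝ), ∃ F : ℝ → ℝ,
        ContDiffOn ℝ (⊤ : ℕ∞) F (Icc 0 XMAX) ∧
        (fun x => (XIA θA θB x (f x), YIA θC θD θE lam N x (f x))) '' Icc 0 xMAX
          = (fun X => (X, F X)) '' Icc 0 XMAX ∧
        (∀ X ∈ Icc (0 : ℝ) XMAX, |F X| ≤ X ^ N) ∧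
        (∀ m : ℕ, 1 ≤ m → m ≤ N - 10 → ∀ X ∈ Icc (0 : ℝ) XMAX,
          |iteratedDerivWithin m F (Icc 0 XMAX) X| ≤ K m * X ^ (N - m)) ∧
        |XMAX - (xMAX + xMAX ^ 2)| ≤ C * xMAX ^ 3 := by
  obtain ⟨r, hr, hrV⟩ := Metric.mem_nhds_iff.1 hV
  have sm : ∀ {θ : ℝ × ℝ → ℝ}, ContDiffOn ℝ (⊤ : ℕ∞) θ V →
      ContDiffOn ℝ (⊤ : ℕ∞) θ (Metric.ball 0 r) := fun h => h.mono hrV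
  set δ₀ : ℝ := min (r / 2) 1 with hδ₀
  have hδ₀pos : 0 < δ₀ := by positivity
  have hδ₀one : δ₀ ≤ 1 := min_le_right _ _
  have hLU : ∀ δ ≤ δ₀, Metric.closedBall (0 : ℝ × ℝ) δ ⊆ Metric.ball 0 r := fun δ hδ =>
    Metric.closedBall_subset_ball (by linarith [min_le_left (r / 2) 1])
  have hL : ∀ δ : ℝ, IsCompact (Metric.closedBall (0 : ℝ × ℝ) δ) := fun δ =>
    isCompact_closedBall 0 δ
  have hX : ∀ δ ≤ δ₀, VanishesTo (fun t : AdmissibleCurve lam N δ => t.1.1) (N - 10) 3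
      (fun t x => XIA θA θB x (t.1.2 x) - x - x ^ 2) := fun δ hδ =>
    VanishesTo.XIA_expansion (fun t => t.2.1) (fun t => t.2.2.1.trans (hδ.trans hδ₀one))
      Metric.isOpen_ball (hL δ) (hLU δ hδ) (by omega) (AdmissibleCurve.vanishesTo hlam N δ)
      (fun t x hx => t.mem_closedBall (by omega) (hδ.trans hδ₀one) hx) (sm hθA) (sm hθB)
  have hY : ∀ δ ≤ δ₀, VanishesTo (fun t : AdmissibleCurve lam N δ => t.1.1) (N - 10) (N + 2)
      (fun t x => YIA θC θD θE lam N x (t.1.2 x) + (1 - lam * x) * t.1.2 x) := fun δ hδ =>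
    VanishesTo.YIA_expansion (fun t => t.2.1) (fun t => t.2.2.1.trans (hδ.trans hδ₀one))
      Metric.isOpen_ball (hL δ) (hLU δ hδ) (by omega) (AdmissibleCurve.vanishesTo hlam N δ)
      (fun t x hx => t.mem_closedBall (by omega) (hδ.trans hδ₀one) hx) (sm hθC) (sm hθD)
      (sm hθE) lam
  have hXsmooth : ∀ δ ≤ δ₀, ∀ t : AdmissibleCurve lam N δ,
      ContDiffOn ℝ (⊤ : ℕ∞) (fun x => XIA θA θB x (t.1.2 x)) (Icc 0 t.1.1) := fun δ hδ t =>
    (((hX δ hδ).contDiffOn t).add (contDiffOn_id.add (contDiffOn_id.pow 2))).congr fun x _ => by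
      simp
  have hYsmooth : ∀ δ ≤ δ₀, ∀ t : AdmissibleCurve lam N δ,
      ContDiffOn ℝ (⊤ : ℕ∞) (fun x => YIA θC θD θE lam N x (t.1.2 x)) (Icc 0 t.1.1) :=
    fun δ hδ t => (((hY δ hδ).contDiffOn t).sub ((contDiffOn_const.sub
      (contDiffOn_const.mul contDiffOn_id)).mul t.2.2.2.1)).congr fun x _ => by
        change _ = YIA θC θD θE lam N x (t.1.2 x) + (1 - lam * x) * t.1.2 x
          - (1 - lam * x) * t.1.2 x
        ring
  obtain ⟨C₀, hC₀, hXbound⟩ := (hX δ₀ le_rfl).bound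
  obtain ⟨C₁, hC₁, hXderiv⟩ := VanishesTo.bound
    (VanishesTo.deriv ((hX δ₀ le_rfl).mono (fun t => t.2.2.1.trans hδ₀one)
      (show 0 + 1 ≤ N - 10 by omega) le_rfl))
  set δ₁ : ℝ := min δ₀ (1 / (C₁ + 1)) with hδ₁
  have hδ₁pos : 0 < δ₁ := by positivity
  have hδ₁₀ : δ₁ ≤ δ₀ := min_le_left _ _
  have hX1 : ∀ t : AdmissibleCurve lam N δ₁, ∀ x ∈ Icc 0 t.1.1,
      1 ≤ derivWithin (fun x => XIA θA θB x (t.1.2 x)) (Icc 0 t.1.1) x := by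
    intro t
    refine derivWithin_XIA_ge_one (C := C₁) t.2.1
      ((hXsmooth δ₁ hδ₁₀ t).differentiableOn (by simp))
      (hXderiv ⟨t.1, t.2.1, t.2.2.1.trans hδ₁₀, t.2.2.2⟩) fun x hx => ?_
    have h := hx.2.trans (t.2.2.1.trans (min_le_right _ _))
    rw [le_div_iff₀ (by positivity)] at h
    linarith [hx.1]
  have hG := fun m (hm : m ≤ N - 10) => (VanishesTo.reparamDeriv_expansion
    (fun t : AdmissibleCurve lam N δ₁ => t.2.1)
    (fun t => t.2.2.1.trans (hδ₁₀.trans hδ₀one)) (Nat.sub_le N 10)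
    (AdmissibleCurve.vanishesTo hlam N δ₁) (hX δ₁ hδ₁₀) hX1 (hY δ₁ hδ₁₀) hm).bound
  choose! C₂ hC₂ hG using hG
  set C₃ : ℝ := ∑ m ∈ Finset.range (N - 10 + 1), C₂ m with hC₃def
  have hC₂₃ : ∀ m ≤ N - 10, C₂ m ≤ C₃ := fun m hm =>
    Finset.single_le_sum (f := C₂) (fun i hi => hC₂ i (by simpa [Nat.lt_succ_iff] using hi))
      (by simpa [Nat.lt_succ_iff] using hm)
  have hC₃ : 0 ≤ C₃ := (hC₂ 0 (Nat.zero_le _)).trans (hC₂₃ 0 (Nat.zero_le _))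
  refine ⟨derivBound lam, fun m _ _ => zero_lt_one.trans_le (one_le_derivBound hlam m),
    C₀ + 1, by positivity, min δ₁ (min (lam / (C₃ + 1)) (1 / (lam + 2 * N))), by positivity, ?_⟩
  intro M f hM hMδ hf hf0 hfm
  have hMδ₁ : M ≤ δ₁ := hMδ.trans (min_le_left _ _)
  have hfK : ∀ m ≤ N - 10, ∀ x ∈ Icc 0 M,
      |iteratedDerivWithin m f (Icc 0 M) x| ≤ derivBound lam m * x ^ (N - m) := by
    intro m hm x hx
    rcases Nat.eq_zero_or_pos m with rfl | hpos
    · simpa [derivBound] using hf0 x hx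
    · exact hfm m hpos hm x hx
  let t : AdmissibleCurve lam N δ₁ := ⟨(M, f), hM, hMδ₁, hf, hfK⟩
  have hf00 : f 0 = 0 := by
    have := hf0 0 ⟨le_rfl, hM.le⟩
    rwa [zero_pow (by omega), abs_nonpos_iff] at this
  set φ : ℝ → ℝ := fun x => XIA θA θB x (f x) with hφdef
  set ψ : ℝ → ℝ := fun x => YIA θC θD θE lam N x (f x) with hψdef
  have hφs : ContDiffOn ℝ (⊤ : ℕ∞) φ (Icc 0 M) := hXsmooth δ₁ hδ₁₀ t
  have hψs : ContDiffOn ℝ (⊤ : ℕ∞) ψ (Icc 0 M) := hYsmooth δ₁ hδ₁₀ t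
  have hφ1 : ∀ x ∈ Icc 0 M, 1 ≤ derivWithin φ (Icc 0 M) x := hX1 t
  obtain ⟨hle, himage, g, hg, hgφ⟩ := exists_contDiffOn_inverse hM hφs
    (by simp [hφdef, XIA, hf00]) hφ1
  have hMmem : M ∈ Icc 0 M := ⟨hM.le, le_rfl⟩
  have hφM : 0 < φ M := hM.trans_le (hle M hMmem)
  have hmaps : MapsTo φ (Icc 0 M) (Icc 0 (φ M)) := by
    rw [← himage]
    exact mapsTo_image _ _
  have hF : ContDiffOn ℝ (⊤ : ℕ∞) (ψ ∘ g) (Icc 0 (φ M)) := by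
    refine hψs.comp hg ?_
    rw [← himage]
    rintro _ ⟨x, hx, rfl⟩
    rwa [hgφ x hx]
  have hFφ : ∀ x ∈ Icc 0 M, (ψ ∘ g) (φ x) = ψ x := fun x hx => by
    rw [Function.comp_apply, hgφ x hx]
  have main : ∀ m ≤ N - 10, ∀ X ∈ Icc 0 (φ M),
      |iteratedDerivWithin m (ψ ∘ g) (Icc 0 (φ M)) X| ≤ derivBound lam m * X ^ (N - m) := by
    intro m hm
    rw [← himage]
    rintro _ ⟨x, hx, rfl⟩
    rw [himage, iteratedDerivWithin_eq_reparamDeriv hM hφM hφs hφ1 hmaps hF hFφ m x hx]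
    have hx0 : 0 ≤ x := hx.1
    have hKpos := one_le_derivBound hlam m
    refine le_trans ?_ (mul_le_mul_of_nonneg_left (pow_le_pow_left₀ hx0 (hle x hx) (N - m))
      (zero_le_one.trans hKpos))
    have hxδ : x ≤ min (lam / (C₃ + 1)) (1 / (lam + 2 * N)) :=
      hx.2.trans (hMδ.trans (min_le_right _ _))
    have hxC : C₂ m * x ≤ lam := by
      have h := hxδ.trans (min_le_left _ _)
      rw [le_div_iff₀ (by positivity)] at h
      have := mul_le_mul_of_nonneg_right (hC₂₃ m hm) hx0
      linarith
    have hxk : (lam + 2 * m) * x ≤ 1 := by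
      have h := hxδ.trans (min_le_right _ _)
      rw [le_div_iff₀ (by positivity)] at h
      have hmN : (m : ℝ) ≤ N := by exact_mod_cast (show m ≤ N by omega)
      have := mul_le_mul_of_nonneg_right hmN hx0
      linarith
    have hR := hG m hm t x hx
    rw [show N + 2 - m = N - m + 2 by omega, pow_add] at hR
    have hP := hfK m hm x hx
    rcases m with _ | m
    · refine abs_le_of_expansion (K' := 0) hx0 (pow_nonneg hx0 _) hR hP ?_ hxk ?_ hxC <;>
        simp [derivBound]
    · have hQ := hfK m (by omega) x hx
      have hc : 0 ≤ ((m + 1 : ℕ) : ℝ) * (lam + (m + 1 : ℕ) - 1) := by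
        push_cast
        have : 0 ≤ lam + ((m : ℝ) + 1) - 1 := by linarith [Nat.cast_nonneg (α := ℝ) m]
        positivity
      refine abs_le_of_expansion (K' := derivBound lam m) hx0 (pow_nonneg hx0 _) hR hP ?_ hxk
        ?_ hxC
      · rw [abs_mul, abs_of_nonneg hc, ← pow_succ, show N - (m + 1) + 1 = N - m by omega]
        exact mul_le_mul_of_nonneg_left hQ hc
      · have e : lam + ((m + 1 : ℕ) : ℝ) * (lam + (m + 1 : ℕ) - 1) * derivBound lam m
            = lam * derivBound lam (m + 1) := by
          simp only [derivBound]
          push_cast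
          field_simp
          ring
        rw [e]
        have : (0 : ℝ) ≤ (m + 1 : ℕ) := Nat.cast_nonneg _
        exact mul_le_mul_of_nonneg_right (by linarith) (zero_le_one.trans hKpos)
  refine ⟨φ M, hφM, ψ ∘ g, hF, ?_, fun X hX => ?_, fun m _ hm => main m hm, ?_⟩
  · rw [← himage, image_image]
    exact image_congr fun x hx => by rw [hFφ x hx]
  · simpa [derivBound] using main 0 (Nat.zero_le _) X hX
  · have h := hXbound ⟨(M, f), hM, hMδ₁.trans hδ₁₀, hf, hfK⟩ M hMmem
    rw [← sub_sub]
    have h3 : 0 ≤ M ^ 3 := by positivity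
    calc |φ M - M - M ^ 2| ≤ C₀ * M ^ 3 := h
      _ ≤ (C₀ + 1) * M ^ 3 := by linarith
end

section
/- Let N ≥ 100 and let Φ be of the form (IA). Then there exist δ > 0, constants K₁, …, K_{N−11} > 0, and a function F of class C^(N−11) on [0, δ] with the following properties: (i) |F(x)| ≤ x^N for x ∈ [0, δ]; (ii) |F^(m)(x)| ≤ K_m x^(N−m) for x ∈ [0, δ] and 1 ≤ m ≤ N−11; (iii) for every x̄ ∈ [0, δ/2] there exists x̂ ∈ [0, x̄] such that (x̄, F(x̄)) = Φ(x̂, F(x̂)). -/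
open Set Filter Asymptotics Topology

open scoped ContDiff

/-- Points `(x, y₀, …, y_M)` of the space of `M`-jets of functions of one variable. -/
abbrev Jet (M : ℕ) : Type := ℝ × (Fin (M + 1) → ℝ)

/-- The shift `(y₀, …, y_M) ↦ (y₁, …, y_M, 0)`. -/
noncomputable def jetShift (M : ℕ) : (Fin (M + 1) → ℝ) →L[ℝ] (Fin (M + 1) → ℝ) :=
  ContinuousLinearMap.pi fun i =>
    if h : (i : ℕ) + 1 < M + 1 then ContinuousLinearMap.proj (⟨i + 1, h⟩ : Fin (M + 1)) else 0

/-- Keep the coordinates of index `< j` and replace the others by `0`. -/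
def jetTrunc {M : ℕ} (j : ℕ) (y : Fin (M + 1) → ℝ) : Fin (M + 1) → ℝ :=
  fun i => if (i : ℕ) < j then y i else 0

/-- The `j`-th coordinate vector. -/
def jetUnit (M j : ℕ) : Fin (M + 1) → ℝ := fun i => if (i : ℕ) = j then 1 else 0

/-- The total derivative of a function on the jet space: the derivative of
`x ↦ H (x, f x, f' x, …)` expressed through the jet of `f`. -/
noncomputable def totalDeriv {M : ℕ} (H : Jet M → ℝ) (z : Jet M) : ℝ :=
  fderiv ℝ H z (1, jetShift M z.2)

/-- `H` depends only on `x` and on the coordinates of index `≤ j`. -/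
def DependsUpTo {M : ℕ} (j : ℕ) (H : Jet M → ℝ) : Prop :=
  ∀ (z : Jet M) (w : Fin (M + 1) → ℝ), (∀ i : Fin (M + 1), (i : ℕ) ≤ j → w i = 0) →
    H (z + (0, w)) = H z

/-- The prolongation of `(X, Y)`: if the graph of `f` is mapped by `(X, Y)` to the graph of `g`,
then `prolong X Y j` expresses the `j`-th derivative of `g` through the jet of `f`. -/
noncomputable def prolong {M : ℕ} (X Y : Jet M → ℝ) : ℕ → Jet M → ℝ
  | 0 => Y
  | j + 1 => fun z => totalDeriv (prolong X Y j) z / totalDeriv X z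

section Jets

variable {M : ℕ}

lemma jetShift_apply_lt (y : Fin (M + 1) → ℝ) (i : Fin (M + 1)) (h : (i : ℕ) + 1 < M + 1) :
    jetShift M y i = y ⟨i + 1, h⟩ := by
  have : jetShift M y i = (if h : (i : ℕ) + 1 < M + 1 then
    ContinuousLinearMap.proj (⟨i + 1, h⟩ : Fin (M + 1)) else 0 :
      (Fin (M + 1) → ℝ) →L[ℝ] ℝ) y := rfl
  rw [this, dif_pos h]
  rfl

lemma jetShift_apply_ge (y : Fin (M + 1) → ℝ) (i : Fin (M + 1)) (h : ¬ (i : ℕ) + 1 < M + 1) :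
    jetShift M y i = 0 := by
  have : jetShift M y i = (if h : (i : ℕ) + 1 < M + 1 then
    ContinuousLinearMap.proj (⟨i + 1, h⟩ : Fin (M + 1)) else 0 :
      (Fin (M + 1) → ℝ) →L[ℝ] ℝ) y := rfl
  rw [this, dif_neg h]
  rfl

lemma jetShift_unit {j : ℕ} (hj : j + 1 ≤ M) :
    jetShift M (jetUnit M (j + 1)) = jetUnit M j := by
  funext i
  by_cases h : (i : ℕ) + 1 < M + 1
  · rw [jetShift_apply_lt _ _ h]; simp [jetUnit]
  · rw [jetShift_apply_ge _ _ h]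
    have : (i : ℕ) ≠ j := by omega
    simp [jetUnit, this]

lemma norm_jetTrunc_le {j : ℕ} {y : Fin (M + 1) → ℝ} {c : ℝ} (hc : 0 ≤ c)
    (h : ∀ i : Fin (M + 1), (i : ℕ) < j → |y i| ≤ c) : ‖jetTrunc j y‖ ≤ c := by
  rw [pi_norm_le_iff_of_nonneg hc]
  intro i
  by_cases hi : (i : ℕ) < j
  · simpa [jetTrunc, hi] using h i hi
  · simpa [jetTrunc, hi] using hc

lemma jetTrunc_succ (j : Fin (M + 1)) (y : Fin (M + 1) → ℝ) :
    jetTrunc ((j : ℕ) + 1) y = jetTrunc j y + y j • jetUnit M j := by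
  funext i
  rcases lt_trichotomy (i : ℕ) j with h | h | h
  · have h2 : (i : ℕ) ≠ j := h.ne
    have h3 : (i : ℕ) < j + 1 := by omega
    simp [jetTrunc, jetUnit, h, h2, h3]
  · obtain rfl : i = j := Fin.ext h
    simp [jetTrunc, jetUnit]
  · have h1 : ¬ (i : ℕ) < j := by omega
    have h2 : (i : ℕ) ≠ j := by omega
    have h3 : ¬ (i : ℕ) < j + 1 := by omega
    simp only [jetTrunc, jetUnit, h1, h2, h3, if_false, Pi.add_apply, Pi.smul_apply]
    simp

lemma DependsUpTo.mono {j k : ℕ} {H : Jet M → ℝ} (h : DependsUpTo j H) (hjk : j ≤ k) :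
    DependsUpTo k H :=
  fun z w hw => h z w fun i hi => hw i (hi.trans hjk)

lemma DependsUpTo.apply_trunc {j : ℕ} {H : Jet M → ℝ} (h : DependsUpTo j H) {k : ℕ} (hjk : j < k)
    (x : ℝ) (y : Fin (M + 1) → ℝ) : H (x, jetTrunc k y) = H (x, y) := by
  have := h (x, y) (jetTrunc k y - y) (fun i hi => by
    have : (i : ℕ) < k := by omega
    simp [jetTrunc, this])
  simpa using this

lemma DependsUpTo.fderiv_add {j : ℕ} {H : Jet M → ℝ} (h : DependsUpTo j H) (z : Jet M)
    {w : Fin (M + 1) → ℝ} (hw : ∀ i : Fin (M + 1), (i : ℕ) ≤ j → w i = 0) :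
    fderiv ℝ H (z + (0, w)) = fderiv ℝ H z := by
  rw [← fderiv_comp_add_right]
  congr 1
  funext z
  exact h z w hw

lemma DependsUpTo.fderiv_apply {j : ℕ} {H : Jet M → ℝ} (h : DependsUpTo j H) (z : Jet M)
    {w : Fin (M + 1) → ℝ} (hw : ∀ i : Fin (M + 1), (i : ℕ) ≤ j → w i = 0) :
    fderiv ℝ H z (0, w) = 0 := by
  by_cases hd : DifferentiableAt ℝ H z
  · rw [← hd.lineDeriv_eq_fderiv, lineDeriv]
    have : (fun t : ℝ => H (z + t • ((0 : ℝ), w))) = fun _ => H z := by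
      funext t
      have := h z (t • w) (fun i hi => by simp [hw i hi])
      simpa using this
    rw [this, deriv_const]
  · simp [fderiv_zero_of_not_differentiableAt hd]

lemma DependsUpTo.totalDeriv {j : ℕ} {H : Jet M → ℝ} (h : DependsUpTo j H) :
    DependsUpTo (j + 1) (totalDeriv H) := by
  intro z w hw
  have h1 := h.fderiv_add z (w := w) fun i hi => hw i (by omega)
  have h2 := h.fderiv_apply z (w := jetShift M w) fun i hi => by
    by_cases hi' : (i : ℕ) + 1 < M + 1
    · rw [jetShift_apply_lt _ _ hi']
      exact hw _ (by simpa using hi)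
    · exact jetShift_apply_ge _ _ hi'
  unfold _root_.totalDeriv
  rw [h1]
  have : ((1 : ℝ), jetShift M (z + (0, w)).2) = (1, jetShift M z.2) + (0, jetShift M w) := by
    simp
  rw [this, map_add, h2, add_zero]

lemma DependsUpTo.prolong {X Y : Jet M → ℝ} (hX : DependsUpTo 0 X) (hY : DependsUpTo 0 Y) (j : ℕ) :
    DependsUpTo j (prolong X Y j) := by
  induction j with
  | zero => exact hY
  | succ j ih =>
    intro z w hw
    have h1 := ih.totalDeriv z w hw
    have h2 := (hX.totalDeriv.mono (by omega : 0 + 1 ≤ j + 1)) z w hw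
    simp only [_root_.prolong, h1, h2]

/-- The total derivative is affine in the highest coordinate. -/
lemma DependsUpTo.fderiv_totalDeriv {j : ℕ} {H : Jet M → ℝ} (h : DependsUpTo j H) (hj : j + 1 ≤ M)
    {z : Jet M} (hd : DifferentiableAt ℝ (_root_.totalDeriv H) z) :
    fderiv ℝ (_root_.totalDeriv H) z (0, jetUnit M (j + 1)) = fderiv ℝ H z (0, jetUnit M j) := by
  rw [← hd.lineDeriv_eq_fderiv, lineDeriv]
  have : (fun t : ℝ => _root_.totalDeriv H (z + t • ((0 : ℝ), jetUnit M (j + 1)))) =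
      fun t => _root_.totalDeriv H z + t * fderiv ℝ H z (0, jetUnit M j) := by
    funext t
    have h1 := h.fderiv_add z (w := t • jetUnit M (j + 1)) (fun i hi => by
      have : (i : ℕ) ≠ j + 1 := by omega
      simp [jetUnit, this])
    have e : z + t • ((0 : ℝ), jetUnit M (j + 1)) = z + (0, t • jetUnit M (j + 1)) := by simp
    unfold _root_.totalDeriv
    rw [e, h1]
    have e2 : ((1 : ℝ), jetShift M (z + (0, t • jetUnit M (j + 1))).2) =
        (1, jetShift M z.2) + t • (0, jetUnit M j) := by
      simp [jetShift_unit hj]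
    rw [e2, map_add, map_smul, smul_eq_mul]
  rw [this]
  simp

lemma contDiffAt_totalDeriv {H : Jet M → ℝ} {z : Jet M} (h : ContDiffAt ℝ ∞ H z) :
    ContDiffAt ℝ ∞ (totalDeriv H) z := by
  unfold totalDeriv
  refine (h.fderiv_right (m := ∞) (by rfl)).clm_apply ?_
  fun_prop

lemma contDiffAt_prolong {X Y : Jet M → ℝ} {z : Jet M} (hX : ContDiffAt ℝ ∞ X z)
    (hY : ContDiffAt ℝ ∞ Y z) (hP : totalDeriv X z ≠ 0) (j : ℕ) :
    ContDiffAt ℝ ∞ (prolong X Y j) z := by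
  induction j with
  | zero => exact hY
  | succ j ih => exact (contDiffAt_totalDeriv ih).div (contDiffAt_totalDeriv hX) hP

lemma ContDiffAt.eventually_top {E : Type*} [NormedAddCommGroup E] [NormedSpace ℝ E]
    {H : E → ℝ} {z : E} (h : ContDiffAt ℝ ∞ H z) (n : ℕ) :
    ∀ᶠ z' in 𝓝 z, ContDiffAt ℝ n H z' :=
  (h.of_le (by exact_mod_cast le_top)).eventually (by simp)

lemma tendsto_axis : Tendsto (fun x : ℝ => ((x, 0) : Jet M)) (𝓝 0) (𝓝 0) := by
  have : Continuous (fun x : ℝ => ((x, 0) : Jet M)) := by fun_prop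
  exact this.tendsto' 0 0 rfl

lemma totalDeriv_axis {H : Jet M → ℝ} {x : ℝ} (h : DifferentiableAt ℝ H (x, 0)) :
    HasDerivAt (fun t : ℝ => H (t, 0)) (totalDeriv H (x, 0)) x := by
  have h1 : HasDerivAt (fun t : ℝ => ((t, 0) : Jet M)) (1, 0) x :=
    (hasDerivAt_id x).prodMk (hasDerivAt_const x _)
  have h2 : HasFDerivAt H (fderiv ℝ H (x, 0)) ((fun t : ℝ => ((t, 0) : Jet M)) x) :=
    h.hasFDerivAt
  have := h2.comp_hasDerivAt x h1
  simpa [totalDeriv, Function.comp_def] using this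

lemma prolong_axis {X Y : Jet M → ℝ} (hX : ContDiffAt ℝ ∞ X 0) (hY : ContDiffAt ℝ ∞ Y 0)
    (hP : totalDeriv X 0 ≠ 0) {k : ℕ} {s : ℝ → ℝ} (hs : ContDiffAt ℝ ∞ s 0)
    (hYs : ∀ᶠ x in 𝓝 (0 : ℝ), Y (x, 0) = x ^ k * s x) :
    ∀ j ≤ k, ∃ s : ℝ → ℝ, ContDiffAt ℝ ∞ s 0 ∧
      ∀ᶠ x in 𝓝 (0 : ℝ), prolong X Y j (x, 0) = x ^ (k - j) * s x := by
  intro j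
  induction j with
  | zero => exact fun _ => ⟨s, hs, by simpa [prolong] using hYs⟩
  | succ j ih =>
    intro hj
    obtain ⟨σ, hσ, hσe⟩ := ih (by omega)
    have hax : ContDiffAt ℝ ∞ (fun x : ℝ => ((x, 0) : Jet M)) 0 := by fun_prop
    have hPs : ContDiffAt ℝ ∞ (fun x : ℝ => totalDeriv X ((x, 0) : Jet M)) 0 :=
      ContDiffAt.comp (0 : ℝ) (g := totalDeriv X) (contDiffAt_totalDeriv hX) hax
    have hσ' : ContDiffAt ℝ ∞ (deriv σ) 0 := by
      have : deriv σ = fun x => fderiv ℝ σ x 1 := by funext x; simp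
      rw [this]
      exact (hσ.fderiv_right (m := ∞) (by rfl)).clm_apply contDiffAt_const
    obtain ⟨m, hm⟩ : ∃ m, k - j = m + 1 := ⟨k - j - 1, by omega⟩
    refine ⟨fun x => ((m + 1) * σ x + x * deriv σ x) / totalDeriv X ((x, 0) : Jet M), ?_, ?_⟩
    · refine ContDiffAt.div ?_ hPs hP
      fun_prop
    · have hd : ∀ᶠ x in 𝓝 (0 : ℝ), ContDiffAt ℝ (1 : ℕ) (prolong X Y j) ((x, 0) : Jet M) :=
        tendsto_axis.eventually ((contDiffAt_prolong hX hY hP j).eventually_top 1)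
      filter_upwards [hd, hσe.eventually_nhds, hσ.eventually_top 1] with x h1 h2 h3
      have e1 := totalDeriv_axis (h1.differentiableAt (by simp))
      have e2 : HasDerivAt (fun t => t ^ (k - j) * σ t)
          ((m + 1) * x ^ m * σ x + x ^ (m + 1) * deriv σ x) x := by
        rw [hm]
        have := (hasDerivAt_pow (m + 1) x).mul (h3.differentiableAt (by simp)).hasDerivAt
        simpa [Pi.mul_def] using this
      have e3 := e1.unique (e2.congr_of_eventuallyEq h2)
      have hk : k - (j + 1) = m := by omega
      simp only [prolong, e3, hk]
      ring

lemma prolong_axis_le {X Y : Jet M → ℝ} (hX : ContDiffAt ℝ ∞ X 0) (hY : ContDiffAt ℝ ∞ Y 0)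
    (hP : totalDeriv X 0 ≠ 0) {k l : ℕ} {s : ℝ → ℝ} (hs : ContDiffAt ℝ ∞ s 0)
    (hYs : ∀ᶠ x in 𝓝 (0 : ℝ), Y (x, 0) = x ^ k * s x) (hl : l ≤ k) {j : ℕ} (hj : j ≤ l) :
    ∃ C : ℝ, 0 ≤ C ∧ ∀ᶠ x in 𝓝 (0 : ℝ), 0 ≤ x → |prolong X Y j (x, 0)| ≤ C * x ^ (l - j) := by
  obtain ⟨σ, hσ, hσe⟩ := prolong_axis hX hY hP hs hYs j (by omega)
  refine ⟨|σ 0| + 1, by positivity, ?_⟩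
  have hb : ∀ᶠ x in 𝓝 (0 : ℝ), |σ x| < |σ 0| + 1 :=
    hσ.continuousAt.abs.eventually_lt continuousAt_const (by simp)
  filter_upwards [hσe, hb, Iic_mem_nhds (zero_lt_one (α := ℝ))] with x h1 h2 h3 h0
  rw [h1, abs_mul, abs_pow, abs_of_nonneg h0, mul_comm]
  exact mul_le_mul h2.le (pow_le_pow_of_le_one h0 h3 (by omega)) (by positivity) (by positivity)

lemma fderiv_prolong_axis_le {X Y : Jet M → ℝ} (hX : ContDiffAt ℝ ∞ X 0)
    (hY : ContDiffAt ℝ ∞ Y 0) (dX : DependsUpTo 0 X) (dY : DependsUpTo 0 Y)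
    (hP : totalDeriv X 0 ≠ 0)
    (hP1 : ∀ᶠ x in 𝓝 (0 : ℝ), 0 ≤ x → 1 ≤ totalDeriv X ((x, 0) : Jet M))
    {k : ℕ} {s : ℝ → ℝ} (hs : ContDiffAt ℝ ∞ s 0)
    (hYs : ∀ᶠ x in 𝓝 (0 : ℝ), Y (x, 0) = x ^ k * s x) (hk : M + 2 ≤ k)
    {lam C₀ : ℝ} (hC₀ : 0 ≤ C₀) (hY1 : ∀ᶠ x in 𝓝 (0 : ℝ), 0 ≤ x →
      |fderiv ℝ Y (x, 0) (0, jetUnit M 0)| ≤ 1 - lam * x + C₀ * x ^ 2) :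
    ∀ j ≤ M, ∃ C : ℝ, 0 ≤ C ∧ ∀ᶠ x in 𝓝 (0 : ℝ), 0 ≤ x →
      |fderiv ℝ (prolong X Y j) (x, 0) (0, jetUnit M j)| ≤ 1 - lam * x + C * x ^ 2 := by
  intro j
  induction j with
  | zero => exact fun _ => ⟨C₀, hC₀, hY1⟩
  | succ j ih =>
    intro hj
    obtain ⟨C, hC, hCe⟩ := ih (by omega)
    obtain ⟨D, hD, hDe⟩ := prolong_axis_le hX hY hP hs hYs hk (j := j + 1) (by omega)
    set G : Jet M → ℝ := fun z => fderiv ℝ (totalDeriv X) z (0, jetUnit M (j + 1)) with hG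
    have hGc : ContinuousAt G 0 := by
      have : ContDiffAt ℝ ∞ G 0 :=
        ((contDiffAt_totalDeriv hX).fderiv_right (m := ∞) (by rfl)).clm_apply contDiffAt_const
      exact this.continuousAt
    have hGb : ∀ᶠ x in 𝓝 (0 : ℝ), |G ((x, 0) : Jet M)| < |G 0| + 1 :=
      tendsto_axis.eventually (hGc.abs.eventually_lt continuousAt_const (by simp))
    refine ⟨C + D * (|G 0| + 1), by positivity, ?_⟩
    filter_upwards [hCe, hDe, hGb, hP1, Iic_mem_nhds (zero_lt_one (α := ℝ)),
      tendsto_axis.eventually ((contDiffAt_totalDeriv (contDiffAt_prolong hX hY hP j)).eventually_top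
        1), tendsto_axis.eventually ((contDiffAt_totalDeriv hX).eventually_top 1)]
      with x h1 h2 h3 h4 h5 h6 h7 h0
    replace h1 := h1 h0
    replace h2 := h2 h0
    replace h4 := h4 h0
    have d6 := h6.differentiableAt (by simp)
    have d7 := h7.differentiableAt (by simp)
    have hPpos : 0 < totalDeriv X ((x, 0) : Jet M) := by linarith
    have e1 := (dX.prolong dY j).fderiv_totalDeriv hj d6
    have key : fderiv ℝ (prolong X Y (j + 1)) (x, 0) (0, jetUnit M (j + 1)) =
        (fderiv ℝ (prolong X Y j) (x, 0) (0, jetUnit M j)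
          - prolong X Y (j + 1) (x, 0) * G (x, 0)) / totalDeriv X ((x, 0) : Jet M) := by
      have hd : DifferentiableAt ℝ (prolong X Y (j + 1)) (x, 0) := by
        have h8 := h6.div h7 hPpos.ne'
        exact ContDiffAt.differentiableAt (n := (1 : ℕ)) h8 (by simp)
      have hmul : totalDeriv (prolong X Y j) =ᶠ[𝓝 ((x, 0) : Jet M)]
          fun z => prolong X Y (j + 1) z * totalDeriv X z := by
        filter_upwards [h7.continuousAt.eventually_ne hPpos.ne'] with z hz
        simp only [prolong]
        field_simp
      have h8 := hmul.fderiv_eq (𝕜 := ℝ)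
      rw [fderiv_fun_mul hd d7] at h8
      rw [← e1, h8]
      simp only [add_apply, smul_apply, smul_eq_mul, hG]
      field_simp
      ring
    rw [key, abs_div, abs_of_pos hPpos]
    have hx2 : x ^ (M + 2 - (j + 1)) ≤ x ^ 2 := pow_le_pow_of_le_one h0 h5 (by omega)
    refine (div_le_self (abs_nonneg _) h4).trans ?_
    have h10 := norm_sub_le (fderiv ℝ (prolong X Y j) (x, 0) (0, jetUnit M j))
      (prolong X Y (j + 1) (x, 0) * G (x, 0))
    rw [norm_mul] at h10
    simp only [Real.norm_eq_abs] at h10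
    have h9 : |prolong X Y (j + 1) (x, 0)| * |G (x, 0)| ≤ (D * x ^ 2) * (|G 0| + 1) :=
      mul_le_mul (h2.trans (mul_le_mul_of_nonneg_left hx2 hD)) h3.le (abs_nonneg _) (by positivity)
    linarith

/-- Near the origin, the `j`-th prolongation is almost contracting in the highest coordinate. -/
lemma abs_fderiv_prolong_le {X Y : Jet M → ℝ} (hX : ContDiffAt ℝ ∞ X 0)
    (hY : ContDiffAt ℝ ∞ Y 0) (hP : totalDeriv X 0 ≠ 0) {j : ℕ} {lam C : ℝ} (hC : 0 ≤ C)
    (h : ∀ᶠ x in 𝓝 (0 : ℝ), 0 ≤ x →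
      |fderiv ℝ (prolong X Y j) (x, 0) (0, jetUnit M j)| ≤ 1 - lam * x + C * x ^ 2) :
    ∃ C : ℝ, 0 ≤ C ∧ ∀ᶠ z in 𝓝 (0 : Jet M), 0 ≤ z.1 →
      |fderiv ℝ (prolong X Y j) z (0, jetUnit M j)| ≤
        1 - lam * z.1 + C * z.1 ^ 2 + C * ‖z.2‖ := by
  set G : Jet M → ℝ := fun z => fderiv ℝ (prolong X Y j) z (0, jetUnit M j) with hG
  have hGc : ContDiffAt ℝ ∞ G 0 :=
    ((contDiffAt_prolong hX hY hP j).fderiv_right (m := ∞) (by rfl)).clm_apply contDiffAt_const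
  obtain ⟨K, t, ht, hK⟩ := (hGc.of_le (by exact_mod_cast le_top)).exists_lipschitzOnWith
  have hfst : Tendsto (fun z : Jet M => z.1) (𝓝 0) (𝓝 0) := continuous_fst.tendsto' 0 0 rfl
  refine ⟨C + K, by positivity, ?_⟩
  filter_upwards [ht, hfst.eventually (tendsto_axis.eventually_mem ht), hfst.eventually h]
    with z h1 h2 h3 h0
  have h4 := hK.dist_le_mul z h1 _ h2
  have h5 : dist z (z.1, 0) = ‖z.2‖ := by
    rw [dist_eq_norm, Prod.norm_def]
    simp
  rw [h5, Real.dist_eq] at h4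
  have h6 : |G z| ≤ |G (z.1, 0)| + |G z - G (z.1, 0)| := by
    have := abs_add_le (G (z.1, 0)) (G z - G (z.1, 0))
    simpa using this
  have h7 := h3 h0
  have h8 : 0 ≤ (K : ℝ) * z.1 ^ 2 := by positivity
  have h9 : 0 ≤ C * ‖z.2‖ := by positivity
  simp only [← hG] at *
  linarith [h6, h7, h4]

lemma norm_jet_lt {x r : ℝ} {y : Fin (M + 1) → ℝ} (hx : |x| < r) (hy : ‖y‖ < r) :
    ((x, y) : Jet M) ∈ Metric.ball 0 r := by
  rw [mem_ball_zero_iff, Prod.norm_def]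
  exact max_lt hx hy

lemma norm_jetTrunc_le_norm (j : ℕ) (y : Fin (M + 1) → ℝ) : ‖jetTrunc j y‖ ≤ ‖y‖ :=
  norm_jetTrunc_le (norm_nonneg _) fun i _ => norm_le_pi_norm y i

/-- The basic local estimate for the prolongations. -/
lemma abs_prolong_le {X Y : Jet M → ℝ} (hX : ContDiffAt ℝ ∞ X 0)
    (hY : ContDiffAt ℝ ∞ Y 0) (dX : DependsUpTo 0 X) (dY : DependsUpTo 0 Y)
    (hP : totalDeriv X 0 ≠ 0)
    (hP1 : ∀ᶠ x in 𝓝 (0 : ℝ), 0 ≤ x → 1 ≤ totalDeriv X ((x, 0) : Jet M))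
    {k l : ℕ} {s : ℝ → ℝ} (hs : ContDiffAt ℝ ∞ s 0)
    (hYs : ∀ᶠ x in 𝓝 (0 : ℝ), Y (x, 0) = x ^ k * s x) (hk : M + 2 ≤ k) (hl : l ≤ k)
    (hMl : M ≤ l)
    {lam C₀ : ℝ} (hC₀ : 0 ≤ C₀) (hY1 : ∀ᶠ x in 𝓝 (0 : ℝ), 0 ≤ x →
      |fderiv ℝ Y (x, 0) (0, jetUnit M 0)| ≤ 1 - lam * x + C₀ * x ^ 2) (j : Fin (M + 1)) :
    ∃ C : ℝ, 0 ≤ C ∧ ∀ᶠ z in 𝓝 (0 : Jet M), 0 ≤ z.1 →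
      |prolong X Y j z| ≤ (1 - lam * z.1 + C * z.1 ^ 2 + C * ‖z.2‖) * |z.2 j| +
        C * ‖jetTrunc j z.2‖ + C * z.1 ^ (l - j) := by
  have hj := j.isLt
  have hjM : (j : ℕ) ≤ M := by omega
  obtain ⟨C₁, hC₁, h₁⟩ := fderiv_prolong_axis_le hX hY dX dY hP hP1 hs hYs hk hC₀ hY1 j hjM
  obtain ⟨C₂, hC₂, h₂⟩ := abs_fderiv_prolong_le hX hY hP hC₁ h₁
  obtain ⟨C₃, hC₃, h₃⟩ := prolong_axis_le hX hY hP hs hYs hl (j := j) (by omega)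
  have hH := contDiffAt_prolong hX hY hP (j : ℕ)
  have dH := dX.prolong dY (j : ℕ)
  set H := prolong X Y (j : ℕ) with hHdef
  obtain ⟨K, t, ht, hK⟩ := (hH.of_le (by exact_mod_cast le_top)).exists_lipschitzOnWith
  have hfst : Tendsto (fun z : Jet M => z.1) (𝓝 0) (𝓝 0) := continuous_fst.tendsto' 0 0 rfl
  obtain ⟨r, hr, hball⟩ := Metric.eventually_nhds_iff_ball.1
    ((hH.eventually_top 1).and (h₂.and (eventually_mem_set.2 ht)))
  refine ⟨C₂ + K + C₃, by positivity, ?_⟩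
  filter_upwards [Metric.ball_mem_nhds (0 : Jet M) hr, hfst.eventually h₃] with z hz hz3 h0
  obtain ⟨x, y⟩ := z
  simp only at hz3 h0 ⊢
  have hz' : |x| < r ∧ ‖y‖ < r := by
    rw [mem_ball_zero_iff, Prod.norm_def] at hz
    exact max_lt_iff.1 hz
  have mem (y' : Fin (M + 1) → ℝ) (h : ‖y'‖ ≤ ‖y‖) : ((x, y') : Jet M) ∈ Metric.ball 0 r :=
    norm_jet_lt hz'.1 (h.trans_lt hz'.2)
  have step1 : |H (x, y) - H (x, jetTrunc j y)| ≤
      (1 - lam * x + C₂ * x ^ 2 + C₂ * ‖y‖) * |y j| := by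
    rw [← dH.apply_trunc (Nat.lt_succ_self _) x y, jetTrunc_succ]
    set γ : ℝ → Jet M := fun τ => (x, jetTrunc j y + τ • jetUnit M j) with hγ
    have hseg : ∀ τ ∈ uIcc 0 (y j), ‖jetTrunc j y + τ • jetUnit M j‖ ≤ ‖y‖ := by
      intro τ hτ
      rw [pi_norm_le_iff_of_nonneg (norm_nonneg _)]
      intro i
      have hi := norm_le_pi_norm y i
      rcases lt_trichotomy (i : ℕ) j with h | h | h
      · simpa [jetTrunc, jetUnit, h, h.ne] using hi
      · obtain rfl : i = j := Fin.ext h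
        have h1 : |τ| ≤ |y i| := by
          have := abs_sub_left_of_mem_uIcc hτ
          simpa using this
        simpa [jetTrunc, jetUnit] using h1.trans hi
      · simp [jetTrunc, jetUnit, h.ne', not_lt.2 h.le]
    have hder : ∀ τ ∈ uIcc 0 (y j), HasDerivWithinAt (fun τ => H (γ τ))
        (fderiv ℝ H (γ τ) (0, jetUnit M j)) (uIcc 0 (y j)) τ := by
      intro τ hτ
      have h1 : HasDerivAt γ (0, jetUnit M j) τ := by
        refine (hasDerivAt_const τ x).prodMk ?_
        have := ((hasDerivAt_id τ).smul_const (jetUnit M j)).const_add (jetTrunc j y)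
        simpa using this
      have h2 := ((hball _ (mem _ (hseg τ hτ))).1.differentiableAt (by simp)).hasFDerivAt
      exact (h2.comp_hasDerivAt τ h1).hasDerivWithinAt
    have hbd : ∀ τ ∈ uIcc 0 (y j), ‖fderiv ℝ H (γ τ) (0, jetUnit M j)‖ ≤
        1 - lam * x + C₂ * x ^ 2 + C₂ * ‖y‖ := by
      intro τ hτ
      have h1 := (hball _ (mem _ (hseg τ hτ))).2.1 h0
      have h2 := mul_le_mul_of_nonneg_left (hseg τ hτ) hC₂
      rw [Real.norm_eq_abs]
      simp only [hγ] at h1 ⊢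
      linarith
    have := Convex.norm_image_sub_le_of_norm_hasDerivWithin_le hder hbd (convex_uIcc 0 (y j))
      left_mem_uIcc right_mem_uIcc
    simpa [hγ] using this
  have step2 : |H (x, jetTrunc j y) - H (x, 0)| ≤ K * ‖jetTrunc j y‖ := by
    have h1 := hK.dist_le_mul _ (hball _ (mem _ (norm_jetTrunc_le_norm j y))).2.2 _
      (hball _ (mem 0 (by simp))).2.2
    have h5 : dist ((x, jetTrunc j y) : Jet M) (x, 0) = ‖jetTrunc j y‖ := by
      rw [dist_eq_norm, Prod.norm_def]
      simp
    rwa [h5, Real.dist_eq] at h1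
  have step3 := hz3 h0
  have tri : |H (x, y)| ≤ |H (x, y) - H (x, jetTrunc j y)| +
      |H (x, jetTrunc j y) - H (x, 0)| + |H (x, 0)| := by
    have h1 := abs_add_three (H (x, y) - H (x, jetTrunc j y)) (H (x, jetTrunc j y) - H (x, 0))
      (H (x, 0))
    have h2 : H (x, y) - H (x, jetTrunc j y) + (H (x, jetTrunc j y) - H (x, 0)) + H (x, 0) =
      H (x, y) := by ring
    rwa [h2] at h1
  have e1 : 0 ≤ ((K + C₃) * x ^ 2 + (K + C₃) * ‖y‖) * |y j| := by positivity
  have e2 : 0 ≤ (C₂ + C₃) * ‖jetTrunc j y‖ := by positivity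
  have e3 : 0 ≤ (C₂ + K) * x ^ (l - (j : ℕ)) := by positivity
  linarith

/-- A function of `(x, y)` seen as a function on the jet space. -/
def liftJet (M : ℕ) (X : ℝ → ℝ → ℝ) (z : Jet M) : ℝ := X z.1 (z.2 0)

lemma dependsUpTo_liftJet (X : ℝ → ℝ → ℝ) : DependsUpTo 0 (liftJet M X) := by
  intro z w hw
  simp [liftJet, hw 0 (by simp)]

/-- Jets at `x` whose `i`-th coordinate is at most `Λ ^ i * x ^ (N - i)`. -/
def jetBox (M N : ℕ) (Λ x : ℝ) : Set (Fin (M + 1) → ℝ) :=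
  {y | ∀ i : Fin (M + 1), |y i| ≤ Λ ^ (i : ℕ) * x ^ (N - (i : ℕ))}

lemma norm_le_of_mem_jetBox {N k : ℕ} {Λ x : ℝ} (hΛ : 1 ≤ Λ) (hx : 0 ≤ x) (hx1 : x ≤ 1)
    (hk : M + k ≤ N) {y : Fin (M + 1) → ℝ} (hy : y ∈ jetBox M N Λ x) :
    ‖y‖ ≤ Λ ^ M * x ^ k := by
  rw [pi_norm_le_iff_of_nonneg (by positivity)]
  intro i
  have hi := i.isLt
  refine (hy i).trans ?_
  exact mul_le_mul (pow_le_pow_right₀ hΛ (by omega)) (pow_le_pow_of_le_one hx hx1 (by omega))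
    (by positivity) (by positivity)

lemma smul_jetUnit_mem_jetBox {N : ℕ} {Λ x t : ℝ} (hΛ : 1 ≤ Λ) (hx : 0 ≤ x)
    (ht : |t| ≤ x ^ N) : t • jetUnit M 0 ∈ jetBox M N Λ x := by
  intro i
  by_cases hi : (i : ℕ) = 0
  · simpa [jetUnit, hi] using ht
  · simp only [jetUnit, hi, if_false, Pi.smul_apply, smul_zero, abs_zero]
    positivity

lemma eventually_jetBox {N : ℕ} {Λ : ℝ} (hΛ : 1 ≤ Λ) (hMN : M + 1 ≤ N) {P : Jet M → Prop}
    (h : ∀ᶠ z in 𝓝 (0 : Jet M), P z) :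
    ∀ᶠ x in 𝓝[>] (0 : ℝ), ∀ y ∈ jetBox M N Λ x, P (x, y) := by
  obtain ⟨r, hr, hb⟩ := Metric.eventually_nhds_iff_ball.1 h
  have h1 : ∀ᶠ x in 𝓝 (0 : ℝ), Λ ^ M * x ^ 1 < r := by
    have : Continuous fun x : ℝ => Λ ^ M * x ^ 1 := by fun_prop
    exact this.continuousAt.eventually_lt continuousAt_const (by simpa using hr)
  filter_upwards [self_mem_nhdsWithin, nhdsWithin_le_nhds h1,
    nhdsWithin_le_nhds (Iic_mem_nhds (zero_lt_one (α := ℝ))),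
    nhdsWithin_le_nhds (Iio_mem_nhds hr)] with x hx h2 h3 h4 y hy
  replace hx : 0 < x := hx
  exact hb _ (norm_jet_lt (by rwa [abs_of_pos hx])
    ((norm_le_of_mem_jetBox hΛ hx.le h3 hMN hy).trans_lt h2))

lemma eventually_mul_le {a b : ℝ} (hb : 0 < b) : ∀ᶠ x in 𝓝[>] (0 : ℝ), a * x ≤ b := by
  have : Continuous fun x : ℝ => a * x := by fun_prop
  have h := this.continuousAt.eventually_lt (x₀ := (0 : ℝ)) continuousAt_const (by simpa using hb)
  exact nhdsWithin_le_nhds (h.mono fun _ => le_of_lt)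

/-- Conditions on a planar map `(X, Y)` under which its graph transform preserves the functions
on `(0, δ)` whose `M`-jets lie in `jetBox M N Λ`, and does not increase distances. -/
structure GraphTransform (M N : ℕ) (δ Λ : ℝ) (X Y : ℝ → ℝ → ℝ) : Prop where
  delta_pos : 0 < δ
  delta_le : δ ≤ 1
  one_le : 1 ≤ Λ
  maps : ∀ x ∈ Ioo 0 δ, ∀ y ∈ jetBox M N Λ x, ∀ j : Fin (M + 1),
    |prolong (liftJet M X) (liftJet M Y) j (x, y)| ≤ Λ ^ (j : ℕ) * x ^ (N - (j : ℕ))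
  diffX : ∀ x ∈ Ioo 0 δ, ∀ y ∈ jetBox M N Λ x, DifferentiableAt ℝ (liftJet M X) (x, y)
  diffY : ∀ x ∈ Ioo 0 δ, ∀ y ∈ jetBox M N Λ x, ∀ j : Fin (M + 1),
    DifferentiableAt ℝ (prolong (liftJet M X) (liftJet M Y) j) (x, y)
  half_le : ∀ x ∈ Ioo 0 δ, ∀ y ∈ jetBox M N Λ x, 1 / 2 ≤ totalDeriv (liftJet M X) (x, y)
  bounds : ∀ x ∈ Ioo 0 δ, ∀ y : ℝ, |y| ≤ x ^ N → x + x ^ 2 / 2 ≤ X x y ∧ X x y ≤ 2 * x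
  contracts : ∀ x ∈ Ioo 0 δ, ∀ y y' : ℝ, |y| ≤ x ^ N → |y'| ≤ x ^ N →
    |Y x y - Y x y'| + Λ * (2 * x) ^ (N - 1) * |X x y - X x y'| ≤ |y - y'|

lemma exists_graphTransform {X Y : ℝ → ℝ → ℝ} {N : ℕ} (hMN : M + 2 ≤ N) (hN : 3 ≤ N)
    (hX : ContDiffAt ℝ ∞ (liftJet M X) 0) (hY : ContDiffAt ℝ ∞ (liftJet M Y) 0)
    (hP1 : ∀ᶠ x in 𝓝 (0 : ℝ), 0 ≤ x → 1 ≤ totalDeriv (liftJet M X) (x, 0))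
    {s : ℝ → ℝ} (hs : ContDiffAt ℝ ∞ s 0)
    (hYs : ∀ᶠ x in 𝓝 (0 : ℝ), Y x 0 = x ^ (N + 2) * s x)
    {lam C₀ : ℝ} (hlam : 0 < lam) (hC₀ : 0 ≤ C₀) (hY1 : ∀ᶠ x in 𝓝 (0 : ℝ), 0 ≤ x →
      |fderiv ℝ (liftJet M Y) (x, 0) (0, jetUnit M 0)| ≤ 1 - lam * x + C₀ * x ^ 2)
    (hXb : ∀ᶠ x in 𝓝[>] (0 : ℝ), ∀ y : ℝ, |y| ≤ x ^ N →
      x + x ^ 2 / 2 ≤ X x y ∧ X x y ≤ 2 * x) :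
    ∃ δ Λ : ℝ, GraphTransform M N δ Λ X Y := by
  have dX := dependsUpTo_liftJet (M := M) X
  have dY := dependsUpTo_liftJet (M := M) Y
  have hP0 : 1 ≤ totalDeriv (liftJet M X) 0 := hP1.self_of_nhds le_rfl
  have hP : totalDeriv (liftJet M X) 0 ≠ 0 := by linarith
  have hC := abs_prolong_le (l := N + 2) hX hY dX dY hP hP1 hs hYs (by omega) le_rfl (by omega)
    hC₀ hY1
  choose C hC0 hCe using hC
  obtain ⟨D, hD, hCD⟩ : ∃ D, 0 ≤ D ∧ ∀ j, C j ≤ D :=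
    ⟨∑ j, C j, Finset.sum_nonneg fun j _ => hC0 j,
      fun j => Finset.single_le_sum (fun j _ => hC0 j) (Finset.mem_univ j)⟩
  set Λ : ℝ := 1 + 4 * D / lam with hΛdef
  have hΛ : 1 ≤ Λ := by
    have : 0 ≤ 4 * D / lam := by positivity
    linarith
  have hDΛ : D / Λ ≤ lam / 4 := by
    rw [div_le_iff₀ (by linarith), hΛdef]
    field_simp
    nlinarith
  obtain ⟨C₂, hC₂, h₂⟩ := abs_fderiv_prolong_le (j := 0) hX hY hP hC₀ hY1
  set B := ‖fderiv ℝ (liftJet M X) 0‖ + 1 with hB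
  have hBe : ∀ᶠ z in 𝓝 (0 : Jet M), ‖fderiv ℝ (liftJet M X) z‖ < B :=
    ((hX.fderiv_right (m := ∞) (by rfl)).continuousAt.norm).eventually_lt continuousAt_const
      (by simp [hB])
  have hPe : ∀ᶠ z in 𝓝 (0 : Jet M), 1 / 2 < totalDeriv (liftJet M X) z :=
    continuousAt_const.eventually_lt (contDiffAt_totalDeriv hX).continuousAt (by linarith)
  have hmono : M + 1 ≤ N := by omega
  have hall : ∀ᶠ x in 𝓝[>] (0 : ℝ), x ∈ Iio (1 / 2 : ℝ) ∧
      (∀ y ∈ jetBox M N Λ x, ∀ j : Fin (M + 1), 0 ≤ x →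
        |prolong (liftJet M X) (liftJet M Y) j (x, y)| ≤
          (1 - lam * x + C j * x ^ 2 + C j * ‖y‖) * |y j| + C j * ‖jetTrunc j y‖ +
            C j * x ^ (N + 2 - (j : ℕ))) ∧
      (∀ y ∈ jetBox M N Λ x, ∀ j : Fin (M + 1),
        ContDiffAt ℝ (1 : ℕ) (prolong (liftJet M X) (liftJet M Y) j) (x, y)) ∧
      (∀ y ∈ jetBox M N Λ x, ContDiffAt ℝ (1 : ℕ) (liftJet M X) (x, y)) ∧
      (∀ y ∈ jetBox M N Λ x, 1 / 2 < totalDeriv (liftJet M X) (x, y)) ∧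
      (∀ y ∈ jetBox M N Λ x, ‖fderiv ℝ (liftJet M X) (x, y)‖ < B) ∧
      (∀ y ∈ jetBox M N Λ x, 0 ≤ x → |fderiv ℝ (liftJet M Y) (x, y) (0, jetUnit M 0)| ≤
        1 - lam * x + C₂ * x ^ 2 + C₂ * ‖y‖) ∧
      (∀ y : ℝ, |y| ≤ x ^ N → x + x ^ 2 / 2 ≤ X x y ∧ X x y ≤ 2 * x) ∧
      lam * x ≤ 1 ∧ (2 * D + D * Λ ^ M) * x ≤ lam / 4 ∧
      (C₂ + C₂ * Λ ^ M) * x ≤ lam / 2 ∧ (4 * Λ * B) * x ≤ lam / 2 :=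
    Filter.Eventually.and (nhdsWithin_le_nhds (Iio_mem_nhds (by norm_num))) <|
      (eventually_jetBox hΛ hmono (eventually_all.2 hCe)).and <|
      (eventually_jetBox hΛ hmono (eventually_all.2 fun j : Fin (M + 1) =>
        (contDiffAt_prolong hX hY hP j).eventually_top 1)).and <|
      (eventually_jetBox hΛ hmono (hX.eventually_top 1)).and <|
      (eventually_jetBox hΛ hmono hPe).and <|
      (eventually_jetBox hΛ hmono hBe).and <|
      (eventually_jetBox hΛ hmono h₂).and <| hXb.and <|
      (eventually_mul_le zero_lt_one).and <| (eventually_mul_le (by positivity)).and <|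
      (eventually_mul_le (by positivity)).and (eventually_mul_le (by positivity))
  obtain ⟨δ, hδ, hsub⟩ := mem_nhdsGT_iff_exists_Ioo_subset.1 hall
  replace hδ : 0 < δ := hδ
  have hlt : ∀ x ∈ Ioo 0 (min δ 1), x ∈ Ioo 0 δ := fun x hx =>
    ⟨hx.1, hx.2.trans_le (min_le_left _ _)⟩
  refine ⟨min δ 1, Λ, ⟨by positivity, min_le_right _ _, hΛ, ?_, ?_, ?_, ?_, ?_, ?_⟩⟩
  · intro x hx y hy j
    obtain ⟨x1, h1, -, -, -, -, -, -, h2, h3, -, -⟩ := hsub (hlt x hx)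
    have x0 : 0 < x := hx.1
    replace x1 : x < 1 / 2 := x1
    have hj := j.isLt
    have hyn : ‖y‖ ≤ Λ ^ M * x ^ 2 := norm_le_of_mem_jetBox hΛ x0.le (by linarith) hMN hy
    have hyj := hy j
    set T : ℝ := Λ ^ (j : ℕ) * x ^ (N - (j : ℕ)) with hT
    have hT0 : 0 ≤ T := by positivity
    have htr : ‖jetTrunc j y‖ ≤ T * (x / Λ) := by
      refine norm_jetTrunc_le (by positivity) fun i hi => (hy i).trans ?_
      obtain ⟨m, hm⟩ : ∃ m, (j : ℕ) = m + 1 := ⟨(j : ℕ) - 1, by omega⟩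
      have e : T * (x / Λ) = Λ ^ m * x ^ (N - m) := by
        have : N - m = N - (j : ℕ) + 1 := by omega
        rw [hT, this, hm, pow_succ, pow_succ]
        field_simp
      rw [e]
      exact mul_le_mul (pow_le_pow_right₀ hΛ (by omega))
        (pow_le_pow_of_le_one x0.le (by linarith) (by omega)) (by positivity) (by positivity)
    have hpow : x ^ (N + 2 - (j : ℕ)) ≤ T * x ^ 2 := by
      have : N + 2 - (j : ℕ) = N - (j : ℕ) + 2 := by omega
      rw [this, pow_add, hT]
      have : (1 : ℝ) ≤ Λ ^ (j : ℕ) := one_le_pow₀ hΛ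
      have h4 : 0 ≤ x ^ (N - (j : ℕ)) * x ^ 2 := by positivity
      nlinarith
    have hCj := hCD j
    have hCj0 := hC0 j
    have a1 : (1 - lam * x + C j * x ^ 2 + C j * ‖y‖) * |y j| ≤
        (1 - lam * x + D * x ^ 2 + D * (Λ ^ M * x ^ 2)) * T := by
      have b1 : C j * x ^ 2 ≤ D * x ^ 2 := by gcongr
      have b2 : C j * ‖y‖ ≤ D * (Λ ^ M * x ^ 2) := by gcongr
      have b3 : 0 ≤ C j * x ^ 2 := by positivity
      have b4 : 0 ≤ C j * ‖y‖ := by positivity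
      exact mul_le_mul (by linarith) hyj (abs_nonneg _) (by linarith)
    have a2 : C j * ‖jetTrunc j y‖ ≤ (D / Λ) * (T * x) := by
      calc C j * ‖jetTrunc j y‖ ≤ D * (T * (x / Λ)) := by gcongr
        _ = (D / Λ) * (T * x) := by ring
    have a2' : (D / Λ) * (T * x) ≤ lam / 4 * (T * x) := by gcongr
    have a3 : C j * x ^ (N + 2 - (j : ℕ)) ≤ D * (T * x ^ 2) := by gcongr
    have a4 := mul_le_mul_of_nonneg_right h3 (show 0 ≤ T * x by positivity)
    have a5 : 0 ≤ lam * (T * x) := by positivity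
    linarith [h1 y hy j x0.le]
  · intro x hx y hy
    obtain ⟨-, -, -, h, -⟩ := hsub (hlt x hx)
    exact (h y hy).differentiableAt (by simp)
  · intro x hx y hy j
    obtain ⟨-, -, h, -⟩ := hsub (hlt x hx)
    exact (h y hy j).differentiableAt (by simp)
  · intro x hx y hy
    obtain ⟨-, -, -, -, h, -⟩ := hsub (hlt x hx)
    exact (h y hy).le
  · intro x hx
    obtain ⟨-, -, -, -, -, -, -, h, -⟩ := hsub (hlt x hx)
    exact h
  · intro x hx y y' hy hy'
    obtain ⟨x1, -, hdY, hdX, -, hB', h2, -, -, -, h3, h4⟩ := hsub (hlt x hx)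
    have x0 : 0 < x := hx.1
    replace x1 : x < 1 / 2 := x1
    set γ : ℝ → Jet M := fun t => (x, t • jetUnit M 0) with hγ
    have hγd (t : ℝ) : HasDerivAt γ (0, jetUnit M 0) t := by
      refine (hasDerivAt_const t x).prodMk ?_
      simpa using (hasDerivAt_id t).smul_const (jetUnit M 0)
    have hlift (Z : ℝ → ℝ → ℝ) (t : ℝ) : liftJet M Z (γ t) = Z x t := by
      simp [liftJet, hγ, jetUnit]
    have hmem : ∀ t ∈ Icc (-x ^ N) (x ^ N), t • jetUnit M 0 ∈ jetBox M N Λ x := fun t ht =>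
      smul_jetUnit_mem_jetBox hΛ x0.le (abs_le.2 ht)
    have hYder : ∀ t ∈ Icc (-x ^ N) (x ^ N), HasDerivWithinAt (fun t => Y x t)
        (fderiv ℝ (liftJet M Y) (γ t) (0, jetUnit M 0)) (Icc (-x ^ N) (x ^ N)) t := by
      intro t ht
      have := (((hdY _ (hmem t ht) 0).differentiableAt (by simp)).hasFDerivAt).comp_hasDerivAt t
        (hγd t)
      simp only [← hlift]
      exact this.hasDerivWithinAt
    have hXder : ∀ t ∈ Icc (-x ^ N) (x ^ N), HasDerivWithinAt (fun t => X x t)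
        (fderiv ℝ (liftJet M X) (γ t) (0, jetUnit M 0)) (Icc (-x ^ N) (x ^ N)) t := by
      intro t ht
      have := (((hdX _ (hmem t ht)).differentiableAt (by simp)).hasFDerivAt).comp_hasDerivAt t
        (hγd t)
      simp only [← hlift]
      exact this.hasDerivWithinAt
    have hYb : ∀ t ∈ Icc (-x ^ N) (x ^ N),
        ‖fderiv ℝ (liftJet M Y) (γ t) (0, jetUnit M 0)‖ ≤ 1 - lam / 2 * x := by
      intro t ht
      have b1 := h2 _ (hmem t ht) x0.le
      have b2 := norm_le_of_mem_jetBox hΛ x0.le (by linarith) hMN (hmem t ht)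
      have b3 := mul_le_mul_of_nonneg_left b2 hC₂
      have b4 := mul_le_mul_of_nonneg_right h3 x0.le
      rw [Real.norm_eq_abs]
      simp only [hγ]
      linarith
    have hXb' : ∀ t ∈ Icc (-x ^ N) (x ^ N),
        ‖fderiv ℝ (liftJet M X) (γ t) (0, jetUnit M 0)‖ ≤ B := by
      intro t ht
      refine (ContinuousLinearMap.le_opNorm _ _).trans ?_
      have b1 : ‖((0 : ℝ), jetUnit M 0)‖ ≤ 1 := by
        rw [Prod.norm_def]
        refine max_le (by simp) ((pi_norm_le_iff_of_nonneg zero_le_one).2 fun i => ?_)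
        by_cases hi : (i : ℕ) = 0 <;> simp [jetUnit, hi]
      have b2 := (hB' _ (hmem t ht)).le
      calc _ ≤ B * 1 := mul_le_mul b2 b1 (norm_nonneg _) (by positivity)
        _ = B := mul_one B
    have c1 := Convex.norm_image_sub_le_of_norm_hasDerivWithin_le hYder hYb
      (convex_Icc _ _) (abs_le.1 hy') (abs_le.1 hy)
    have c2 := Convex.norm_image_sub_le_of_norm_hasDerivWithin_le hXder hXb'
      (convex_Icc _ _) (abs_le.1 hy') (abs_le.1 hy)
    simp only [Real.norm_eq_abs] at c1 c2
    have c3 : (2 * x) ^ (N - 1) ≤ (2 * x) ^ 2 :=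
      pow_le_pow_of_le_one (by linarith) (by linarith) (by omega)
    have c4 : Λ * (2 * x) ^ (N - 1) * |X x y - X x y'| ≤
        Λ * (2 * x) ^ 2 * (B * |y - y'|) := by gcongr
    have c5 := mul_le_mul_of_nonneg_right h4 (show 0 ≤ x * |y - y'| by positivity)
    linarith

end Jets

section Planar

variable {θA θB θC θD θE : ℝ × ℝ → ℝ} {M N : ℕ} {lam : ℝ}

lemma contDiffAt_comp_jet {θ : ℝ × ℝ → ℝ} (h : ContDiffAt ℝ ∞ θ 0) :
    ContDiffAt ℝ ∞ (fun z : Jet M => θ (z.1, z.2 0)) 0 := by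
  have h1 : ContDiffAt ℝ ∞ (fun z : Jet M => (z.1, z.2 0)) 0 := by fun_prop
  exact ContDiffAt.comp (0 : Jet M) (g := θ) h h1

lemma contDiffAt_comp_axis {θ : ℝ × ℝ → ℝ} (h : ContDiffAt ℝ ∞ θ 0) :
    ContDiffAt ℝ ∞ (fun x : ℝ => θ (x, 0)) 0 := by
  have h1 : ContDiffAt ℝ ∞ (fun x : ℝ => (x, (0 : ℝ))) 0 := by fun_prop
  exact ContDiffAt.comp (0 : ℝ) (g := θ) h h1

lemma contDiffAt_liftJet_XIA (hA : ContDiffAt ℝ ∞ θA 0) (hB : ContDiffAt ℝ ∞ θB 0) :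
    ContDiffAt ℝ ∞ (liftJet M (XIA θA θB)) 0 := by
  have h1 := contDiffAt_comp_jet (M := M) hA
  have h2 := contDiffAt_comp_jet (M := M) hB
  unfold liftJet XIA
  fun_prop

lemma contDiffAt_liftJet_YIA (hC : ContDiffAt ℝ ∞ θC 0) (hD : ContDiffAt ℝ ∞ θD 0)
    (hE : ContDiffAt ℝ ∞ θE 0) :
    ContDiffAt ℝ ∞ (liftJet M (YIA θC θD θE lam N)) 0 := by
  have h1 := contDiffAt_comp_jet (M := M) hC
  have h2 := contDiffAt_comp_jet (M := M) hD
  have h3 := contDiffAt_comp_jet (M := M) hE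
  unfold liftJet YIA
  fun_prop

lemma eventually_abs_lt {E : Type*} [TopologicalSpace E] {f : E → ℝ} {z : E}
    (h : ContinuousAt f z) : ∀ᶠ w in 𝓝 z, |f w| < |f z| + 1 :=
  h.abs.eventually_lt continuousAt_const (by simp)

lemma one_le_totalDeriv_XIA (hA : ContDiffAt ℝ ∞ θA 0) (hB : ContDiffAt ℝ ∞ θB 0) :
    ∀ᶠ x in 𝓝 (0 : ℝ), 0 ≤ x → 1 ≤ totalDeriv (liftJet M (XIA θA θB)) (x, 0) := by
  have ha := contDiffAt_comp_axis hA
  set a : ℝ → ℝ := fun x => θA (x, 0) with hadef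
  have hc : ContinuousAt (fun x => 2 + x * (3 * a x + x * deriv a x)) 0 := by
    have h1 : ContinuousAt (deriv a) 0 := by
      have : deriv a = fun x => fderiv ℝ a x 1 := by funext x; simp
      rw [this]
      exact ((ha.fderiv_right (m := ∞) (by rfl)).clm_apply contDiffAt_const).continuousAt
    have h2 := ha.continuousAt
    fun_prop
  have hpos := continuousAt_const.eventually_lt hc (by simp : (0 : ℝ) < _)
  filter_upwards [hpos, ha.eventually_top 1, tendsto_axis.eventually
    ((contDiffAt_liftJet_XIA (M := M) hA hB).eventually_top 1)] with x h1 h2 h3 h0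
  have e1 := totalDeriv_axis (h3.differentiableAt (by simp))
  have e2 : HasDerivAt (fun t => t + t ^ 2 + t ^ 3 * a t)
      (1 + 2 * x + (3 * x ^ 2 * a x + x ^ 3 * deriv a x)) x := by
    have := ((hasDerivAt_id x).add (hasDerivAt_pow 2 x)).add
      ((hasDerivAt_pow 3 x).mul (h2.differentiableAt (by simp)).hasDerivAt)
    refine (this.congr_of_eventuallyEq (f₁ := fun t => t + t ^ 2 + t ^ 3 * a t)
      (Eventually.of_forall fun t => rfl)).congr_deriv ?_
    norm_num
  have e3 : (fun t : ℝ => liftJet M (XIA θA θB) (t, 0)) = fun t => t + t ^ 2 + t ^ 3 * a t := by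
    funext t
    simp [liftJet, XIA, hadef]
  rw [e3] at e1
  rw [e1.unique e2]
  nlinarith

lemma XIA_bounds (hA : ContDiffAt ℝ ∞ θA 0) (hB : ContDiffAt ℝ ∞ θB 0) (hN : 3 ≤ N) :
    ∀ᶠ x in 𝓝[>] (0 : ℝ), ∀ y : ℝ, |y| ≤ x ^ N →
      x + x ^ 2 / 2 ≤ XIA θA θB x y ∧ XIA θA θB x y ≤ 2 * x := by
  obtain ⟨r, hr, hb⟩ := Metric.eventually_nhds_iff_ball.1
    ((eventually_abs_lt hA.continuousAt).and (eventually_abs_lt hB.continuousAt))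
  set c := |θA 0| + 1 + (|θB 0| + 1) with hc
  filter_upwards [self_mem_nhdsWithin, nhdsWithin_le_nhds (Iio_mem_nhds hr),
    nhdsWithin_le_nhds (Iio_mem_nhds (show (0 : ℝ) < 1 / 2 by norm_num)),
    eventually_mul_le (a := c) (b := 1 / 2) (by norm_num)] with x x0 xr x1 hx y hy
  replace x0 : 0 < x := x0
  replace x1 : x < 1 / 2 := x1
  replace xr : x < r := xr
  have hy3 : |y| ≤ x ^ 3 := hy.trans (pow_le_pow_of_le_one x0.le (by linarith) hN)
  have hyx : x ^ 3 ≤ x := by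
    simpa using pow_le_pow_of_le_one (m := 1) x0.le (by linarith) (by norm_num : 1 ≤ 3)
  have hmem : ((x, y) : ℝ × ℝ) ∈ Metric.ball 0 r := by
    rw [mem_ball_zero_iff, Prod.norm_def]
    refine max_lt ?_ ?_
    · simpa [abs_of_pos x0] using xr
    · simp only [Real.norm_eq_abs]
      linarith
  obtain ⟨h1, h2⟩ := hb _ hmem
  have h3 : |x ^ 3 * θA (x, y) + y * θB (x, y)| ≤ c * x ^ 3 := by
    refine (abs_add_le _ _).trans ?_
    rw [abs_mul, abs_mul, abs_of_pos (show 0 < x ^ 3 by positivity)]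
    have b1 : x ^ 3 * |θA (x, y)| ≤ x ^ 3 * (|θA 0| + 1) := by gcongr
    have b2 : |y| * |θB (x, y)| ≤ x ^ 3 * (|θB 0| + 1) := by gcongr
    linarith
  have h4 : c * x ^ 3 ≤ x ^ 2 / 2 := by
    have := mul_le_mul_of_nonneg_right hx (sq_nonneg x)
    linarith
  have h5 := abs_le.1 h3
  unfold XIA
  constructor
  · linarith
  · nlinarith

lemma fderiv_YIA_axis_le (hC : ContDiffAt ℝ ∞ θC 0) (hD : ContDiffAt ℝ ∞ θD 0)
    (hE : ContDiffAt ℝ ∞ θE 0) :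
    ∃ C : ℝ, 0 ≤ C ∧ ∀ᶠ x in 𝓝 (0 : ℝ), 0 ≤ x →
      |fderiv ℝ (liftJet M (YIA θC θD θE lam N)) (x, 0) (0, jetUnit M 0)| ≤
        1 - lam * x + C * x ^ 2 := by
  set G : ℝ → ℝ := fun x => fderiv ℝ θE (x, 0) (0, 1) with hG
  have haxis : Tendsto (fun x : ℝ => (x, (0 : ℝ))) (𝓝 0) (𝓝 0) :=
    (by fun_prop : Continuous fun x : ℝ => (x, (0 : ℝ))).tendsto' 0 0 rfl
  have hGc : ContinuousAt G 0 := by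
    have h1 : ContDiffAt ℝ ∞ (fun p => fderiv ℝ θE p (0, 1)) 0 :=
      (hE.fderiv_right (m := ∞) (by rfl)).clm_apply contDiffAt_const
    exact (contDiffAt_comp_axis h1).continuousAt
  have hsmall : ∀ᶠ x in 𝓝 (0 : ℝ), |lam * x| < 1 := by
    have : Continuous fun x => |lam * x| := by fun_prop
    exact this.continuousAt.eventually_lt continuousAt_const (by simp)
  refine ⟨|θD (0, 0)| + 1 + (|G 0| + 1), by positivity, ?_⟩
  filter_upwards [eventually_abs_lt hGc,
    eventually_abs_lt (contDiffAt_comp_axis hD).continuousAt, hsmall,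
    haxis.eventually (hC.eventually_top 1), haxis.eventually (hD.eventually_top 1),
    haxis.eventually (hE.eventually_top 1),
    tendsto_axis.eventually
      ((contDiffAt_liftJet_YIA (M := M) (lam := lam) (N := N) hC hD hE).eventually_top 1),
    Iic_mem_nhds (zero_lt_one (α := ℝ))] with x h1 h2 h3 h4 h5 h6 h7 x1 x0
  have hline (θ : ℝ × ℝ → ℝ) (hθ : DifferentiableAt ℝ θ (x, 0)) :
      HasDerivAt (fun t : ℝ => θ (x, t)) (fderiv ℝ θ (x, 0) (0, 1)) 0 := by
    have e : HasDerivAt (fun t : ℝ => (x, t)) (0, 1) 0 :=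
      (hasDerivAt_const (0 : ℝ) x).prodMk (hasDerivAt_id (0 : ℝ))
    exact HasFDerivAt.comp_hasDerivAt (0 : ℝ) (l := θ) hθ.hasFDerivAt e
  have dC := hline θC (h4.differentiableAt (by simp))
  have dD := hline θD (h5.differentiableAt (by simp))
  have dE := hline θE (h6.differentiableAt (by simp))
  have e1 : HasDerivAt (fun t : ℝ => YIA θC θD θE lam N x t)
      (-(1 - lam * x + x ^ 2 * θD (x, 0)) + x ^ (N + 100) * G x) 0 := by
    have b1 := ((hasDerivAt_id (0 : ℝ)).mul dC).const_add (1 - lam * x)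
    have b2 := (b1.add (dD.const_mul (x ^ 2)))
    have b3 := ((hasDerivAt_id (0 : ℝ)).neg.mul b2).add (dE.const_mul (x ^ (N + 100)))
    have b4 := b3.congr_of_eventuallyEq (f₁ := fun t : ℝ => YIA θC θD θE lam N x t)
      (Eventually.of_forall fun t => by
        simp only [YIA, Pi.add_apply, Pi.mul_apply, Pi.neg_apply, id_eq])
    refine b4.congr_deriv ?_
    simp [hG]
  have e2 : HasDerivAt (fun t : ℝ => YIA θC θD θE lam N x t)
      (fderiv ℝ (liftJet M (YIA θC θD θE lam N)) (x, 0) (0, jetUnit M 0)) 0 := by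
    have e : HasDerivAt (fun t : ℝ => ((x, t • jetUnit M 0) : Jet M)) (0, jetUnit M 0) 0 := by
      refine (hasDerivAt_const (0 : ℝ) x).prodMk ?_
      simpa using (hasDerivAt_id (0 : ℝ)).smul_const (jetUnit M 0)
    have hd : HasFDerivAt (liftJet M (YIA θC θD θE lam N))
        (fderiv ℝ (liftJet M (YIA θC θD θE lam N)) (x, 0))
        ((fun t : ℝ => ((x, t • jetUnit M 0) : Jet M)) 0) := by
      simpa using (h7.differentiableAt (by simp)).hasFDerivAt
    have := hd.comp_hasDerivAt (0 : ℝ) e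
    refine this.congr_of_eventuallyEq (Eventually.of_forall fun t => ?_)
    simp [liftJet, jetUnit]
  rw [e2.unique e1]
  have b1 : |x ^ 2 * θD (x, 0)| ≤ x ^ 2 * (|θD (0, 0)| + 1) := by
    rw [abs_mul, abs_of_nonneg (sq_nonneg x)]
    gcongr
  have b2 : |x ^ (N + 100) * G x| ≤ x ^ 2 * (|G 0| + 1) := by
    rw [abs_mul, abs_of_nonneg (pow_nonneg x0 _)]
    have := pow_le_pow_of_le_one x0 x1 (show 2 ≤ N + 100 by omega)
    gcongr
  have b3 := abs_lt.1 h3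
  rw [abs_le] at b1 b2 ⊢
  constructor <;> linarith

lemma exists_graphTransform_IA {V : Set (ℝ × ℝ)} (hV : V ∈ 𝓝 (0 : ℝ × ℝ))
    (hA : ContDiffOn ℝ ∞ θA V) (hB : ContDiffOn ℝ ∞ θB V)
    (hC : ContDiffOn ℝ ∞ θC V) (hD : ContDiffOn ℝ ∞ θD V) (hE : ContDiffOn ℝ ∞ θE V)
    (hlam : 0 < lam) (hN : 3 ≤ N) (hMN : M + 2 ≤ N) :
    ∃ δ Λ : ℝ, GraphTransform M N δ Λ (XIA θA θB) (YIA θC θD θE lam N) := by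
  replace hA := hA.contDiffAt hV
  replace hB := hB.contDiffAt hV
  replace hC := hC.contDiffAt hV
  replace hD := hD.contDiffAt hV
  replace hE := hE.contDiffAt hV
  obtain ⟨C, hC0, hCe⟩ := fderiv_YIA_axis_le (M := M) (N := N) (lam := lam) hC hD hE
  have hs := contDiffAt_comp_axis hE
  refine exists_graphTransform hMN hN (contDiffAt_liftJet_XIA hA hB)
    (contDiffAt_liftJet_YIA hC hD hE) (one_le_totalDeriv_XIA hA hB)
    (s := fun x => x ^ 98 * θE (x, 0)) (by fun_prop) (Eventually.of_forall fun x => ?_)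
    hlam hC0 hCe (XIA_bounds hA hB hN)
  simp only [YIA]
  rw [show N + 100 = N + 2 + 98 from rfl, pow_add]
  ring

end Planar

section Iterate

variable {M N : ℕ} {δ Λ : ℝ} {X Y : ℝ → ℝ → ℝ}

lemma DependsUpTo.hasDerivAt_comp {j : ℕ} {H : Jet M → ℝ} (h : DependsUpTo j H) (hj : j + 1 ≤ M)
    {u : ℝ → Fin (M + 1) → ℝ} {x : ℝ} (hd : DifferentiableAt ℝ H (x, u x))
    (hu : ∀ (i : Fin (M + 1)) (hi : (i : ℕ) + 1 < M + 1),
      HasDerivAt (fun t => u t i) (u x ⟨i + 1, hi⟩) x) :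
    HasDerivAt (fun t => H (t, u t)) (_root_.totalDeriv H (x, u x)) x := by
  have h1 : HasDerivAt (fun t => jetTrunc M (u t)) (jetShift M (u x)) x := by
    rw [hasDerivAt_pi]
    intro i
    by_cases hi : (i : ℕ) + 1 < M + 1
    · have hi' : (i : ℕ) < M := by omega
      simpa [jetTrunc, hi', jetShift_apply_lt _ _ hi] using hu i hi
    · have hi' : ¬ (i : ℕ) < M := by omega
      simpa [jetTrunc, hi', jetShift_apply_ge _ _ hi] using hasDerivAt_const x (0 : ℝ)
  have hw : ∀ i : Fin (M + 1), (i : ℕ) ≤ j → (u x - jetTrunc M (u x)) i = 0 := by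
    intro i hi
    have hi' : (i : ℕ) < M := by omega
    simp [jetTrunc, hi']
  have h2 : HasFDerivAt H (fderiv ℝ H (x, u x)) (x, jetTrunc M (u x)) := by
    have e : (x, u x) = (x, jetTrunc M (u x)) + ((0 : ℝ), u x - jetTrunc M (u x)) := by simp
    have h3 : HasFDerivAt H (fderiv ℝ H (x, u x))
        ((x, jetTrunc M (u x)) + ((0 : ℝ), u x - jetTrunc M (u x))) := by
      rw [← e]; exact hd.hasFDerivAt
    have h4 := (hasFDerivAt_comp_add_right _).2 h3
    refine h4.congr_of_eventuallyEq (Eventually.of_forall fun z => ?_)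
    exact (h z _ hw).symm
  have h3 := HasFDerivAt.comp_hasDerivAt x (l := H) h2 ((hasDerivAt_id x).prodMk h1)
  refine h3.congr_of_eventuallyEq (Eventually.of_forall fun t => ?_)
  exact (h.apply_trunc (k := M) (by omega) t (u t)).symm

/-- `u` extends by `0` to the left of `0` and consists of the successive derivatives of its first
component, bounded by `jetBox M N Λ`. -/
structure IsJetCurve (M N : ℕ) (δ Λ : ℝ) (u : ℝ → Fin (M + 1) → ℝ) : Prop where
  eq_zero : ∀ x ≤ 0, u x = 0
  mem : ∀ x ∈ Ioo 0 δ, u x ∈ jetBox M N Λ x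
  hasDerivAt : ∀ x < δ, ∀ (i : Fin (M + 1)) (hi : (i : ℕ) + 1 < M + 1),
    HasDerivAt (fun t => u t i) (u x ⟨i + 1, hi⟩) x

lemma isJetCurve_zero (hΛ : 1 ≤ Λ) : IsJetCurve M N δ Λ 0 where
  eq_zero _ _ := rfl
  mem x hx i := by
    have := hx.1
    simp only [Pi.zero_apply, abs_zero]
    positivity
  hasDerivAt x _ i hi := by simpa using hasDerivAt_const x (0 : ℝ)

/-- A function which is `0` on the left of `0` and `O(x²)` on its right has derivative `0`. -/
lemma hasDerivAt_zero_of_abs_le {f : ℝ → ℝ} {C : ℝ} (hδ : 0 < δ) (h0 : ∀ x ≤ 0, f x = 0)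
    (h : ∀ x ∈ Ioo 0 δ, |f x| ≤ C * x ^ 2) {x : ℝ} (hx : x ≤ 0) : HasDerivAt f 0 x := by
  rcases hx.lt_or_eq with hx | rfl
  · refine (hasDerivAt_const x (0 : ℝ)).congr_of_eventuallyEq ?_
    filter_upwards [Iio_mem_nhds hx] with t ht
    exact h0 t ht.le
  · have : f =O[𝓝 0] fun x : ℝ => ‖x - 0‖ ^ 2 := by
      refine IsBigO.of_bound C ?_
      filter_upwards [Iio_mem_nhds hδ] with t ht
      rcases le_or_gt t 0 with h1 | h1
      · by_cases hC : 0 ≤ C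
        · rw [h0 t h1, norm_zero]; positivity
        · have := (abs_nonneg _).trans (h (δ / 2) ⟨by linarith, by linarith⟩)
          exact absurd (nonneg_of_mul_nonneg_left this (by positivity)) hC
      · simpa using h t ⟨h1, ht⟩
    simpa using (this.hasFDerivAt (by norm_num)).hasDerivAt

lemma IsJetCurve.abs_zero_le {u : ℝ → Fin (M + 1) → ℝ} (h : IsJetCurve M N δ Λ u) {x : ℝ}
    (hx : x ∈ Ioo 0 δ) : |u x 0| ≤ x ^ N := by
  simpa using h.mem x hx 0

namespace GraphTransform

lemma hasDerivAt_base (h : GraphTransform M N δ Λ X Y) (hM : 1 ≤ M) {u : ℝ → Fin (M + 1) → ℝ}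
    (hu : IsJetCurve M N δ Λ u) {x : ℝ} (hx : x ∈ Ioo 0 δ) :
    HasDerivAt (fun t => X t (u t 0)) (totalDeriv (liftJet M X) (x, u x)) x :=
  (dependsUpTo_liftJet X).hasDerivAt_comp (by omega) (h.diffX x hx _ (hu.mem x hx))
    (hu.hasDerivAt x hx.2)

lemma half_sub_le (h : GraphTransform M N δ Λ X Y) (hM : 1 ≤ M) {u : ℝ → Fin (M + 1) → ℝ}
    (hu : IsJetCurve M N δ Λ u) {a b : ℝ} (ha : a ∈ Ioo 0 δ) (hb : b ∈ Ioo 0 δ) (hab : a ≤ b) :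
    1 / 2 * (b - a) ≤ X b (u b 0) - X a (u a 0) := by
  refine (convex_Ioo 0 δ).mul_sub_le_image_sub_of_le_deriv (f := fun t => X t (u t 0))
    (fun x hx => (h.hasDerivAt_base hM hu hx).continuousAt.continuousWithinAt)
    (fun x hx => ?_) (fun x hx => ?_) a ha b hb hab
  · rw [interior_Ioo] at hx
    exact (h.hasDerivAt_base hM hu hx).differentiableAt.differentiableWithinAt
  · rw [interior_Ioo] at hx
    rw [(h.hasDerivAt_base hM hu hx).deriv]
    exact h.half_le x hx _ (hu.mem x hx)

lemma abs_sub_le_two_mul (h : GraphTransform M N δ Λ X Y) (hM : 1 ≤ M)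
    {u : ℝ → Fin (M + 1) → ℝ} (hu : IsJetCurve M N δ Λ u) {a b : ℝ} (ha : a ∈ Ioo 0 δ)
    (hb : b ∈ Ioo 0 δ) : |a - b| ≤ 2 * |X a (u a 0) - X b (u b 0)| := by
  rcases le_total a b with hab | hab
  · have h1 := h.half_sub_le hM hu ha hb hab
    have h2 := neg_le_abs (X a (u a 0) - X b (u b 0))
    rw [abs_of_nonpos (by linarith)]
    linarith
  · have h1 := h.half_sub_le hM hu hb ha hab
    have h2 := le_abs_self (X a (u a 0) - X b (u b 0))
    rw [abs_of_nonneg (by linarith)]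
    linarith

lemma exists_preimage (h : GraphTransform M N δ Λ X Y) {f : ℝ → ℝ} {x : ℝ} (hx : x ∈ Ioo 0 δ)
    (hf : ∀ t ∈ Ioc 0 x, |f t| ≤ t ^ N)
    (hc : ∀ t ∈ Ioc 0 x, ContinuousAt (fun t => X t (f t)) t) :
    ∃ t ∈ Icc (x / 2) x, X t (f t) = x := by
  have hx0 := hx.1
  have hx' : x / 2 ∈ Ioo 0 δ := ⟨by linarith, by linarith [hx.2]⟩
  have h1 := (h.bounds _ hx' _ (hf _ ⟨hx'.1, by linarith⟩)).2
  have h2 := (h.bounds _ hx _ (hf _ ⟨hx0, le_rfl⟩)).1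
  exact intermediate_value_Icc (f := fun t => X t (f t)) (by linarith)
    (fun t ht => (hc t ⟨by linarith [ht.1], ht.2⟩).continuousWithinAt)
    ⟨by linarith, by nlinarith⟩

/-- The graph transform of a jet curve is a jet curve. -/
lemma exists_step (h : GraphTransform M N δ Λ X Y) (hM : 1 ≤ M) (hMN : M + 2 ≤ N)
    {u : ℝ → Fin (M + 1) → ℝ} (hu : IsJetCurve M N δ Λ u) :
    ∃ v : ℝ → Fin (M + 1) → ℝ, IsJetCurve M N δ Λ v ∧
      ∀ x ∈ Ioo 0 δ, X x (u x 0) < δ → v (X x (u x 0)) 0 = Y x (u x 0) := by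
  have hf : ∀ x ∈ Ioo 0 δ, |u x 0| ≤ x ^ N := fun x hx => hu.abs_zero_le hx
  have hex : ∀ x ∈ Ioo 0 δ, ∃ t ∈ Icc (x / 2) x, X t (u t 0) = x := fun x hx =>
    h.exists_preimage hx (fun t ht => hf t ⟨ht.1, ht.2.trans_lt hx.2⟩)
      fun t ht => (h.hasDerivAt_base hM hu ⟨ht.1, ht.2.trans_lt hx.2⟩).continuousAt
  choose! g hg hgX using hex
  have hgI : ∀ x ∈ Ioo 0 δ, g x ∈ Ioo 0 δ := fun x hx =>
    ⟨by linarith [(hg x hx).1, hx.1], (hg x hx).2.trans_lt hx.2⟩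
  have hgc : ∀ x ∈ Ioo 0 δ, ContinuousAt g x := by
    intro x hx
    have h1 : Tendsto (fun t => 2 * |t - x|) (𝓝 x) (𝓝 0) :=
      (by fun_prop : Continuous fun t => 2 * |t - x|).tendsto' x 0 (by simp)
    rw [ContinuousAt, tendsto_iff_dist_tendsto_zero]
    refine squeeze_zero' (Eventually.of_forall fun _ => dist_nonneg) ?_ h1
    filter_upwards [Ioo_mem_nhds hx.1 hx.2] with t ht
    have := h.abs_sub_le_two_mul hM hu (hgI t ht) (hgI x hx)
    rwa [hgX t ht, hgX x hx] at this
  have hgd : ∀ x ∈ Ioo 0 δ,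
      HasDerivAt g (totalDeriv (liftJet M X) (g x, u (g x)))⁻¹ x := by
    intro x hx
    have h1 := h.half_le _ (hgI x hx) _ (hu.mem _ (hgI x hx))
    refine HasDerivAt.of_local_left_inverse (f := fun t => X t (u t 0)) (hgc x hx)
      (h.hasDerivAt_base hM hu (hgI x hx)) (by linarith) ?_
    filter_upwards [Ioo_mem_nhds hx.1 hx.2] with t ht using hgX t ht
  set v : ℝ → Fin (M + 1) → ℝ := fun x j =>
    if x ∈ Ioo 0 δ then prolong (liftJet M X) (liftJet M Y) j (g x, u (g x)) else 0 with hv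
  have hv1 : ∀ x ∈ Ioo 0 δ, ∀ j : Fin (M + 1),
      v x j = prolong (liftJet M X) (liftJet M Y) j (g x, u (g x)) := fun x hx j => by
    simp only [hv, if_pos hx]
  have hv0 : ∀ x ≤ 0, v x = 0 := fun x hx => by
    funext j
    have : x ∉ Ioo 0 δ := fun h => h.1.not_ge hx
    simp only [hv, if_neg this, Pi.zero_apply]
  have hvm : ∀ x ∈ Ioo 0 δ, v x ∈ jetBox M N Λ x := by
    intro x hx j
    have h0 := (hgI x hx).1.le
    have hΛ := h.one_le
    rw [hv1 x hx]
    refine (h.maps _ (hgI x hx) _ (hu.mem _ (hgI x hx)) j).trans ?_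
    have := pow_le_pow_left₀ h0 (hg x hx).2 (N - (j : ℕ))
    gcongr
  refine ⟨v, ⟨hv0, hvm, fun x hx i hi => ?_⟩, fun x hx hxδ => ?_⟩
  · rcases le_or_gt x 0 with h0 | h0
    · rw [hv0 x h0]
      refine hasDerivAt_zero_of_abs_le (C := Λ ^ M) h.delta_pos (fun t ht => by simp [hv0 t ht])
        (fun t ht => ?_) h0
      exact (norm_le_pi_norm (v t) i).trans
        (norm_le_of_mem_jetBox h.one_le ht.1.le (ht.2.le.trans h.delta_le) hMN (hvm t ht))
    · have hxI : x ∈ Ioo 0 δ := ⟨h0, hx⟩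
      have hG := hgI x hxI
      have d1 := ((dependsUpTo_liftJet X).prolong (dependsUpTo_liftJet Y) i).hasDerivAt_comp
        (by omega) (h.diffY _ hG _ (hu.mem _ hG) i) (hu.hasDerivAt _ hG.2)
      have d2 := HasDerivAt.comp x (h₂ := fun t =>
        prolong (liftJet M X) (liftJet M Y) i (t, u t)) d1 (hgd x hxI)
      rw [hv1 x hxI]
      refine d2.congr_of_eventuallyEq ?_
      filter_upwards [Ioo_mem_nhds hxI.1 hxI.2] with t ht using hv1 t ht i
  · have hpos : X x (u x 0) ∈ Ioo 0 δ :=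
      ⟨by nlinarith [(h.bounds x hx _ (hf x hx)).1, hx.1], hxδ⟩
    have h1 := h.abs_sub_le_two_mul hM hu (hgI _ hpos) hx
    rw [hgX _ hpos] at h1
    have h2 : g (X x (u x 0)) = x := by
      have := abs_nonneg (g (X x (u x 0)) - x)
      rw [sub_self, abs_zero, mul_zero] at h1
      exact sub_eq_zero.1 (abs_eq_zero.1 (le_antisymm h1 this))
    rw [hv1 _ hpos, h2]
    rfl

lemma exists_iterates (h : GraphTransform M N δ Λ X Y) (hM : 1 ≤ M) (hMN : M + 2 ≤ N) :
    ∃ u : ℕ → ℝ → Fin (M + 1) → ℝ, (∀ n, IsJetCurve M N δ Λ (u n)) ∧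
      ∀ n, ∀ x ∈ Ioo 0 δ, X x (u n x 0) < δ → u (n + 1) (X x (u n x 0)) 0 = Y x (u n x 0) := by
  choose T hT hTX using fun u : {u // IsJetCurve M N δ Λ u} => h.exists_step hM hMN u.2
  let S : {u // IsJetCurve M N δ Λ u} → {u // IsJetCurve M N δ Λ u} := fun u => ⟨T u, hT u⟩
  refine ⟨fun n => (S^[n] ⟨0, isJetCurve_zero h.one_le⟩).1, fun n => Subtype.prop _,
    fun n x hx hxδ => ?_⟩
  simp only [Function.iterate_succ_apply']
  exact hTX _ x hx hxδ

/-- One application of the graph transform does not increase the distance of two curves, and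
moves their abscissas towards `0` under backward iteration. -/
lemma exists_abs_sub_le (h : GraphTransform M N δ Λ X Y) (hM : 1 ≤ M)
    {u v u' v' : ℝ → Fin (M + 1) → ℝ} (hu : IsJetCurve M N δ Λ u) (hv : IsJetCurve M N δ Λ v)
    (hv' : IsJetCurve M N δ Λ v')
    (huu' : ∀ x ∈ Ioo 0 δ, X x (u x 0) < δ → u' (X x (u x 0)) 0 = Y x (u x 0))
    (hvv' : ∀ x ∈ Ioo 0 δ, X x (v x 0) < δ → v' (X x (v x 0)) 0 = Y x (v x 0))
    {x : ℝ} (hx : x ∈ Ioo 0 (δ / 2)) :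
    ∃ t ∈ Ioo 0 (δ / 2), 1 / x + 1 / 4 ≤ 1 / t ∧ |u' x 0 - v' x 0| ≤ |u t 0 - v t 0| := by
  have hδ := h.delta_pos
  have hx0 := hx.1
  have hxδ : x < δ := by linarith [hx.2]
  obtain ⟨t, ht, htx⟩ := h.exists_preimage (f := fun t => u t 0) ⟨hx0, hxδ⟩
    (fun t ht => hu.abs_zero_le ⟨ht.1, ht.2.trans_lt hxδ⟩)
    (fun t ht => (h.hasDerivAt_base hM hu ⟨ht.1, ht.2.trans_lt hxδ⟩).continuousAt)
  have ht0 : 0 < t := by linarith [ht.1]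
  have ht2 : t < δ / 2 := ht.2.trans_lt hx.2
  have htI : t ∈ Ioo 0 δ := ⟨ht0, by linarith⟩
  have hbu := h.bounds t htI _ (hu.abs_zero_le htI)
  have hbv := h.bounds t htI _ (hv.abs_zero_le htI)
  rw [htx] at hbu
  refine ⟨t, ⟨ht0, ht2⟩, ?_, ?_⟩
  · have : 1 / t - 1 / x = (x - t) / (t * x) := by field_simp
    have h2 : 1 / 4 ≤ (x - t) / (t * x) := by
      rw [div_le_div_iff₀ (by norm_num) (by positivity)]
      nlinarith
    linarith
  · have e1 := huu' t htI (by rw [htx]; linarith [hx.2])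
    have e2 := hvv' t htI (by linarith)
    rw [htx] at e1
    set ξ := X t (v t 0) with hξ
    have hξ0 : 0 < ξ := by nlinarith [hbv.1]
    have h1 : ‖v' x 0 - v' ξ 0‖ ≤ Λ * (2 * t) ^ (N - 1) * ‖x - ξ‖ := by
      refine (convex_Ioc 0 (2 * t)).norm_image_sub_le_of_norm_hasDerivWithin_le
        (f := fun s => v' s 0) (f' := fun s => v' s ⟨0 + 1, by omega⟩) (fun s hs => ?_)
        (fun s hs => ?_) ⟨hξ0, hbv.2⟩ ⟨hx0, hbu.2⟩
      · exact (hv'.hasDerivAt s (by linarith [hs.2]) 0 (by rw [Fin.val_zero]; omega)).hasDerivWithinAt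
      · have h3 := hv'.mem s ⟨hs.1, by linarith [hs.2]⟩ ⟨0 + 1, by omega⟩
        have hΛ := h.one_le
        have h4 := pow_le_pow_left₀ hs.1.le hs.2 (N - 1)
        simp only [zero_add, pow_one] at h3
        exact h3.trans (by gcongr)
    have h2 := h.contracts t htI _ _ (hu.abs_zero_le htI) (hv.abs_zero_le htI)
    rw [htx, ← hξ, ← e1, ← e2] at h2
    simp only [Real.norm_eq_abs] at h1
    have h3 := abs_sub_le (u' x 0) (v' ξ 0) (v' x 0)
    rw [abs_sub_comm (v' ξ 0)] at h3
    linarith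

lemma abs_iterates_sub_le (h : GraphTransform M N δ Λ X Y) (hM : 1 ≤ M) (hN : 1 ≤ N)
    {u : ℕ → ℝ → Fin (M + 1) → ℝ} (hu : ∀ n, IsJetCurve M N δ Λ (u n))
    (hstep : ∀ n, ∀ x ∈ Ioo 0 δ, X x (u n x 0) < δ →
      u (n + 1) (X x (u n x 0)) 0 = Y x (u n x 0)) (n m : ℕ) :
    ∀ x ∈ Ioo 0 (δ / 2), |u (n + m) x 0 - u n x 0| ≤ 2 / (1 / x + n / 4) := by
  induction n with
  | zero =>
    intro x hx
    have hx0 := hx.1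
    have hxI : x ∈ Ioo 0 δ := ⟨hx0, by linarith [hx.2]⟩
    have h1 := pow_le_pow_of_le_one hx0.le (hxI.2.le.trans h.delta_le) hN
    have h2 := (hu (0 + m)).abs_zero_le hxI
    have h3 := (hu 0).abs_zero_le hxI
    have h4 := abs_sub (u (0 + m) x 0) (u 0 x 0)
    simp only [Nat.cast_zero, zero_div, add_zero, div_div_eq_mul_div, div_one]
    linarith
  | succ n ih =>
    intro x hx
    have hx0 := hx.1
    obtain ⟨t, ht, htx, hle⟩ := h.exists_abs_sub_le hM (hu (n + m)) (hu n) (hu (n + 1))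
      (hstep (n + m)) (hstep n) hx
    rw [show n + 1 + m = n + m + 1 by omega]
    refine hle.trans ((ih t ht).trans ?_)
    push_cast
    exact div_le_div_of_nonneg_left (by norm_num) (by positivity) (by linarith)

lemma uniformCauchySeqOn_iterates (h : GraphTransform M N δ Λ X Y) (hM : 1 ≤ M) (hN : 1 ≤ N)
    {u : ℕ → ℝ → Fin (M + 1) → ℝ} (hu : ∀ n, IsJetCurve M N δ Λ (u n))
    (hstep : ∀ n, ∀ x ∈ Ioo 0 δ, X x (u n x 0) < δ →
      u (n + 1) (X x (u n x 0)) 0 = Y x (u n x 0)) :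
    UniformCauchySeqOn (fun n x => u n x 0) atTop (Iio (δ / 2)) := by
  have key (n m : ℕ) (hnm : n ≤ m) (x : ℝ) (hx : x < δ / 2) :
      |u m x 0 - u n x 0| ≤ 8 / (n + 1) := by
    rcases le_or_gt x 0 with h0 | h0
    · simp only [(hu _).eq_zero x h0, sub_self, abs_zero]
      positivity
    · obtain ⟨k, rfl⟩ := Nat.exists_eq_add_of_le hnm
      refine (h.abs_iterates_sub_le hM hN hu hstep n k x ⟨h0, hx⟩).trans ?_
      have h1 : 1 ≤ 1 / x := by
        rw [le_div_iff₀ h0]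
        linarith [h.delta_le, h.delta_pos]
      rw [div_le_div_iff₀ (by positivity) (by positivity)]
      linarith
  rw [Metric.uniformCauchySeqOn_iff]
  intro ε hε
  obtain ⟨k, hk⟩ := exists_nat_one_div_lt (show 0 < ε / 16 by positivity)
  have hk' : (8 : ℝ) / (k + 1) < ε / 2 := by
    rw [div_lt_iff₀ (by positivity)] at hk ⊢
    linarith
  refine ⟨k, fun m hm n hn x hx => ?_⟩
  have h1 := key k m hm x hx
  have h2 := key k n hn x hx
  rw [Real.dist_eq]
  have h3 := abs_sub_le (u m x 0) (u k x 0) (u n x 0)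
  rw [abs_sub_comm (u k x 0)] at h3
  linarith

end GraphTransform

/-- If `f n` converges uniformly and the second derivatives are bounded, then the first derivatives
converge uniformly. -/
lemma UniformCauchySeqOn.of_hasDerivAt {f g k : ℕ → ℝ → ℝ} {c K : ℝ}
    (hf : ∀ n, ∀ x < c, HasDerivAt (f n) (g n x) x)
    (hg : ∀ n, ∀ x < c, HasDerivAt (g n) (k n x) x) (hK : ∀ n, ∀ x < c, |k n x| ≤ K)
    (h : UniformCauchySeqOn f atTop (Iio c)) : UniformCauchySeqOn g atTop (Iio c) := by
  have hK0 : 0 ≤ K := (abs_nonneg _).trans (hK 0 (c - 1) (by linarith))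
  rw [Metric.uniformCauchySeqOn_iff] at h ⊢
  intro ε hε
  set t := ε / (4 * (K + 1)) with ht
  have ht0 : 0 < t := by positivity
  have htK : 2 * K * t < ε / 2 := by
    have : t * (4 * (K + 1)) = ε := by rw [ht]; field_simp
    linarith
  obtain ⟨n₀, hn₀⟩ := h (t * ε / 4) (by positivity)
  refine ⟨n₀, fun m hm n hn x hx => ?_⟩
  replace hx : x < c := hx
  have hxt : x - t < x := by linarith
  obtain ⟨ξ, hξ, hξe⟩ := exists_hasDerivAt_eq_slope (fun s => f m s - f n s)
    (fun s => g m s - g n s) hxt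
    (fun s hs => ((hf m s (hs.2.trans_lt hx)).sub
      (hf n s (hs.2.trans_lt hx))).continuousAt.continuousWithinAt)
    (fun s hs => (hf m s (hs.2.trans hx)).sub (hf n s (hs.2.trans hx)))
  have h1 := hn₀ m hm n hn x hx
  have h2 := hn₀ m hm n hn (x - t) (hxt.trans hx)
  rw [Real.dist_eq] at h1 h2 ⊢
  have h3 : |g m ξ - g n ξ| < ε / 2 := by
    rw [hξe, sub_sub_cancel, abs_div, abs_of_pos ht0, div_lt_iff₀ ht0]
    have := abs_sub (f m x - f n x) (f m (x - t) - f n (x - t))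
    linarith
  have h4 : ‖(g m x - g n x) - (g m ξ - g n ξ)‖ ≤ 2 * K * ‖x - ξ‖ := by
    refine (convex_Iio c).norm_image_sub_le_of_norm_hasDerivWithin_le
      (f := fun s => g m s - g n s) (f' := fun s => k m s - k n s)
      (fun s hs => ((hg m s hs).sub (hg n s hs)).hasDerivWithinAt) (fun s hs => ?_)
      (hξ.2.trans hx) hx
    have b1 := abs_sub (k m s) (k n s)
    have b2 := hK m s hs
    have b3 := hK n s hs
    rw [Real.norm_eq_abs]
    linarith
  rw [Real.norm_eq_abs, Real.norm_eq_abs, abs_of_pos (sub_pos.2 hξ.2)] at h4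
  have h5 : 2 * K * (x - ξ) ≤ 2 * K * t := by
    have := hξ.1
    gcongr
    linarith
  have h6 := abs_add_le ((g m x - g n x) - (g m ξ - g n ξ)) (g m ξ - g n ξ)
  rw [sub_add_cancel] at h6
  linarith

namespace GraphTransform

lemma continuousAt_fst (h : GraphTransform M N δ Λ X Y) {x y : ℝ} (hx : x ∈ Ioo 0 δ)
    (hy : |y| ≤ x ^ N) : ContinuousAt (fun p : ℝ × ℝ => X p.1 p.2) (x, y) := by
  have h1 := (h.diffX x hx _ (smul_jetUnit_mem_jetBox h.one_le hx.1.le hy)).continuousAt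
  have h2 : ContinuousAt (fun p : ℝ × ℝ => ((p.1, p.2 • jetUnit M 0) : Jet M)) (x, y) := by fun_prop
  have h3 := ContinuousAt.comp (x := (x, y)) (g := liftJet M X) h1 h2
  refine h3.congr (Eventually.of_forall fun p => ?_)
  simp [liftJet, jetUnit]

lemma continuousAt_snd (h : GraphTransform M N δ Λ X Y) {x y : ℝ} (hx : x ∈ Ioo 0 δ)
    (hy : |y| ≤ x ^ N) : ContinuousAt (fun p : ℝ × ℝ => Y p.1 p.2) (x, y) := by
  have h1 : ContinuousAt (liftJet M Y) (x, y • jetUnit M 0) :=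
    (h.diffY x hx _ (smul_jetUnit_mem_jetBox h.one_le hx.1.le hy) 0).continuousAt
  have h2 : ContinuousAt (fun p : ℝ × ℝ => ((p.1, p.2 • jetUnit M 0) : Jet M)) (x, y) := by fun_prop
  have h3 := ContinuousAt.comp (x := (x, y)) (g := liftJet M Y) h1 h2
  refine h3.congr (Eventually.of_forall fun p => ?_)
  simp [liftJet, jetUnit]

/-- The graph transform has an invariant function: `F 0`, with successive derivatives `F j`. -/
lemma exists_invariant (h : GraphTransform M N δ Λ X Y) (hM : 1 ≤ M) (hMN : M + 2 ≤ N) :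
    ∃ F : ℕ → ℝ → ℝ, (∀ j < M, ∀ x ≤ 0, F j x = 0) ∧
      (∀ j < M, ∀ x ∈ Ioo 0 (δ / 2), |F j x| ≤ Λ ^ j * x ^ (N - j)) ∧
      (∀ j < M, ContinuousOn (F j) (Iio (δ / 2))) ∧
      (∀ j, j + 1 < M → ∀ x < δ / 2, HasDerivAt (F j) (F (j + 1) x) x) ∧
      ∀ x ∈ Ioo 0 (δ / 2), X x (F 0 x) < δ / 2 → F 0 (X x (F 0 x)) = Y x (F 0 x) := by
  have hδ := h.delta_pos
  obtain ⟨u, hu, hstep⟩ := h.exists_iterates hM hMN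
  set f : ℕ → ℕ → ℝ → ℝ := fun j n x => if hj : j < M + 1 then u n x ⟨j, hj⟩ else 0 with hf
  have hfu (j : ℕ) (hj : j < M + 1) (n : ℕ) (x : ℝ) : f j n x = u n x ⟨j, hj⟩ := by
    simp only [hf, dif_pos hj]
  have hfd (j : ℕ) (hj : j + 1 < M + 1) (n : ℕ) (x : ℝ) (hx : x < δ / 2) :
      HasDerivAt (f j n) (f (j + 1) n x) x := by
    have h1 := (hu n).hasDerivAt x (by linarith) ⟨j, by omega⟩ hj
    rw [hfu _ hj]
    exact h1.congr_of_eventuallyEq (Eventually.of_forall fun t => hfu _ _ n t)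
  have hf0 (j : ℕ) (n : ℕ) (x : ℝ) (hx : x ≤ 0) : f j n x = 0 := by
    simp only [hf, (hu n).eq_zero x hx, Pi.zero_apply, dite_eq_ite, ite_self]
  have hfb (j : ℕ) (hj : j < M + 1) (n : ℕ) (x : ℝ) (hx : x ∈ Ioo 0 (δ / 2)) :
      |f j n x| ≤ Λ ^ j * x ^ (N - j) := by
    rw [hfu j hj]
    exact (hu n).mem x ⟨hx.1, by linarith [hx.2]⟩ ⟨j, hj⟩
  have hfK (j : ℕ) (hj : j < M + 1) (n : ℕ) (x : ℝ) (hx : x < δ / 2) : |f j n x| ≤ Λ ^ j := by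
    have hΛ : 0 ≤ Λ ^ j := pow_nonneg (zero_le_one.trans h.one_le) j
    rcases le_or_gt x 0 with h0 | h0
    · rwa [hf0 j n x h0, abs_zero]
    · refine (hfb j hj n x ⟨h0, hx⟩).trans (mul_le_of_le_one_right hΛ ?_)
      exact pow_le_one₀ h0.le (by linarith [h.delta_le])
  have hcauchy (j : ℕ) (hj : j < M) : UniformCauchySeqOn (f j) atTop (Iio (δ / 2)) := by
    induction j with
    | zero =>
      have := h.uniformCauchySeqOn_iterates hM (by omega) hu hstep
      exact this
    | succ j ih =>
      exact (ih (by omega)).of_hasDerivAt (hfd j (by omega)) (hfd (j + 1) (by omega))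
        (hfK (j + 2) (by omega))
  have hlim (j : ℕ) (hj : j < M) (x : ℝ) (hx : x < δ / 2) :
      ∃ l, Tendsto (fun n => f j n x) atTop (𝓝 l) :=
    cauchySeq_tendsto_of_complete ((hcauchy j hj).cauchySeq hx)
  choose! G hG using hlim
  set F : ℕ → ℝ → ℝ := fun j x => if x ≤ 0 then 0 else G j x with hF
  have hF0 (j : ℕ) (x : ℝ) (hx : x ≤ 0) : F j x = 0 := if_pos hx
  have hFt (j : ℕ) (hj : j < M) (x : ℝ) (hx : x < δ / 2) :
      Tendsto (fun n => f j n x) atTop (𝓝 (F j x)) := by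
    rcases le_or_gt x 0 with h0 | h0
    · simp only [hF0 j x h0, hf0 j _ x h0, tendsto_const_nhds]
    · simpa only [hF, if_neg h0.not_ge] using hG j hj x hx
  have hFu (j : ℕ) (hj : j < M) : TendstoUniformlyOn (f j) (F j) atTop (Iio (δ / 2)) :=
    (hcauchy j hj).tendstoUniformlyOn_of_tendsto (hFt j hj)
  have hFb (j : ℕ) (hj : j < M) (x : ℝ) (hx : x ∈ Ioo 0 (δ / 2)) :
      |F j x| ≤ Λ ^ j * x ^ (N - j) :=
    le_of_tendsto (hFt j hj x hx.2).abs (Eventually.of_forall fun n => hfb j (by omega) n x hx)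
  have hFc (j : ℕ) (hj : j < M) : ContinuousOn (F j) (Iio (δ / 2)) :=
    (hFu j hj).continuousOn (Eventually.of_forall fun n x hx =>
      (hfd j (by omega) n x hx).continuousAt.continuousWithinAt).frequently
  refine ⟨F, fun j _ => hF0 j, hFb, hFc, fun j hj x hx => ?_, fun x hx hX => ?_⟩
  · exact hasDerivAt_of_tendstoUniformlyOn isOpen_Iio (hFu (j + 1) hj)
      (Eventually.of_forall fun n x hx => hfd j (by omega) n x hx) (hFt j (by omega)) hx
  · have hxI : x ∈ Ioo 0 δ := ⟨hx.1, by linarith [hx.2]⟩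
    have hFx : |F 0 x| ≤ x ^ N := by simpa using hFb 0 (by omega) x hx
    have ht : Tendsto (fun n => (x, u n x 0)) atTop (𝓝 (x, F 0 x)) :=
      tendsto_const_nhds.prodMk_nhds (hFt 0 (by omega) x hx.2)
    have hXt : Tendsto (fun n => X x (u n x 0)) atTop (𝓝 (X x (F 0 x))) :=
      (h.continuousAt_fst hxI hFx).tendsto.comp ht
    have hYt : Tendsto (fun n => Y x (u n x 0)) atTop (𝓝 (Y x (F 0 x))) :=
      (h.continuousAt_snd hxI hFx).tendsto.comp ht
    have hlt : ∀ᶠ n in atTop, X x (u n x 0) < δ / 2 := hXt.eventually_lt_const hX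
    have hs : TendstoUniformlyOn (fun n => f 0 (n + 1)) (F 0) atTop (Iio (δ / 2)) :=
      fun v hv => (tendsto_add_atTop_nat 1).eventually (hFu 0 (by omega) v hv)
    have h1 := hs.tendsto_comp (hFc 0 (by omega) _ hX)
      (tendsto_nhdsWithin_iff.2 ⟨hXt, hlt⟩)
    refine tendsto_nhds_unique h1 (hYt.congr' ?_)
    filter_upwards [hlt] with n hn
    rw [← hstep n x hxI (by linarith)]
    exact (hfu 0 (by omega) _ _).symm

end GraphTransform

end Iterate

lemma iteratedDerivWithin_eq_of_hasDerivAt {F : ℕ → ℝ → ℝ} {s : Set ℝ} (hs : UniqueDiffOn ℝ s)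
    {n : ℕ} (h : ∀ j < n, ∀ x ∈ s, HasDerivAt (F j) (F (j + 1) x) x) {j : ℕ} (hj : j ≤ n) :
    EqOn (iteratedDerivWithin j (F 0) s) (F j) s := by
  induction j with
  | zero => intro x _; simp
  | succ j ih =>
    intro x hx
    have h1 := ih (by omega)
    rw [iteratedDerivWithin_succ, derivWithin_congr h1 (h1 hx)]
    exact (h j (by omega) x hx).hasDerivWithinAt.derivWithin (hs x hx)

lemma contDiffOn_of_hasDerivAt {F : ℕ → ℝ → ℝ} {s : Set ℝ} (hs : UniqueDiffOn ℝ s)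
    {n : ℕ} (h : ∀ j < n, ∀ x ∈ s, HasDerivAt (F j) (F (j + 1) x) x)
    (hc : ∀ j ≤ n, ContinuousOn (F j) s) : ContDiffOn ℝ n (F 0) s := by
  rw [contDiffOn_nat_iff_continuousOn_differentiableOn_deriv hs]
  refine ⟨fun m hm => ?_, fun m hm => ?_⟩
  · exact (hc m hm).congr (iteratedDerivWithin_eq_of_hasDerivAt hs h hm)
  · have h1 : DifferentiableOn ℝ (F m) s := fun x hx =>
      (h m hm x hx).differentiableAt.differentiableWithinAt
    exact h1.congr (iteratedDerivWithin_eq_of_hasDerivAt hs h hm.le)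

/-- **Assertion 7.** Let `N ≥ 100` and let `Φ` be of the form (IA).
Then there exist `δ > 0`, constants `K 1, …, K (N-11) > 0`, and `F ∈ C^(N-11)([0,δ])`
with: (i) `|F(x)| ≤ xᴺ` on `[0,δ]`; (ii) `|F⁽ᵐ⁾(x)| ≤ K_m x^(N-m)` on `[0,δ]` for
`1 ≤ m ≤ N-11`; (iii) every `x̄ ∈ [0, δ/2]` admits `x̂ ∈ [0, x̄]` with
`(x̄, F(x̄)) = Φ(x̂, F(x̂))`. -/
theorem assertion7
    (θA θB θC θD θE : ℝ × ℝ → ℝ) (V : Set (ℝ × ℝ)) (hV : V ∈ 𝓝 (0 : ℝ × ℝ))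
    (hθA : ContDiffOn ℝ (⊤ : ℕ∞) θA V) (hθB : ContDiffOn ℝ (⊤ : ℕ∞) θB V)
    (hθC : ContDiffOn ℝ (⊤ : ℕ∞) θC V) (hθD : ContDiffOn ℝ (⊤ : ℕ∞) θD V)
    (hθE : ContDiffOn ℝ (⊤ : ℕ∞) θE V)
    (lam : ℝ) (hlam : 0 < lam) (N : ℕ) (hN : 100 ≤ N)
    :
    ∃ δ > (0 : ℝ), ∃ K : ℕ → ℝ, (∀ m : ℕ, 1 ≤ m → m ≤ N - 11 → 0 < K m) ∧
      ∃ F : ℝ → ℝ,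
        ContDiffOn ℝ ((N - 11 : ℕ) : ℕ∞) F (Icc 0 δ) ∧
        (∀ x ∈ Icc (0 : ℝ) δ, |F x| ≤ x ^ N) ∧
        (∀ m : ℕ, 1 ≤ m → m ≤ N - 11 → ∀ x ∈ Icc (0 : ℝ) δ,
          |iteratedDerivWithin m F (Icc 0 δ) x| ≤ K m * x ^ (N - m)) ∧
        (∀ xb ∈ Icc (0 : ℝ) (δ / 2), ∃ xh ∈ Icc (0 : ℝ) xb,
          (xb, F xb) = (XIA θA θB xh (F xh), YIA θC θD θE lam N xh (F xh))) := by
  obtain ⟨δ, Λ, h⟩ := exists_graphTransform_IA (M := N - 10) (N := N) hV hθA hθB hθC hθD hθE hlam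
    (by omega) (by omega)
  have hδ := h.delta_pos
  have hΛ : 0 < Λ := zero_lt_one.trans_le h.one_le
  obtain ⟨F, hF0, hFb, hFc, hFd, hFi⟩ := h.exists_invariant (by omega) (by omega)
  have hs : UniqueDiffOn ℝ (Icc 0 (δ / 4)) := uniqueDiffOn_Icc (by linarith)
  have hb (j : ℕ) (hj : j ≤ N - 11) (x : ℝ) (hx : x ∈ Icc 0 (δ / 4)) :
      |F j x| ≤ Λ ^ j * x ^ (N - j) := by
    rcases hx.1.eq_or_lt with rfl | h0
    · rw [hF0 j (by omega) 0 le_rfl, abs_zero]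
      positivity
    · exact hFb j (by omega) x ⟨h0, by linarith [hx.2]⟩
  have hd : ∀ j < N - 11, ∀ x ∈ Icc 0 (δ / 4), HasDerivAt (F j) (F (j + 1) x) x :=
    fun j hj x hx => hFd j (by omega) x (by linarith [hx.2])
  refine ⟨δ / 4, by linarith, fun m => Λ ^ m, fun m _ _ => pow_pos hΛ m, F 0,
    contDiffOn_of_hasDerivAt hs hd fun j hj => (hFc j (by omega)).mono fun x hx => ?_,
    fun x hx => by simpa using hb 0 (by omega) x hx, fun m _ hm x hx => ?_, fun xb hxb => ?_⟩
  · rw [mem_Iio]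
    linarith [hx.2]
  · rw [iteratedDerivWithin_eq_of_hasDerivAt hs hd hm hx]
    exact hb m hm x hx
  · rcases hxb.1.eq_or_lt with rfl | h0
    · refine ⟨0, ⟨le_rfl, le_rfl⟩, ?_⟩
      simp [hF0 0 (by omega) 0 le_rfl, XIA, YIA]
    · have hlt : xb < δ / 2 := by linarith [hxb.2]
      have hf (t : ℝ) (ht : t ∈ Ioc 0 xb) : |F 0 t| ≤ t ^ N := by
        simpa using hFb 0 (by omega) t ⟨ht.1, ht.2.trans_lt hlt⟩
      obtain ⟨t, ht, hX⟩ := h.exists_preimage (f := F 0) ⟨h0, by linarith⟩ hf fun t ht => by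
        have h1 := h.continuousAt_fst ⟨ht.1, by linarith [ht.2]⟩ (hf t ht)
        have h2 : ContinuousAt (F 0) t :=
          (hFc 0 (by omega)).continuousAt (Iio_mem_nhds (ht.2.trans_lt hlt))
        exact ContinuousAt.comp (x := t) (f := fun t => (t, F 0 t)) h1 (continuousAt_id.prodMk h2)
      have h1 := hFi t ⟨by linarith [ht.1], ht.2.trans_lt hlt⟩ (by rwa [hX])
      rw [hX] at h1
      exact ⟨t, ⟨by linarith [ht.1], ht.2⟩, by rw [hX, h1]⟩
end
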